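/- arXiv:2205.01792 — 2 statements merged into one kernel-verified Lean document; each statement's English description precedes it below -/
import Mathlib

section
/- Let G be a group generated by a finite set S of involutions, acting faithfully on a Cantor set X. Suppose there exists a singular point ξ ∈ X such that: (1) the orbital graphs of regular points are linearly repetitive; (2) the orbital graphs of regular points are quasi-isometric to ℝ, while the orbital graph of ξ is quasi-isometric to [0, ∞); (3) the group of germs of ξ is finite (an elementary abelian 2-group) and for every g ∈ G_ξ the interior of the set of fixed points of g accumulates on ξ. Then there exists α ∈ (0, 1) such that the growth of G satisfies γ_G(R) ≼ exp(R^α). -/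
noncomputable section

namespace GermGrowth

variable {G X : Type} [Group G] [TopologicalSpace X]

/-- The product in `G` of a word over the generating set `S`. -/
def wordProd (S : Set G) (w : List S) : G := (w.map (fun s => (s : G))).prod

/-- The ball of radius `R` in the group `G` with respect to `S`. -/
def ballG (S : Set G) (R : ℕ) : Set G :=
  {g | ∃ w : List S, w.length ≤ R ∧ wordProd S w = g}

/-- `γ_G(R)`: the growth function of `G` with respect to `S`. -/
def groupGrowth (S : Set G) (R : ℕ) : ℕ := Nat.card (ballG S R)

/-- The orbit of a point under the right action `act`. -/
def orbit (act : X → G → X) (ξ : X) : Set X := {x | ∃ g : G, act ξ g = x}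

/-- The stabilizer `G_ξ` of a point. -/
def stab (act : X → G → X) (ξ : X) : Set G := {g | act ξ g = ξ}

/-- `G_{(ξ)}`: the elements acting trivially on a neighborhood of `ξ`. -/
def germTrivial (act : X → G → X) (ξ : X) : Set G :=
  {g | ∃ U ∈ nhds ξ, ∀ x ∈ U, act x g = x}

/-- A point is regular if `G_ξ = G_{(ξ)}`, i.e. every stabilizing element acts
trivially near `ξ`. -/
def IsRegular (act : X → G → X) (ξ : X) : Prop :=
  stab act ξ ⊆ germTrivial act ξ

/-- Two group elements have the same germ at `ξ`. -/
def SameGerm (act : X → G → X) (ξ : X) (g h : G) : Prop :=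
  ∃ U ∈ nhds ξ, ∀ x ∈ U, act x g = act x h

/-- The ball of radius `R` centered at `ζ` in the orbital graph `Γ_ζ`. -/
def oball (act : X → G → X) (S : Set G) (ζ : X) (R : ℕ) : Set X :=
  {x | ∃ w : List S, w.length ≤ R ∧ act ζ (wordProd S w) = x}

/-- Graph distance in the orbital graph (for a symmetric set `S`). -/
def odist (act : X → G → X) (S : Set G) (x y : X) : ℕ :=
  sInf {n | ∃ w : List S, w.length = n ∧ act x (wordProd S w) = y}

/-- The orbital graph of `ξ` is quasi-isometric to the half-line `[0, ∞)`. -/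
def QIToHalfLine (act : X → G → X) (S : Set G) (ξ : X) : Prop :=
  ∃ (φ : X → ℝ) (Λ c : ℝ), 1 ≤ Λ ∧ 0 ≤ c ∧
    (∀ x ∈ orbit act ξ, 0 ≤ φ x) ∧
    (∀ x ∈ orbit act ξ, ∀ y ∈ orbit act ξ,
      Λ⁻¹ * (odist act S x y : ℝ) - c ≤ |φ x - φ y| ∧
      |φ x - φ y| ≤ Λ * (odist act S x y : ℝ) + c) ∧
    (∀ r : ℝ, 0 ≤ r → ∃ x ∈ orbit act ξ, |φ x - r| ≤ c)

/-- The orbital graph of `ξ` is quasi-isometric to the line `ℝ`. -/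
def QIToLine (act : X → G → X) (S : Set G) (ξ : X) : Prop :=
  ∃ (φ : X → ℝ) (Λ c : ℝ), 1 ≤ Λ ∧ 0 ≤ c ∧
    (∀ x ∈ orbit act ξ, ∀ y ∈ orbit act ξ,
      Λ⁻¹ * (odist act S x y : ℝ) - c ≤ |φ x - φ y| ∧
      |φ x - φ y| ≤ Λ * (odist act S x y : ℝ) + c) ∧
    (∀ r : ℝ, ∃ x ∈ orbit act ξ, |φ x - r| ≤ c)

set_option linter.unusedSectionVars false

/-- A right action of `G` on `X`, with `G` generated by the finite set `S` of involutions. -/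
structure RightAct (act : X → G → X) (S : Set G) : Prop where
  one : ∀ x : X, act x 1 = x
  mul : ∀ (x : X) (g h : G), act (act x g) h = act x (g * h)
  invol : ∀ s ∈ S, s * s = 1
  gen : Subgroup.closure S = ⊤
  fin : S.Finite

section Balls

variable {S : Set G}

theorem wordProd_append (u v : List S) :
    wordProd S (u ++ v) = wordProd S u * wordProd S v := by
  simp [wordProd]

theorem one_mem_ballG (n : ℕ) : (1 : G) ∈ ballG S n := ⟨[], by simp, by simp [wordProd]⟩

theorem ballG_mono {m n : ℕ} (h : m ≤ n) : ballG S m ⊆ ballG S n := by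
  rintro g ⟨w, hw, rfl⟩
  exact ⟨w, hw.trans h, rfl⟩

theorem mul_mem_ballG {m n : ℕ} {g h : G} (hg : g ∈ ballG S m) (hh : h ∈ ballG S n) :
    g * h ∈ ballG S (m + n) := by
  obtain ⟨u, hu, rfl⟩ := hg
  obtain ⟨v, hv, rfl⟩ := hh
  exact ⟨u ++ v, by simp; omega, wordProd_append u v⟩

theorem mem_ballG_one {s : G} (hs : s ∈ S) : s ∈ ballG S 1 :=
  ⟨[⟨s, hs⟩], by simp, by simp [wordProd]⟩

theorem inv_mem_ballG (hinv : ∀ s ∈ S, s * s = 1) {n : ℕ} {g : G} (hg : g ∈ ballG S n) :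
    g⁻¹ ∈ ballG S n := by
  obtain ⟨w, hw, rfl⟩ := hg
  refine ⟨w.reverse, by simpa using hw, ?_⟩
  clear hw
  induction w with
  | nil => simp [wordProd]
  | cons a w ih =>
    have ha : (a : G)⁻¹ = a := inv_eq_of_mul_eq_one_left (hinv a a.2)
    have : wordProd S (a :: w) = a * wordProd S w := by simp [wordProd]
    rw [List.reverse_cons, wordProd_append, ih, this, mul_inv_rev, ha]
    simp [wordProd]

theorem exists_mem_ballG (hinv : ∀ s ∈ S, s * s = 1) (hgen : Subgroup.closure S = ⊤) (g : G) :
    ∃ n, g ∈ ballG S n := by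
  have hg : g ∈ Subgroup.closure S := by rw [hgen]; trivial
  induction hg using Subgroup.closure_induction with
  | mem x hx => exact ⟨1, mem_ballG_one hx⟩
  | one => exact ⟨0, one_mem_ballG 0⟩
  | mul x y _ _ hx hy =>
    obtain ⟨m, hm⟩ := hx
    obtain ⟨n, hn⟩ := hy
    exact ⟨m + n, mul_mem_ballG hm hn⟩
  | inv x _ hx =>
    obtain ⟨m, hm⟩ := hx
    exact ⟨m, inv_mem_ballG hinv hm⟩

theorem ballG_finite (hS : S.Finite) (n : ℕ) : (ballG S n).Finite := by
  have : Finite S := hS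
  refine ((List.finite_length_le S n).image (wordProd S)).subset ?_
  rintro g ⟨w, hw, rfl⟩
  exact ⟨w, hw, rfl⟩

theorem ballG_split {n k : ℕ} {g : G} (hg : g ∈ ballG S n) :
    ∃ a ∈ ballG S k, ∃ b ∈ ballG S (n - k), g = a * b := by
  obtain ⟨w, hw, rfl⟩ := hg
  refine ⟨wordProd S (w.take k), ⟨_, by simp, rfl⟩, wordProd S (w.drop k),
    ⟨_, by simp; omega, rfl⟩, ?_⟩
  rw [← wordProd_append, List.take_append_drop]

theorem eq_one_of_mem_ballG_zero {g : G} (hg : g ∈ ballG S 0) : g = 1 := by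
  obtain ⟨w, hw, rfl⟩ := hg
  simp at hw
  simp [hw, wordProd]

end Balls

/-- A path in the Cayley graph, allowed to pause. -/
def IsPath (S : Set G) (P : ℕ → G) : Prop := ∀ t, ∃ s ∈ ballG S 1, P (t + 1) = P t * s

theorem exists_path {S : Set G} {R : ℕ} {g : G} (hg : g ∈ ballG S R) :
    ∃ P : ℕ → G, IsPath S P ∧ P 0 = 1 ∧ P R = g := by
  obtain ⟨w, hw, rfl⟩ := hg
  refine ⟨fun t => wordProd S (w.take t), fun t => ?_, by simp [wordProd], ?_⟩
  · have h : wordProd S ((w.drop t).take 1) ∈ ballG S 1 := ⟨(w.drop t).take 1, by simp, rfl⟩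
    refine ⟨_, h, ?_⟩
    simp only [← wordProd_append, ← List.take_add]
  · simp only []
    rw [List.take_of_length_le hw]

section Metric

variable {act : X → G → X} {S : Set G}

theorem odist_le {n : ℕ} {x y : X} {g : G} (hg : g ∈ ballG S n) (h : act x g = y) :
    odist act S x y ≤ n := by
  obtain ⟨w, hw, rfl⟩ := hg
  have hm : w.length ∈ {n | ∃ w : List S, w.length = n ∧ act x (wordProd S w) = y} := ⟨w, rfl, h⟩
  exact (Nat.sInf_le hm).trans hw

namespace RightAct

variable (A : RightAct act S)
include A

theorem inv_mem {n : ℕ} {g : G} (hg : g ∈ ballG S n) : g⁻¹ ∈ ballG S n :=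
  inv_mem_ballG A.invol hg

theorem act_inv {x y : X} {g : G} (h : act x g = y) : act y g⁻¹ = x := by
  rw [← h, A.mul, mul_inv_cancel, A.one]

theorem act_left_inj {x y : X} (g : G) : act x g = act y g ↔ x = y := by
  refine ⟨fun h => ?_, fun h => by rw [h]⟩
  have := A.act_inv h
  rw [A.mul, mul_inv_cancel, A.one] at this
  exact this.symm

theorem act_eq_iff {x : X} {g h : G} : act x g = act x h ↔ act x (g * h⁻¹) = x := by
  rw [← A.act_left_inj (x := act x (g * h⁻¹)) h, A.mul]
  simp

theorem mem_orbit (c : X) (g : G) : act c g ∈ orbit act c := ⟨g, rfl⟩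

theorem self_mem_orbit (c : X) : c ∈ orbit act c := ⟨1, A.one c⟩

theorem act_mem_orbit {c x : X} (hx : x ∈ orbit act c) (g : G) : act x g ∈ orbit act c := by
  obtain ⟨h, rfl⟩ := hx
  exact ⟨h * g, (A.mul _ _ _).symm⟩

theorem orbit_eq {c c' : X} (h : c' ∈ orbit act c) : orbit act c' = orbit act c := by
  obtain ⟨g, rfl⟩ := h
  ext x
  constructor
  · rintro ⟨h, rfl⟩
    exact ⟨g * h, (A.mul _ _ _).symm⟩
  · rintro ⟨h, rfl⟩
    exact ⟨g⁻¹ * h, by rw [A.mul, mul_inv_cancel_left]⟩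

theorem geo {c x y : X} (hx : x ∈ orbit act c) (hy : y ∈ orbit act c) :
    ∃ g ∈ ballG S (odist act S x y), act x g = y := by
  obtain ⟨g, hg⟩ : ∃ g, act x g = y := by
    rw [← A.orbit_eq hx] at hy
    exact hy
  obtain ⟨n, w, hw, rfl⟩ := exists_mem_ballG A.invol A.gen g
  have : odist act S x y ∈ {n | ∃ w : List S, w.length = n ∧ act x (wordProd S w) = y} :=
    Nat.sInf_mem ⟨_, w, rfl, hg⟩
  obtain ⟨v, hv, h⟩ := this
  exact ⟨_, ⟨v, hv.le, rfl⟩, h⟩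

theorem dist_self (x : X) : odist act S x x = 0 :=
  Nat.le_zero.1 (odist_le (one_mem_ballG 0) (A.one x))

theorem dist_symm {c x y : X} (hx : x ∈ orbit act c) (hy : y ∈ orbit act c) :
    odist act S x y = odist act S y x := by
  apply le_antisymm
  · obtain ⟨g, hg, h⟩ := A.geo hy hx
    exact odist_le (A.inv_mem hg) (A.act_inv h)
  · obtain ⟨g, hg, h⟩ := A.geo hx hy
    exact odist_le (A.inv_mem hg) (A.act_inv h)

theorem dist_tri {c x y z : X} (hx : x ∈ orbit act c) (hy : y ∈ orbit act c)
    (hz : z ∈ orbit act c) :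
    odist act S x z ≤ odist act S x y + odist act S y z := by
  obtain ⟨g, hg, h⟩ := A.geo hx hy
  obtain ⟨g', hg', h'⟩ := A.geo hy hz
  exact odist_le (mul_mem_ballG hg hg') (by rw [← A.mul, h, h'])

theorem dist_step {c x y : X} (hx : x ∈ orbit act c) (hy : y ∈ orbit act c) {s : G}
    (hs : s ∈ ballG S 1) :
    odist act S (act x s) y ≤ odist act S x y + 1 ∧
      odist act S x y ≤ odist act S (act x s) y + 1 := by
  have h1 : odist act S x (act x s) ≤ 1 := odist_le hs rfl
  have hxs := A.act_mem_orbit hx s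
  have h2 := A.dist_symm hx hxs
  have h3 := A.dist_tri hx hxs hy
  have h4 := A.dist_tri hxs hx hy
  omega

theorem path_step {P : ℕ → G} (hP : IsPath S P) {c x y : X} (hx : x ∈ orbit act c)
    (hy : y ∈ orbit act c) (t : ℕ) :
    odist act S (act x (P (t + 1))) y ≤ odist act S (act x (P t)) y + 1 ∧
      odist act S (act x (P t)) y ≤ odist act S (act x (P (t + 1))) y + 1 := by
  obtain ⟨s, hs, h⟩ := hP t
  rw [h, ← A.mul]
  exact A.dist_step (A.act_mem_orbit hx _) hy hs

/-- Balls in the orbital graphs are finite. -/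
theorem finite_ball (c : X) (n : ℕ) : {x | x ∈ orbit act c ∧ odist act S x c ≤ n}.Finite := by
  refine ((ballG_finite A.fin n).image (act c)).subset ?_
  rintro x ⟨hx, h⟩
  obtain ⟨g, hg, h'⟩ := A.geo (A.self_mem_orbit c) hx
  rw [A.dist_symm (A.self_mem_orbit c) hx] at hg
  exact ⟨g, ballG_mono h hg, h'⟩

end RightAct

end Metric

theorem ncard_le_of_rel {α β : Type*} {s : Set α} {t : Set β} (r : α → β → Prop)
    (hr : ∀ a ∈ s, ∃ b ∈ t, r a b) (hinj : ∀ a ∈ s, ∀ a' ∈ s, ∀ b ∈ t, r a b → r a' b → a = a')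
    (ht : t.Finite) : s.ncard ≤ t.ncard := by
  have : ∀ a : s, ∃ b ∈ t, r a b := fun a => hr a a.2
  choose f hf using this
  rw [← Nat.card_coe_set_eq, ← Nat.card_coe_set_eq]
  have := ht.to_subtype
  refine Nat.card_le_card_of_injective (fun a : s => (⟨f a, (hf a).1⟩ : t)) ?_
  intro a a' h
  have h' : f a = f a' := congrArg Subtype.val h
  exact Subtype.ext (hinj a a.2 a' a'.2 (f a) (hf a).1 (hf a).2 (h' ▸ (hf a').2))

theorem finite_of_rel {α β : Type*} {s : Set α} {t : Set β} (r : α → β → Prop)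
    (hr : ∀ a ∈ s, ∃ b ∈ t, r a b) (hinj : ∀ a ∈ s, ∀ a' ∈ s, ∀ b ∈ t, r a b → r a' b → a = a')
    (ht : t.Finite) : s.Finite := by
  have : ∀ a : s, ∃ b ∈ t, r a b := fun a => hr a a.2
  choose f hf using this
  have := ht.to_subtype
  refine Finite.of_injective (fun a : s => (⟨f a, (hf a).1⟩ : t)) ?_
  intro a a' h
  have h' : f a = f a' := congrArg Subtype.val h
  exact Subtype.ext (hinj a a.2 a' a'.2 (f a) (hf a).1 (hf a).2 (h' ▸ (hf a').2))

/-- `x` and `y` have the same loops of length at most `n`. -/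
def Eqv (act : X → G → X) (S : Set G) (n : ℕ) (x y : X) : Prop :=
  ∀ g ∈ ballG S n, act x g = x ↔ act y g = y

/-- One of three points is between the other two, up to an error `δ`. -/
def Col3 (act : X → G → X) (S : Set G) (δ : ℕ) (x y z : X) : Prop :=
  odist act S x y + odist act S y z ≤ odist act S x z + δ ∨
  odist act S x y + odist act S x z ≤ odist act S y z + δ ∨
  odist act S x z + odist act S y z ≤ odist act S x y + δ

section Eqv

variable {act : X → G → X} {S : Set G}

theorem Eqv.mono {m n : ℕ} {x y : X} (h : Eqv act S n x y) (hmn : m ≤ n) : Eqv act S m x y :=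
  fun g hg => h g (ballG_mono hmn hg)

theorem Eqv.symm {n : ℕ} {x y : X} (h : Eqv act S n x y) : Eqv act S n y x :=
  fun g hg => (h g hg).symm

theorem Eqv.trans {n : ℕ} {x y z : X} (h : Eqv act S n x y) (h' : Eqv act S n y z) :
    Eqv act S n x z := fun g hg => (h g hg).trans (h' g hg)

theorem Eqv.refl (n : ℕ) (x : X) : Eqv act S n x x := fun _ _ => Iff.rfl

variable (A : RightAct act S)
include A

theorem Eqv.move {n k m : ℕ} {x y : X} (h : Eqv act S m x y) (hm : n + 2 * k ≤ m) {g : G}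
    (hg : g ∈ ballG S k) : Eqv act S n (act x g) (act y g) := by
  intro u hu
  have hmem : g * u * g⁻¹ ∈ ballG S m :=
    ballG_mono (by omega) (mul_mem_ballG (mul_mem_ballG hg hu) (A.inv_mem hg))
  rw [A.mul, A.mul, A.act_eq_iff, A.act_eq_iff]
  exact h _ hmem

theorem Eqv.eq_iff {n a b : ℕ} {x y : X} (h : Eqv act S n x y) {g k : G} (hg : g ∈ ballG S a)
    (hk : k ∈ ballG S b) (hn : a + b ≤ n) : act x g = act x k ↔ act y g = act y k := by
  rw [A.act_eq_iff, A.act_eq_iff]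
  exact h _ (ballG_mono hn (mul_mem_ballG hg (A.inv_mem hk)))

theorem Eqv.dist_le {n m : ℕ} {x y : X} (h : Eqv act S n x y) {g k : G} (hg : g ∈ ballG S m)
    (hk : k ∈ ballG S m) (hn : 4 * m ≤ n) :
    odist act S (act x g) (act x k) ≤ odist act S (act y g) (act y k) := by
  obtain ⟨u, hu, hu'⟩ := A.geo (A.mem_orbit y g) (A.mem_orbit y k)
  have h1 : odist act S (act y g) (act y k) ≤ m + m :=
    odist_le (mul_mem_ballG (A.inv_mem hg) hk) (by rw [A.mul]; simp)
  have h2 : u ∈ ballG S (m + m) := ballG_mono h1 hu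
  refine odist_le hu ?_
  rw [A.mul] at hu' ⊢
  exact (h.eq_iff A (mul_mem_ballG hg h2) hk (by omega)).2 hu'

theorem Eqv.dist_eq {n m : ℕ} {x y : X} (h : Eqv act S n x y) {g k : G} (hg : g ∈ ballG S m)
    (hk : k ∈ ballG S m) (hn : 4 * m ≤ n) :
    odist act S (act x g) (act x k) = odist act S (act y g) (act y k) :=
  le_antisymm (h.dist_le A hg hk hn) (h.symm.dist_le A hg hk hn)

theorem Eqv.dist_base {n m : ℕ} {x y : X} (h : Eqv act S n x y) {g : G} (hg : g ∈ ballG S m)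
    (hn : 4 * m ≤ n) : odist act S (act x g) x = odist act S (act y g) y := by
  have := h.dist_eq A hg (one_mem_ballG m) hn
  rwa [A.one, A.one] at this

end Eqv

section Topology

variable {act : X → G → X} {S : Set G}

theorem IsRegular.map (A : RightAct act S) (hcont : ∀ g : G, Continuous fun x : X => act x g)
    {x : X} (hx : IsRegular act x) (g : G) : IsRegular act (act x g) := by
  intro h hh
  have h1 : act x (g * h * g⁻¹) = x := by
    have : act (act x g) h = act x g := hh
    rwa [A.mul, A.act_eq_iff] at this
  obtain ⟨U, hU, hU'⟩ := hx h1
  have hback : act (act x g) g⁻¹ = x := by rw [A.mul, mul_inv_cancel, A.one]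
  refine ⟨(fun y => act y g⁻¹) ⁻¹' U, (hcont g⁻¹).continuousAt.preimage_mem_nhds
    (by rw [hback]; exact hU), fun y hy => ?_⟩
  have := hU' _ hy
  rw [A.mul, A.act_eq_iff] at this
  simpa [mul_assoc] using this

theorem RightAct.countable (A : RightAct act S) : Countable G := by
  rw [← Set.countable_univ_iff]
  have : (Set.univ : Set G) = ⋃ n, ballG S n := by
    ext g
    simpa using exists_mem_ballG A.invol A.gen g
  rw [this]
  exact Set.countable_iUnion fun n => (ballG_finite A.fin n).countable

theorem dense_isRegular [CompactSpace X] [T2Space X] (A : RightAct act S)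
    (hcont : ∀ g : G, Continuous fun x : X => act x g) : Dense {x | IsRegular act x} := by
  have := A.countable
  have hcl : ∀ g : G, IsClosed {x | act x g = x} := fun g =>
    isClosed_eq (hcont g) continuous_id
  have hd : Dense (⋂ g : G, (frontier {x | act x g = x})ᶜ) := by
    refine dense_iInter_of_isOpen (fun g => isClosed_frontier.isOpen_compl) fun g => ?_
    rw [← interior_eq_empty_iff_dense_compl]
    exact interior_frontier (hcl g)
  refine hd.mono fun x hx g hg => ?_
  rw [Set.mem_iInter] at hx
  have h1 := hx g
  rw [(hcl g).frontier_eq] at h1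
  have h2 : x ∈ interior {x | act x g = x} := by
    by_contra h
    exact h1 ⟨hg, h⟩
  exact ⟨_, isOpen_interior.mem_nhds h2, fun y hy =>
    interior_subset (s := {x | act x g = x}) hy⟩

end Topology

section QI

variable {act : X → G → X} {S : Set G}

theorem exists_abs_sub_le {M v : ℝ} (a : ℕ → ℝ) (n : ℕ) (h : ∀ t < n, |a (t + 1) - a t| ≤ M)
    (hM : 0 ≤ M) (h0 : a 0 ≤ v) (hn : v ≤ a n) : ∃ t ≤ n, |a t - v| ≤ M := by
  induction n with
  | zero =>
    have : a 0 = v := le_antisymm h0 hn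
    exact ⟨0, le_rfl, by simpa [this] using hM⟩
  | succ n ih =>
    by_cases hv : v ≤ a n
    · obtain ⟨t, ht, h'⟩ := ih (fun t ht => h t (by omega)) hv
      exact ⟨t, by omega, h'⟩
    · refine ⟨n, by omega, ?_⟩
      have := h n (by omega)
      rw [abs_le] at this ⊢
      constructor <;> linarith [this.1, this.2]

theorem ballG_prefix {n : ℕ} {g : G} (hg : g ∈ ballG S n) :
    ∃ a : ℕ → G, a 0 = 1 ∧ a n = g ∧ (∀ t, ∃ s ∈ ballG S 1, a (t + 1) = a t * s) ∧
      (∀ t ≤ n, a t ∈ ballG S t ∧ (a t)⁻¹ * g ∈ ballG S (n - t)) := by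
  obtain ⟨w, hw, rfl⟩ := hg
  have key : ∀ t, wordProd S w = wordProd S (w.take t) * wordProd S (w.drop t) := by
    intro t
    rw [← wordProd_append, List.take_append_drop]
  refine ⟨fun t => wordProd S (w.take t), by simp [wordProd], ?_, fun t => ?_, fun t _ => ⟨?_, ?_⟩⟩
  · simp only []
    rw [List.take_of_length_le hw]
  · have h : wordProd S ((w.drop t).take 1) ∈ ballG S 1 := ⟨(w.drop t).take 1, by simp, rfl⟩
    refine ⟨_, h, ?_⟩
    simp only [← wordProd_append, ← List.take_add]
  · exact ⟨w.take t, by simp, rfl⟩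
  · simp only []
    rw [key t, inv_mul_cancel_left]
    exact ⟨w.drop t, by simp; omega, rfl⟩

theorem dist_add_dist_le_of_qi (A : RightAct act S) {c₀ : X} {φ : X → ℝ} {Λ c : ℝ}
    (hΛ : 1 ≤ Λ) (hc : 0 ≤ c)
    (hφ : ∀ x ∈ orbit act c₀, ∀ y ∈ orbit act c₀,
      Λ⁻¹ * (odist act S x y : ℝ) - c ≤ |φ x - φ y| ∧
      |φ x - φ y| ≤ Λ * (odist act S x y : ℝ) + c) {x y z : X} (hx : x ∈ orbit act c₀)
    (hy : y ∈ orbit act c₀) (hz : z ∈ orbit act c₀) (hxy : φ x ≤ φ y) (hyz : φ y ≤ φ z) :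
    odist act S x y + odist act S y z ≤
      odist act S x z + 2 * ⌈Λ * (Λ + c + c)⌉₊ := by
  obtain ⟨g, hg, hgz⟩ := A.geo hx hz
  obtain ⟨a, ha0, han, has, hab⟩ := ballG_prefix hg
  set n := odist act S x z with hn
  have horb : ∀ t, act x (a t) ∈ orbit act c₀ := fun t => A.act_mem_orbit hx _
  have hstep : ∀ t < n, |φ (act x (a (t + 1))) - φ (act x (a t))| ≤ Λ + c := by
    intro t _
    have h1 : odist act S (act x (a (t + 1))) (act x (a t)) ≤ 1 := by
      obtain ⟨s, hs, h⟩ := has t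
      refine odist_le (A.inv_mem hs) ?_
      rw [A.mul, h]
      simp
    have h2 := (hφ _ (horb (t + 1)) _ (horb t)).2
    have h3 : (odist act S (act x (a (t + 1))) (act x (a t)) : ℝ) ≤ 1 := by exact_mod_cast h1
    nlinarith
  obtain ⟨t, ht, h⟩ := exists_abs_sub_le (fun t => φ (act x (a t))) n hstep (by linarith)
    (v := φ y) (by simpa [ha0, A.one] using hxy) (by simpa [han, hgz] using hyz)
  have hclose : odist act S (act x (a t)) y ≤ ⌈Λ * (Λ + c + c)⌉₊ := by
    have h1 := (hφ _ (horb t) _ hy).1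
    have h2 : Λ⁻¹ * (odist act S (act x (a t)) y : ℝ) ≤ Λ + c + c := by linarith
    have h3 : (odist act S (act x (a t)) y : ℝ) ≤ Λ * (Λ + c + c) := by
      rwa [inv_mul_le_iff₀ (by linarith)] at h2
    exact_mod_cast h3.trans (Nat.le_ceil _)
  have h1 : odist act S x (act x (a t)) ≤ t := odist_le (hab t ht).1 rfl
  have h2 : odist act S (act x (a t)) z ≤ n - t := by
    refine odist_le (hab t ht).2 ?_
    rw [A.mul, mul_inv_cancel_left, hgz]
  have h3 := A.dist_tri hx (horb t) hy
  have h4 := A.dist_tri hy (horb t) hz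
  have h5 := A.dist_symm hy (horb t)
  omega

theorem QIToLine.col3 (A : RightAct act S) {c₀ : X} (h : QIToLine act S c₀) :
    ∃ δ : ℕ, ∀ x ∈ orbit act c₀, ∀ y ∈ orbit act c₀, ∀ z ∈ orbit act c₀,
      Col3 act S δ x y z := by
  obtain ⟨φ, Λ, c, hΛ, hc, hφ, -⟩ := h
  refine ⟨2 * ⌈Λ * (Λ + c + c)⌉₊, fun x hx y hy z hz => ?_⟩
  have key := @dist_add_dist_le_of_qi G X _ _ act S A c₀ φ Λ c hΛ hc hφ
  have s1 := A.dist_symm hx hy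
  have s2 := A.dist_symm hx hz
  have s3 := A.dist_symm hy hz
  unfold Col3
  rcases le_total (φ x) (φ y) with h1 | h1 <;> rcases le_total (φ y) (φ z) with h2 | h2 <;>
    rcases le_total (φ x) (φ z) with h3 | h3
  · have := key hx hy hz h1 h2; omega
  · have := key hx hy hz h1 h2; omega
  · have := key hx hz hy h3 h2; omega
  · have := key hz hx hy h3 h1; omega
  · have := key hy hx hz h1 h3; omega
  · have := key hy hz hx h2 h3; omega
  · have := key hz hy hx h2 h1; omega
  · have := key hz hy hx h2 h1; omega

theorem QIToHalfLine.dist_le (A : RightAct act S) {ξ : X} (h : QIToHalfLine act S ξ) :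
    ∃ δ : ℕ, ∀ x ∈ orbit act ξ, ∀ y ∈ orbit act ξ,
      odist act S x y + odist act S x ξ ≤ odist act S y ξ + δ ∨
      odist act S x y + odist act S y ξ ≤ odist act S x ξ + δ := by
  obtain ⟨φ, Λ, c, hΛ, hc, hpos, hφ, -⟩ := h
  have key := @dist_add_dist_le_of_qi G X _ _ act S A ξ φ Λ c hΛ hc hφ
  have hξ := A.self_mem_orbit (S := S) ξ
  have main : ∀ x ∈ orbit act ξ, ∀ y ∈ orbit act ξ, φ x ≤ φ y →
      odist act S x y + odist act S x ξ ≤ odist act S y ξ +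
        (2 * ⌈Λ * (Λ + c + c)⌉₊ + 2 * ⌈Λ * (φ ξ + c)⌉₊) := by
    intro x hx y hy hxy
    have s1 := A.dist_symm hx hξ
    have s2 := A.dist_symm hy hξ
    rcases le_total (φ ξ) (φ x) with h1 | h1
    · have := key hξ hx hy h1 hxy
      omega
    · have h2 := (hφ x hx ξ hξ).1
      have h3 : |φ x - φ ξ| ≤ φ ξ := by
        rw [abs_le]
        constructor <;> linarith [hpos x hx]
      have h4 : (odist act S x ξ : ℝ) ≤ Λ * (φ ξ + c) := by
        rw [← inv_mul_le_iff₀ (by linarith)]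
        linarith
      have h5 : odist act S x ξ ≤ ⌈Λ * (φ ξ + c)⌉₊ := by
        exact_mod_cast h4.trans (Nat.le_ceil _)
      have := A.dist_tri hx hξ hy
      omega
  refine ⟨2 * ⌈Λ * (Λ + c + c)⌉₊ + 2 * ⌈Λ * (φ ξ + c)⌉₊, fun x hx y hy => ?_⟩
  rcases le_total (φ x) (φ y) with h1 | h1
  · exact Or.inl (main x hx y hy h1)
  · have s := A.dist_symm hx hy
    have := main y hy x hx h1
    exact Or.inr (by omega)

end QI

/-- The geometric consequences of linear repetitivity and of the orbital graphs of regular points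
being quasi-isometric to a line. -/
structure LinRep (act : X → G → X) (S : Set G) (L δ : ℕ) : Prop extends RightAct act S where
  reg : ∀ x g, IsRegular act x → IsRegular act (act x g)
  rep : ∀ x y, IsRegular act x → IsRegular act y → ∀ n,
    ∃ b ∈ ballG S (L * n), Eqv act S n (act y b) x
  col : ∀ c, IsRegular act c → ∀ x ∈ orbit act c, ∀ y ∈ orbit act c, ∀ z ∈ orbit act c,
    Col3 act S δ x y z

section Rep

variable {act : X → G → X} {S : Set G}

theorem exists_eqv_of_embedding (A : RightAct act S) {ζ ζ' : X} {n m : ℕ} {ψ : X → X}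
    (hinj : Set.InjOn ψ (oball act S ζ n))
    (hmaps : Set.MapsTo ψ (oball act S ζ n) (oball act S ζ' m))
    (hψ : ∀ x ∈ oball act S ζ n, ∀ y ∈ oball act S ζ n, ∀ s : S,
          (act x (s : G) = y ↔ act (ψ x) (s : G) = ψ y)) :
    ∃ b ∈ ballG S m, Eqv act S n (act ζ' b) ζ := by
  have h0 : ζ ∈ oball act S ζ n := ⟨[], by simp, by simp [wordProd, A.one]⟩
  obtain ⟨w, hw, hw'⟩ := hmaps h0
  refine ⟨wordProd S w, ⟨w, hw, rfl⟩, ?_⟩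
  rw [hw']
  have key : ∀ v : List S, v.length ≤ n → ψ (act ζ (wordProd S v)) = act (ψ ζ) (wordProd S v) := by
    intro v
    induction v using List.reverseRecOn with
    | nil => simp [wordProd, A.one]
    | append_singleton v s ih =>
      intro hv
      rw [List.length_append, List.length_singleton] at hv
      have hs : wordProd S [s] = s := by simp [wordProd]
      have := (hψ (act ζ (wordProd S v)) ⟨v, by omega, rfl⟩ (act ζ (wordProd S (v ++ [s])))
        ⟨v ++ [s], by simpa using hv, rfl⟩ s).1 (by rw [A.mul, wordProd_append, hs])
      rw [← this, ih (by omega), A.mul, wordProd_append, hs]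
  rintro g ⟨v, hv, rfl⟩
  rw [← key v hv]
  exact ⟨fun h => hinj ⟨v, hv, rfl⟩ h0 h, fun h => by rw [h]⟩

theorem exists_linRep (A : RightAct act S) (hcont : ∀ g : G, Continuous fun x : X => act x g)
    (hrep : ∃ L : ℝ, 1 < L ∧ ∀ ζ ζ' : X, IsRegular act ζ → IsRegular act ζ' →
      ∀ R : ℕ, 0 < R → ∃ ψ : X → X,
        Set.InjOn ψ (oball act S ζ R) ∧
        Set.MapsTo ψ (oball act S ζ R) (oball act S ζ' ⌊L * (R : ℝ)⌋₊) ∧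
        ∀ x ∈ oball act S ζ R, ∀ y ∈ oball act S ζ R, ∀ s : S,
          (act x (s : G) = y ↔ act (ψ x) (s : G) = ψ y))
    (hlineQI : ∀ ζ : X, IsRegular act ζ → QIToLine act S ζ) {ζ₀ : X} (hζ₀ : IsRegular act ζ₀) :
    ∃ L δ₀ : ℕ, 1 ≤ L ∧ ∀ δ ≥ δ₀, LinRep act S L δ := by
  obtain ⟨L, hL, hrep⟩ := hrep
  obtain ⟨δ₀, hδ₀⟩ := (hlineQI ζ₀ hζ₀).col3 A
  have rep : ∀ x y, IsRegular act x → IsRegular act y → ∀ n,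
      ∃ b ∈ ballG S (⌈L⌉₊ * n), Eqv act S n (act y b) x := by
    intro x y hx hy n
    rcases Nat.eq_zero_or_pos n with rfl | hn
    · refine ⟨1, one_mem_ballG _, fun g hg => ?_⟩
      rw [eq_one_of_mem_ballG_zero hg]
      simp [A.one]
    · obtain ⟨ψ, h1, h2, h3⟩ := hrep x y hx hy n hn
      obtain ⟨b, hb, h⟩ := exists_eqv_of_embedding A h1 h2 h3
      refine ⟨b, ballG_mono ?_ hb, h⟩
      have : (⌊L * (n : ℝ)⌋₊ : ℝ) ≤ ((⌈L⌉₊ * n : ℕ) : ℝ) := by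
        refine (Nat.floor_le (by positivity)).trans ?_
        push_cast
        exact mul_le_mul_of_nonneg_right (Nat.le_ceil L) (Nat.cast_nonneg n)
      exact_mod_cast this
  refine ⟨⌈L⌉₊, δ₀, Nat.one_le_ceil_iff.2 (by linarith), fun δ hδ =>
    ⟨A, fun x g hx => IsRegular.map A hcont hx g, rep, ?_⟩⟩
  rintro c hc _ ⟨g₁, rfl⟩ _ ⟨g₂, rfl⟩ _ ⟨g₃, rfl⟩
  obtain ⟨n₁, h₁⟩ := exists_mem_ballG A.invol A.gen g₁
  obtain ⟨n₂, h₂⟩ := exists_mem_ballG A.invol A.gen g₂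
  obtain ⟨n₃, h₃⟩ := exists_mem_ballG A.invol A.gen g₃
  obtain ⟨b, -, hb⟩ := rep c ζ₀ hc hζ₀ (4 * (n₁ + n₂ + n₃))
  replace h₁ := ballG_mono (show n₁ ≤ n₁ + n₂ + n₃ by omega) h₁
  replace h₂ := ballG_mono (show n₂ ≤ n₁ + n₂ + n₃ by omega) h₂
  replace h₃ := ballG_mono (show n₃ ≤ n₁ + n₂ + n₃ by omega) h₃
  have horb : ∀ g, act (act ζ₀ b) g ∈ orbit act ζ₀ := fun g =>
    A.act_mem_orbit (A.mem_orbit ζ₀ b) g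
  have := hδ₀ _ (horb g₁) _ (horb g₂) _ (horb g₃)
  unfold Col3 at this ⊢
  rw [hb.dist_eq A h₁ h₂ le_rfl, hb.dist_eq A h₁ h₃ le_rfl, hb.dist_eq A h₂ h₃ le_rfl] at this
  omega

end Rep

namespace LinRep

variable {act : X → G → X} {S : Set G} {L δ : ℕ} (A : LinRep act S L δ)
include A

theorem reg_of_mem {c x : X} (hc : IsRegular act c) (hx : x ∈ orbit act c) : IsRegular act x := by
  obtain ⟨g, rfl⟩ := hx
  exact A.reg c g hc

theorem sphere_ncard_le {c : X} (hc : IsRegular act c) (m : ℕ) :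
    {x | x ∈ orbit act c ∧ odist act S x c = m}.ncard ≤ 3 * (ballG S (2 * δ)).ncard := by
  have hfin := ballG_finite A.fin (2 * δ)
  have hcc := A.self_mem_orbit c
  have hcard : ∀ x : X, (act x '' ballG S (2 * δ)).ncard ≤ (ballG S (2 * δ)).ncard := fun x =>
    Set.ncard_image_le hfin
  have hnear : ∀ x ∈ orbit act c, ∀ y ∈ orbit act c, odist act S x y ≤ 2 * δ →
      y ∈ act x '' ballG S (2 * δ) := by
    intro x hx y hy h
    obtain ⟨g, hg, h'⟩ := A.geo hx hy
    exact ⟨g, ballG_mono h hg, h'⟩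
  have main : ∃ x₀ x₁ : X, {x | x ∈ orbit act c ∧ odist act S x c = m} ⊆
      act x₀ '' ballG S (2 * δ) ∪ act x₁ '' ballG S (2 * δ) ∪ act c '' ballG S (2 * δ) := by
    by_cases h0 : ∃ x₀ ∈ orbit act c, odist act S x₀ c = m
    swap
    · exact ⟨c, c, fun x hx => absurd ⟨x, hx⟩ h0⟩
    obtain ⟨x₀, hx₀, hd₀⟩ := h0
    by_cases h1 : ∃ x₁ ∈ orbit act c, odist act S x₁ c = m ∧ 2 * δ < odist act S x₀ x₁
    swap
    · refine ⟨x₀, x₀, fun x hx => Or.inl (Or.inl (hnear _ hx₀ _ hx.1 ?_))⟩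
      by_contra h
      exact h1 ⟨x, hx.1, hx.2, by omega⟩
    obtain ⟨x₁, hx₁, hd₁, h01⟩ := h1
    refine ⟨x₀, x₁, ?_⟩
    rintro x ⟨hx, hd⟩
    by_cases hm : m ≤ 2 * δ
    · right
      refine hnear _ hcc _ hx ?_
      rw [A.dist_symm hcc hx]
      omega
    left
    have c1 := A.col c hc _ hx₀ _ hx₁ _ hcc
    have c2 := A.col c hc _ hx₀ _ hx _ hcc
    have c3 := A.col c hc _ hx₁ _ hx _ hcc
    have c4 := A.col c hc _ hx₀ _ hx₁ _ hx
    unfold Col3 at c1 c2 c3 c4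
    have t1 := A.dist_tri hx₀ hcc hx₁
    have t2 := A.dist_tri hx₀ hcc hx
    have t3 := A.dist_tri hx₁ hcc hx
    have s1 := A.dist_symm hcc hx₁
    have s2 := A.dist_symm hcc hx
    by_cases h2 : odist act S x₀ x ≤ 2 * δ
    · exact Or.inl (hnear _ hx₀ _ hx h2)
    · refine Or.inr (hnear _ hx₁ _ hx ?_)
      omega
  obtain ⟨x₀, x₁, h⟩ := main
  have f := fun x : X => hfin.image (act x)
  refine (Set.ncard_le_ncard h (((f x₀).union (f x₁)).union (f c))).trans ?_
  have h1 := Set.ncard_union_le (act x₀ '' ballG S (2 * δ) ∪ act x₁ '' ballG S (2 * δ))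
    (act c '' ballG S (2 * δ))
  have h2 := Set.ncard_union_le (act x₀ '' ballG S (2 * δ)) (act x₁ '' ballG S (2 * δ))
  have := hcard x₀
  have := hcard x₁
  have := hcard c
  omega

theorem ball_ncard_le {c : X} (hc : IsRegular act c) (n : ℕ) :
    {x | x ∈ orbit act c ∧ odist act S x c ≤ n}.ncard ≤
      3 * (ballG S (2 * δ)).ncard * (n + 1) := by
  induction n with
  | zero =>
    simpa using A.sphere_ncard_le hc 0
  | succ n ih =>
    have : {x | x ∈ orbit act c ∧ odist act S x c ≤ n + 1} =
        {x | x ∈ orbit act c ∧ odist act S x c ≤ n} ∪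
          {x | x ∈ orbit act c ∧ odist act S x c = n + 1} := by
      ext x
      simp only [Set.mem_ofPred_eq, Set.mem_union]
      constructor
      · rintro ⟨h1, h2⟩
        rcases Nat.lt_or_ge (odist act S x c) (n + 1) with h | h
        · exact Or.inl ⟨h1, by omega⟩
        · exact Or.inr ⟨h1, by omega⟩
      · rintro (⟨h1, h2⟩ | ⟨h1, h2⟩)
        · exact ⟨h1, by omega⟩
        · exact ⟨h1, by omega⟩
    rw [this]
    refine (Set.ncard_union_le _ _).trans ?_
    have := A.sphere_ncard_le hc (n + 1)
    calc _ ≤ 3 * (ballG S (2 * δ)).ncard * (n + 1) + 3 * (ballG S (2 * δ)).ncard :=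
          add_le_add ih this
      _ = _ := by ring

end LinRep

theorem exists_crossing {f ρ σ : ℕ → ℕ} {δ τ D q i j : ℕ} (hij : i ≤ j)
    (hf : ∀ t, i ≤ t → t ≤ j → f t ≤ ρ t ∧ ρ t ≤ f t + τ)
    (hρ : ∀ t, ρ (t + 1) ≤ ρ t + 1 ∧ ρ t ≤ ρ (t + 1) + 1)
    (hσ : ∀ t, σ (t + 1) ≤ σ t + 1 ∧ σ t ≤ σ (t + 1) + 1)
    (hcol : ∀ t, i ≤ t → t ≤ j →
      ρ t + q ≤ σ t + δ ∨ ρ t + σ t ≤ q + δ ∨ q + σ t ≤ ρ t + δ)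
    (hσi : σ i = 0) (hρi : ρ i = q) (hfi : D ≤ f i) (hfj : D ≤ f j)
    (hend : ρ j + q ≤ σ j + δ) (hD : 2 * δ + 2 * τ + 10 ≤ D) :
    ∃ i' j', i ≤ i' ∧ i' < j' ∧ j' ≤ j ∧ D ≤ f i' ∧ D ≤ f j' ∧
      (∀ t, i' < t → t < j' → f t < D) ∧ σ i' + D ≤ σ j' ∧
      ∃ t₀, i' < t₀ ∧ t₀ < j' ∧ ρ t₀ ≤ δ + 1 := by
  classical
  have hqD : D ≤ q := by have := (hf i le_rfl hij).1; omega
  obtain ⟨i', ⟨hi1, hi2, hi3, hi4⟩, hmax⟩ : ∃ i', (i ≤ i' ∧ i' ≤ j ∧ D ≤ f i' ∧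
      σ i' + δ < ρ i' + q) ∧ ∀ t, i' < t → t ≤ j → D ≤ f t → ρ t + q ≤ σ t + δ := by
    let p : ℕ → Prop := fun t => i ≤ t ∧ t ≤ j ∧ D ≤ f t ∧ σ t + δ < ρ t + q
    have hp : p i := ⟨le_rfl, hij, hfi, by omega⟩
    refine ⟨Nat.findGreatest p j, Nat.findGreatest_spec hij hp, fun t h1 h2 h3 => ?_⟩
    have := Nat.findGreatest_is_greatest h1 h2
    have hi := (Nat.findGreatest_spec hij hp).1
    by_contra h
    exact this ⟨by omega, h2, h3, by omega⟩
  have hi5 : i' < j := by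
    rcases Nat.lt_or_ge i' j with h | h
    · exact h
    · have : i' = j := by omega
      subst this
      omega
  have hex : ∃ t, i' < t ∧ t ≤ j ∧ D ≤ f t := ⟨j, hi5, le_rfl, hfj⟩
  obtain ⟨hj1, hj2, hj3⟩ := Nat.find_spec hex
  have hmin : ∀ t, i' < t → t < Nat.find hex → f t < D := by
    intro t h1 h2
    by_contra h
    exact Nat.find_min hex h2 ⟨h1, by omega, by omega⟩
  set j' := Nat.find hex with hj'
  have hopp := hmax j' hj1 hj2 hj3
  have hflip : ∃ t, i' ≤ t ∧ t < j' ∧ σ t + δ < ρ t + q ∧ ρ (t + 1) + q ≤ σ (t + 1) + δ := by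
    have hex2 : ∃ t, i' < t ∧ ρ t + q ≤ σ t + δ := ⟨j', hj1, hopp⟩
    obtain ⟨h1, h2⟩ := Nat.find_spec hex2
    have h3 : Nat.find hex2 ≤ j' := Nat.find_min' hex2 ⟨hj1, hopp⟩
    have h4 : ∀ t, t < Nat.find hex2 → i' < t → σ t + δ < ρ t + q := by
      intro t ht h
      by_contra h'
      exact Nat.find_min hex2 ht ⟨h, by omega⟩
    obtain ⟨u, hu⟩ : ∃ u, Nat.find hex2 = u + 1 := ⟨Nat.find hex2 - 1, by omega⟩
    rw [hu] at h1 h2 h3 h4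
    refine ⟨u, by omega, by omega, ?_, h2⟩
    rcases Nat.lt_or_ge i' u with h | h
    · exact h4 u (by omega) h
    · have : u = i' := by omega
      subst this
      exact hi4
  obtain ⟨t, ht1, ht2, ht3, ht4⟩ := hflip
  have c1 := hcol t (by omega) (by omega)
  have e1 := hρ t
  have e2 := hσ t
  have hρt : ρ t ≤ δ + 1 := by omega
  have f1 := hf t (by omega) (by omega)
  have ht5 : i' < t := by
    rcases Nat.lt_or_ge i' t with h | h
    · exact h
    · have : t = i' := by omega
      subst this
      omega
  refine ⟨i', j', hi1, hj1, hj2, hi3, hj3, hmin, ?_, t, ht5, ht2, hρt⟩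
  have f2 := hf i' hi1 hi2
  have f3 := hf j' (by omega) hj2
  have f4 := hf (i' + 1) (by omega) (by omega)
  have e3 := hρ i'
  have m1 := hmin (i' + 1) (by omega) (by omega)
  have c2 := hcol i' hi1 hi2
  omega

theorem interval_unique {f : ℕ → ℕ} {D i j i' j' s : ℕ} (h1 : D ≤ f i) (h2 : D ≤ f j)
    (h3 : ∀ t, i < t → t < j → f t < D) (h1' : D ≤ f i') (h2' : D ≤ f j')
    (h3' : ∀ t, i' < t → t < j' → f t < D) (hs : i < s ∧ s < j) (hs' : i' < s ∧ s < j') :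
    i = i' ∧ j = j' := by
  have a1 := h3 i'
  have a2 := h3 j'
  have a3 := h3' i
  have a4 := h3' j
  omega

/-- The passages, along the path `P`, of trajectories through the ball of radius `D` around `c`
from one side to the other. -/
def Cr (act : X → G → X) (S : Set G) (P : ℕ → G) (R : ℕ) (c : X) (D : ℕ) : Set (X × ℕ × ℕ) :=
  {e | e.1 ∈ orbit act c ∧ e.2.1 < e.2.2 ∧ e.2.2 ≤ R ∧
    D ≤ odist act S (act e.1 (P e.2.1)) c ∧ D ≤ odist act S (act e.1 (P e.2.2)) c ∧
    (∀ t, e.2.1 < t → t < e.2.2 → odist act S (act e.1 (P t)) c < D) ∧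
    D ≤ odist act S (act e.1 (P e.2.1)) (act e.1 (P e.2.2))}

section Cr

variable {act : X → G → X} {S : Set G} {P : ℕ → G} {R : ℕ}

namespace RightAct

variable (A : RightAct act S)
include A

theorem cr_lt (hP : IsPath S P) {c : X} {D : ℕ} (hD : 2 ≤ D) {e : X × ℕ × ℕ}
    (he : e ∈ Cr act S P R c D) : e.2.1 + 1 < e.2.2 := by
  obtain ⟨h1, h2, h3, h4, h5, h6, h7⟩ := he
  by_contra h
  have : e.2.2 = e.2.1 + 1 := by omega
  have h8 := (A.path_step hP h1 (A.act_mem_orbit h1 (P e.2.1)) e.2.1).1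
  rw [← this, A.dist_self, A.dist_symm (A.act_mem_orbit h1 _) (A.act_mem_orbit h1 _)] at h8
  omega

theorem cr_dist_le (hP : IsPath S P) {c : X} {D : ℕ} (hD : 2 ≤ D) {e : X × ℕ × ℕ}
    (he : e ∈ Cr act S P R c D) {t : ℕ} (ht : e.2.1 ≤ t) (ht' : t ≤ e.2.2) :
    odist act S (act e.1 (P t)) c ≤ D := by
  have hlt := A.cr_lt hP hD he
  obtain ⟨h1, h2, h3, h4, h5, h6, h7⟩ := he
  rcases Nat.lt_or_ge e.2.1 t with h | h
  · rcases Nat.lt_or_ge t e.2.2 with h' | h'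
    · exact (h6 t h h').le
    · have s := (A.path_step hP h1 (A.self_mem_orbit c) (e.2.2 - 1)).1
      have l := h6 (e.2.2 - 1) (by omega) (by omega)
      rw [show e.2.2 - 1 + 1 = e.2.2 by omega] at s
      rw [show t = e.2.2 by omega]
      omega
  · have s := (A.path_step hP h1 (A.self_mem_orbit c) e.2.1).2
    have l := h6 (e.2.1 + 1) (by omega) (by omega)
    rw [show t = e.2.1 by omega]
    omega

theorem exists_ballG_of_dist_le {c x : X} {D : ℕ} (hx : x ∈ orbit act c)
    (h : odist act S x c ≤ D) : ∃ g ∈ ballG S D, act c g = x := by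
  obtain ⟨g, hg, h'⟩ := A.geo (A.self_mem_orbit c) hx
  rw [A.dist_symm (A.self_mem_orbit c) hx] at hg
  exact ⟨g, ballG_mono h hg, h'⟩

theorem cr_rel_ballG (hP : IsPath S P) {c : X} {D : ℕ} (hD : 2 ≤ D) :
    (Cr act S P R c D).Finite ∧
      (Cr act S P R c D).ncard ≤ (ballG S D).ncard * (R + 1) := by
  have hfin : ((ballG S D) ×ˢ (Set.Iic R)).Finite :=
    (ballG_finite A.fin D).prod (Set.finite_Iic R)
  let r : X × ℕ × ℕ → G × ℕ → Prop := fun e g => act e.1 (P e.2.1) = act c g.1 ∧ e.2.1 = g.2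
  have hr : ∀ e ∈ Cr act S P R c D, ∃ g ∈ (ballG S D) ×ˢ (Set.Iic R), r e g := by
    intro e he
    have h := A.cr_dist_le hP hD he le_rfl he.2.1.le
    obtain ⟨g, hg, hg'⟩ := A.exists_ballG_of_dist_le (A.act_mem_orbit he.1 _) h
    exact ⟨(g, e.2.1), ⟨hg, he.2.1.le.trans he.2.2.1⟩, hg'.symm, rfl⟩
  have hinj : ∀ e ∈ Cr act S P R c D, ∀ e' ∈ Cr act S P R c D,
      ∀ g ∈ (ballG S D) ×ˢ (Set.Iic R), r e g → r e' g → e = e' := by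
    rintro ⟨x, i, j⟩ he ⟨x', i', j'⟩ he' ⟨g, k⟩ - ⟨h1, h2⟩ ⟨h3, h4⟩
    have l := A.cr_lt hP hD he
    have l' := A.cr_lt hP hD he'
    simp only at h1 h2 h3 h4 l l'
    subst h2 h4
    have hx : x = x' := (A.act_left_inj (P i')).1 (h1.trans h3.symm)
    subst hx
    obtain ⟨-, a1, a2, a3, a4, a5, a6⟩ := he
    obtain ⟨-, b1, b2, b3, b4, b5, b6⟩ := he'
    have := interval_unique (f := fun t => odist act S (act x (P t)) c) a3 a4 a5 b3 b4 b5
      (s := i' + 1) ⟨by simp only; omega, l⟩ ⟨by simp only; omega, l'⟩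
    simp only at this
    rw [this.2]
  refine ⟨finite_of_rel r hr hinj hfin, (ncard_le_of_rel r hr hinj hfin).trans ?_⟩
  rw [Set.ncard_prod, Set.ncard_Iic_nat]

end RightAct

namespace LinRep

variable {L δ : ℕ} (A : LinRep act S L δ)
include A

/-- A trajectory from `x₁ = x · P i` to `x₂ = x · P j` such that `c` is between `x₁` and `x₂`
crosses the ball of radius `D` around `c`. -/
theorem exists_cr_of_between (hP : IsPath S P) {c x : X} (hc : IsRegular act c)
    (hx : x ∈ orbit act c) {D i j : ℕ} (hD : 2 * δ + 10 ≤ D) (hij : i ≤ j) (hj : j ≤ R)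
    (hi : D ≤ odist act S (act x (P i)) c) (hj' : D ≤ odist act S (act x (P j)) c)
    (hend : odist act S (act x (P j)) c + odist act S (act x (P i)) c ≤
      odist act S (act x (P j)) (act x (P i)) + δ) :
    ∃ i' j', i ≤ i' ∧ j' ≤ j ∧ (x, i', j') ∈ Cr act S P R c D := by
  have ho : ∀ t, act x (P t) ∈ orbit act c := fun t => A.act_mem_orbit hx _
  have hcc := A.self_mem_orbit c
  obtain ⟨i', j', h1, h2, h3, h4, h5, h6, h7, -⟩ := exists_crossing
    (f := fun t => odist act S (act x (P t)) c) (ρ := fun t => odist act S (act x (P t)) c)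
    (σ := fun t => odist act S (act x (P t)) (act x (P i))) (δ := δ) (τ := 0) (D := D)
    (q := odist act S (act x (P i)) c) (i := i) (j := j) hij (fun t _ _ => ⟨le_rfl, le_rfl⟩)
    (A.path_step hP hx hcc) (A.path_step hP hx (ho i))
    (fun t _ _ => by
      have := A.col c hc _ (ho t) _ hcc _ (ho i)
      unfold Col3 at this
      rw [A.dist_symm hcc (ho i)] at this
      omega)
    (A.dist_self _) rfl hi hj' hend (by omega)
  refine ⟨i', j', h1, h3, hx, h2, h3.trans hj, h4, h5, h6, ?_⟩
  have := A.dist_tri (ho j') (ho i') (ho i)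
  have := A.dist_symm (ho i') (ho j')
  simp only at *
  omega

theorem cr_ncard_le_of_near (hP : IsPath S P) {c c' : X} (hc : IsRegular act c)
    (hc' : c' ∈ orbit act c) {m D D' : ℕ} (hm : odist act S c c' ≤ m) (hD : 2 * δ + 10 ≤ D)
    (hD' : 2 * m + D + δ + 1 ≤ D') :
    (Cr act S P R c D').ncard ≤ (Cr act S P R c' D).ncard := by
  have hreg' := A.reg_of_mem hc hc'
  have hcc := A.self_mem_orbit c
  have ho' := A.orbit_eq hc'
  have hmm := A.dist_symm hcc hc'
  refine ncard_le_of_rel (fun e e' => e.1 = e'.1 ∧ e.2.1 ≤ e'.2.1 ∧ e'.2.2 ≤ e.2.2) ?_ ?_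
    (A.cr_rel_ballG hP (by omega)).1
  · rintro ⟨x, i, j⟩ he
    have b1 := A.cr_dist_le hP (by omega) he le_rfl he.2.1.le
    have b2 := A.cr_dist_le hP (by omega) he he.2.1.le le_rfl
    obtain ⟨h1, h2, h3, h4, h5, h6, h7⟩ := he
    simp only at *
    have ho : ∀ t, act x (P t) ∈ orbit act c := fun t => A.act_mem_orbit h1 _
    have n1 := A.dist_tri (ho i) hc' hcc
    have n2 := A.dist_tri (ho i) hcc hc'
    have n3 := A.dist_tri (ho j) hc' hcc
    have n4 := A.dist_tri (ho j) hcc hc'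
    have hcol := A.col c hc _ (ho j) _ hc' _ (ho i)
    unfold Col3 at hcol
    rw [A.dist_symm hc' (ho i)] at hcol
    have s1 := A.dist_symm (ho i) (ho j)
    obtain ⟨i', j', a1, a2, a3⟩ := A.exists_cr_of_between (R := R) hP hreg' (x := x) (i := i)
      (j := j) (by rw [ho']; exact h1) hD h2.le h3 (by omega) (by omega) (by omega)
    exact ⟨_, a3, rfl, a1, a2⟩
  · rintro ⟨x, i, j⟩ he ⟨x', i', j'⟩ he' ⟨y, k, l⟩ hy ⟨a1, a2, a3⟩ ⟨b1, b2, b3⟩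
    have hl := A.cr_lt hP (by omega) hy
    simp only at *
    subst a1 b1
    obtain ⟨-, u1, u2, u3, u4, u5, u6⟩ := he
    obtain ⟨-, v1, v2, v3, v4, v5, v6⟩ := he'
    have := interval_unique (f := fun t => odist act S (act x' (P t)) c) u3 u4 u5 v3 v4 v5
      (s := k + 1) ⟨by simp only; omega, by simp only; omega⟩ ⟨by simp only; omega, by simp only; omega⟩
    simp only at this
    rw [this.1, this.2]

theorem cr_ncard_le_of_eqv (hP : IsPath S P) {c c' : X} {D : ℕ} (hD : 2 ≤ D)
    (h : Eqv act S (4 * D + 4) c c') :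
    (Cr act S P R c D).ncard ≤ (Cr act S P R c' D).ncard := by
  refine ncard_le_of_rel (fun e e' => ∃ g ∈ ballG S D, act e.1 (P e.2.1) = act c g ∧
    act e'.1 (P e.2.1) = act c' g ∧ e.2 = e'.2) ?_ ?_
    (A.cr_rel_ballG hP hD).1
  · rintro ⟨x, i, j⟩ he
    have b1 : ∀ t, i ≤ t → t ≤ j → odist act S (act x (P t)) c ≤ D :=
      fun t ht ht' => A.cr_dist_le hP hD he ht ht'
    obtain ⟨h1, h2, h3, h4, h5, h6, h7⟩ := he
    simp only at *
    have ho : ∀ t, act x (P t) ∈ orbit act c := fun t => A.act_mem_orbit h1 _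
    obtain ⟨g, hg, hg'⟩ := A.exists_ballG_of_dist_le (ho i) (b1 i le_rfl h2.le)
    set y := act c' (g * (P i)⁻¹) with hy
    have hyi : act y (P i) = act c' g := by rw [hy, A.mul]; simp
    have key : ∀ t, i ≤ t → t ≤ j → ∃ k ∈ ballG S D, act x (P t) = act c k ∧
        act y (P t) = act c' k := by
      intro t ht
      induction t, ht using Nat.le_induction with
      | base => exact fun _ => ⟨g, hg, hg'.symm, hyi⟩
      | succ t ht ih =>
        intro ht'
        obtain ⟨k, hk, hk1, hk2⟩ := ih (by omega)
        obtain ⟨s, hs, hs'⟩ := hP t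
        obtain ⟨k', hk', hk''⟩ := A.exists_ballG_of_dist_le (ho (t + 1)) (b1 _ (by omega) ht')
        refine ⟨k', hk', hk''.symm, ?_⟩
        rw [hs', ← A.mul, hk2, A.mul]
        rw [hs', ← A.mul, hk1, A.mul] at hk''
        exact ((h.eq_iff A.toRightAct hk' (mul_mem_ballG hk hs) (by omega)).1 hk'').symm
    have dk : ∀ t, i ≤ t → t ≤ j → odist act S (act x (P t)) c = odist act S (act y (P t)) c' := by
      intro t ht ht'
      obtain ⟨k, hk, hk1, hk2⟩ := key t ht ht'
      rw [hk1, hk2]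
      exact h.dist_base A.toRightAct hk (by omega)
    refine ⟨(y, i, j), ⟨A.mem_orbit _ _, h2, h3, ?_, ?_, ?_, ?_⟩, g, hg, hg'.symm, hyi, rfl⟩
    · simp only; rw [← dk i le_rfl h2.le]; exact h4
    · simp only; rw [← dk j h2.le le_rfl]; exact h5
    · intro t ht ht'
      simp only at *
      rw [← dk t ht.le ht'.le]
      exact h6 t ht ht'
    · obtain ⟨k, hk, hk1, hk2⟩ := key j h2.le le_rfl
      simp only
      rw [hyi, hk2, ← h.dist_eq A.toRightAct hg hk (by omega), hg', ← hk1]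
      exact h7
  · rintro ⟨x, i, j⟩ he ⟨x', i', j'⟩ he' ⟨y, k, l⟩ hy ⟨g, hg, a1, a2, a3⟩ ⟨g', hg', b1, b2, b3⟩
    simp only [Prod.mk.injEq] at *
    obtain ⟨rfl, rfl⟩ := a3
    obtain ⟨rfl, rfl⟩ := b3
    have h1 : act c' g = act c' g' := by rw [← a2, b2]
    have h2 := (h.eq_iff A.toRightAct hg hg' (by omega)).2 h1
    refine ⟨(A.act_left_inj (P i')).1 ?_, rfl, rfl⟩
    rw [a1, b1, h2]

theorem cr_ncard_le (hP : IsPath S P) {c c' : X} (hc : IsRegular act c)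
    (hc' : IsRegular act c') {D D' : ℕ} (hD : 2 * δ + 10 ≤ D)
    (hD' : 2 * (L * (4 * D + 4)) + D + δ + 1 ≤ D') :
    (Cr act S P R c D').ncard ≤ (Cr act S P R c' D).ncard := by
  obtain ⟨b, hb, h⟩ := A.rep c' c hc' hc (4 * D + 4)
  exact (A.cr_ncard_le_of_near hP hc (A.mem_orbit c b) (odist_le hb rfl) hD hD').trans
    (A.cr_ncard_le_of_eqv hP (by omega) h)

end LinRep

end Cr

/-- `T` represents all germs of the stabilizer of `ξ`, and `U` is a neighborhood of `ξ` on which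
these germs describe the action of all elements of length at most `n`. -/
structure LocalGerms (act : X → G → X) (S : Set G) (ξ : X) (T : Finset G) (τ : ℕ) (U : Set X)
    (n : ℕ) : Prop where
  mem : ξ ∈ U
  stab : ∀ t ∈ T, act ξ t = ξ
  short : ∀ t ∈ T, t ∈ ballG S τ
  fix : ∀ g ∈ ballG S n, act ξ g = ξ → ∃ t ∈ T, ∀ y ∈ U, act y g = act y t
  mov : ∀ g ∈ ballG S n, ∀ y ∈ U, act y g = y → act ξ g = ξ

/-- On `U`, the element `γ` acts as `t * g` with `t ∈ T` and `g` of length at most `m`. -/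
def IsShort (act : X → G → X) (S : Set G) (T : Finset G) (U : Set X) (m : ℕ) (γ : G) : Prop :=
  ∃ t ∈ T, ∃ g ∈ ballG S m, ∀ y ∈ U, act y γ = act y (t * g)

section LocalGerms

variable {act : X → G → X} {S : Set G} {ξ : X} {T : Finset G} {τ n : ℕ} {U : Set X}

theorem exists_finset_germs (A : RightAct act S)
    (hgermfin : ∃ T : Finset G, ∀ g ∈ stab act ξ, ∃ h ∈ T, SameGerm act ξ g h) :
    ∃ (T : Finset G) (τ : ℕ), (∀ t ∈ T, act ξ t = ξ) ∧ (∀ t ∈ T, t ∈ ballG S τ) ∧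
      ∀ g ∈ stab act ξ, ∃ h ∈ T, SameGerm act ξ g h := by
  classical
  obtain ⟨T₀, hT₀⟩ := hgermfin
  choose len hlen using exists_mem_ballG A.invol A.gen
  refine ⟨T₀.filter fun t => act ξ t = ξ, T₀.sup len, fun t ht => (Finset.mem_filter.1 ht).2,
    fun t ht => ballG_mono (Finset.le_sup (f := len) (Finset.mem_filter.1 ht).1) (hlen t),
    fun g hg => ?_⟩
  obtain ⟨h, hh, V, hV, hgh⟩ := hT₀ g hg
  refine ⟨h, Finset.mem_filter.2 ⟨hh, ?_⟩, V, hV, hgh⟩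
  rw [← hgh ξ (mem_of_mem_nhds hV)]
  exact hg

theorem exists_localGerms [T2Space X] (A : RightAct act S)
    (hcont : ∀ g : G, Continuous fun x : X => act x g)
    (hstab : ∀ t ∈ T, act ξ t = ξ) (hshort : ∀ t ∈ T, t ∈ ballG S τ)
    (hT : ∀ g ∈ stab act ξ, ∃ h ∈ T, SameGerm act ξ g h) (n : ℕ) :
    ∃ U ∈ nhds ξ, LocalGerms act S ξ T τ U n := by
  have key : ∀ g, ∃ V ∈ nhds ξ, (act ξ g = ξ → ∃ t ∈ T, ∀ y ∈ V, act y g = act y t) ∧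
      ∀ y ∈ V, act y g = y → act ξ g = ξ := by
    intro g
    by_cases hg : act ξ g = ξ
    · obtain ⟨t, ht, V, hV, h⟩ := hT g hg
      exact ⟨V, hV, fun _ => ⟨t, ht, h⟩, fun _ _ _ => hg⟩
    · have hopen : IsOpen {y | act y g ≠ y} := isOpen_ne_fun (hcont g) continuous_id
      exact ⟨_, hopen.mem_nhds hg, fun h => absurd h hg, fun y hy h => absurd h hy⟩
  choose V hV h1 h2 using key
  have hU : (⋂ g ∈ ballG S n, V g) ∈ nhds ξ :=
    (Filter.biInter_mem (ballG_finite A.fin n)).2 fun g _ => hV g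
  refine ⟨_, hU, mem_of_mem_nhds hU, hstab, hshort, fun g hg hgξ => ?_, fun g hg y hy => ?_⟩
  · obtain ⟨t, ht, h⟩ := h1 g hgξ
    exact ⟨t, ht, fun y hy => h y (Set.mem_iInter₂.1 hy g hg)⟩
  · exact h2 g y (Set.mem_iInter₂.1 hy g hg)

namespace LocalGerms

variable (H : LocalGerms act S ξ T τ U n) (A : RightAct act S)
include H A

theorem isShort_of_mem_ballG {m : ℕ} {g : G} (hg : g ∈ ballG S m) : IsShort act S T U m g := by
  obtain ⟨t, ht, h⟩ := H.fix 1 (one_mem_ballG n) (A.one ξ)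
  refine ⟨t, ht, g, hg, fun y hy => ?_⟩
  rw [← A.mul, ← h y hy, A.one]

omit H in
theorem isShort_step {m : ℕ} {γ s : G} (h : IsShort act S T U m γ) (hs : s ∈ ballG S 1) :
    IsShort act S T U (m + 1) (γ * s) := by
  obtain ⟨t, ht, g, hg, h⟩ := h
  refine ⟨t, ht, g * s, mul_mem_ballG hg hs, fun y hy => ?_⟩
  rw [← A.mul, h y hy, A.mul, mul_assoc]

theorem act_eq {t g : G} (ht : t ∈ T) : act ξ (t * g) = act ξ g := by
  rw [← A.mul, H.stab t ht]

theorem shrink {m m' : ℕ} {γ g' : G} (h : IsShort act S T U m γ) (hg' : g' ∈ ballG S m')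
    (he : act ξ g' = act ξ γ) (hn : τ + m + m' ≤ n) :
    ∃ t ∈ T, ∀ y ∈ U, act y γ = act y (t * g') := by
  obtain ⟨t, ht, g, hg, h⟩ := h
  have h1 : t * g * g'⁻¹ ∈ ballG S n :=
    ballG_mono hn (mul_mem_ballG (mul_mem_ballG (H.short t ht) hg) (A.inv_mem hg'))
  have h2 : act ξ (t * g * g'⁻¹) = ξ := by
    rw [← A.act_eq_iff, ← h ξ H.mem, he]
  obtain ⟨t', ht', h3⟩ := H.fix _ h1 h2
  refine ⟨t', ht', fun y hy => ?_⟩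
  have := h3 y hy
  rw [h y hy, ← A.mul y t' g', ← this, A.mul]
  simp

theorem eq_of_eq {m m' : ℕ} {γ γ' : G} (h : IsShort act S T U m γ) (h' : IsShort act S T U m' γ')
    {ζ : X} (hζ : ζ ∈ U) (he : act ζ γ = act ζ γ') (hn : 2 * τ + m + m' ≤ n) :
    act ξ γ = act ξ γ' := by
  obtain ⟨t, ht, g, hg, h⟩ := h
  obtain ⟨t', ht', g', hg', h'⟩ := h'
  rw [h ζ hζ, h' ζ hζ, A.act_eq_iff] at he
  rw [h ξ H.mem, h' ξ H.mem, A.act_eq_iff]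
  refine H.mov _ (ballG_mono (show (τ + m) + (τ + m') ≤ n by omega) ?_) ζ hζ he
  exact mul_mem_ballG (mul_mem_ballG (H.short t ht) hg)
    (A.inv_mem (mul_mem_ballG (H.short t' ht') hg'))

theorem dist_le {m : ℕ} {γ : G} (h : IsShort act S T U m γ) {ζ : X} (hζ : ζ ∈ U)
    (hn : 3 * τ + 2 * m ≤ n) :
    odist act S (act ξ γ) ξ ≤ odist act S (act ζ γ) ζ ∧
      odist act S (act ζ γ) ζ ≤ odist act S (act ξ γ) ξ + τ := by
  have o1 := A.self_mem_orbit (S := S) ζ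
  have o2 := A.mem_orbit ζ γ
  have o3 := A.self_mem_orbit (S := S) ξ
  have o4 := A.mem_orbit ξ γ
  rw [A.dist_symm o2 o1, A.dist_symm o4 o3]
  obtain ⟨t, ht, g, hg, hγ⟩ := id h
  constructor
  · obtain ⟨u, hu, hu'⟩ := A.geo o1 o2
    have h1 : odist act S ζ (act ζ γ) ≤ τ + m :=
      odist_le (mul_mem_ballG (H.short t ht) hg) (hγ ζ hζ).symm
    refine odist_le hu ?_
    exact (H.eq_of_eq A h (H.isShort_of_mem_ballG A hu) hζ hu'.symm (by omega)).symm
  · obtain ⟨u, hu, hu'⟩ := A.geo o3 o4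
    have h1 : odist act S ξ (act ξ γ) ≤ m :=
      odist_le hg (by rw [hγ ξ H.mem, H.act_eq A ht])
    obtain ⟨t', ht', h2⟩ := H.shrink A h hu hu' (by omega)
    have := odist_le (mul_mem_ballG (H.short t' ht') hu) (h2 ζ hζ).symm
    omega

/-- Shortness persists along a trajectory that stays close to `ζ`. -/
theorem isShort_track {P : ℕ → G} (hP : IsPath S P) {m i j : ℕ} {γ : G}
    (h : IsShort act S T U m (γ * P i)) {ζ : X} (hζ : ζ ∈ U)
    (hd : ∀ s, i ≤ s → s ≤ j → odist act S (act ζ (γ * P s)) ζ ≤ m)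
    (hn : 3 * τ + 2 * m + 2 ≤ n) {s : ℕ} (hs : i ≤ s) (hs' : s ≤ j) :
    IsShort act S T U m (γ * P s) := by
  induction s, hs using Nat.le_induction with
  | base => exact h
  | succ s hs ih =>
    obtain ⟨u, hu, hu'⟩ := hP s
    have h1 := isShort_step A (ih (by omega)) hu
    rw [mul_assoc, ← hu'] at h1
    have h2 := (H.dist_le A h1 hζ (by omega)).1.trans (hd (s + 1) (by omega) hs')
    obtain ⟨g, hg, hg'⟩ := A.exists_ballG_of_dist_le (A.mem_orbit ξ _) h2
    obtain ⟨t, ht, h3⟩ := H.shrink A h1 hg hg' (by omega)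
    exact ⟨t, ht, g, hg, h3⟩

end LocalGerms

/-- Excursions to the vicinity of `ξ` of the trajectories along `P` of points of the orbit
of `ξ`. -/
def Exc (act : X → G → X) (S : Set G) (P : ℕ → G) (R : ℕ) (ξ : X) (δ D : ℕ) : Set (X × ℕ × ℕ) :=
  {e | e.1 ∈ orbit act ξ ∧ e.2.1 < e.2.2 ∧ e.2.2 ≤ R ∧
    D ≤ odist act S (act e.1 (P e.2.1)) ξ ∧ D ≤ odist act S (act e.1 (P e.2.2)) ξ ∧
    (∀ t, e.2.1 < t → t < e.2.2 → odist act S (act e.1 (P t)) ξ < D) ∧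
    ∃ t, e.2.1 < t ∧ t < e.2.2 ∧ odist act S (act e.1 (P t)) ξ ≤ δ + 1}

/-- The excursions of points of the orbit of `ζ` that shadow the excursions to the vicinity
of `ξ`. -/
def ExcShadow (act : X → G → X) (S : Set G) (P : ℕ → G) (R : ℕ) (ξ : X) (δ D : ℕ) (T : Finset G)
    (U : Set X) (ζ : X) : Set (X × ℕ × ℕ) :=
  {e | ∃ γ, e.1 = act ζ γ ∧ (act ξ γ, e.2) ∈ Exc act S P R ξ δ D ∧
    IsShort act S T U D (γ * P e.2.1)}

theorem exc_dist_le (A : RightAct act S) {P : ℕ → G} (hP : IsPath S P) {R D δ : ℕ}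
    {e : X × ℕ × ℕ} (he : e ∈ Exc act S P R ξ δ D) {t : ℕ} (ht : e.2.1 ≤ t) (ht' : t ≤ e.2.2) :
    odist act S (act e.1 (P t)) ξ ≤ D := by
  obtain ⟨h1, h2, h3, h4, h5, h6, u, h7, h8, -⟩ := he
  rcases Nat.lt_or_ge e.2.1 t with h | h
  · rcases Nat.lt_or_ge t e.2.2 with h' | h'
    · exact (h6 t h h').le
    · have s := (A.path_step hP h1 (A.self_mem_orbit ξ) (e.2.2 - 1)).1
      have l := h6 (e.2.2 - 1) (by omega) (by omega)
      rw [show e.2.2 - 1 + 1 = e.2.2 by omega] at s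
      rw [show t = e.2.2 by omega]
      omega
  · have s := (A.path_step hP h1 (A.self_mem_orbit ξ) e.2.1).2
    have l := h6 (e.2.1 + 1) (by omega) (by omega)
    rw [show t = e.2.1 by omega]
    omega

theorem exc_finite (A : RightAct act S) {P : ℕ → G} (hP : IsPath S P) {R D δ : ℕ} :
    (Exc act S P R ξ δ D).Finite := by
  have hfin : ((ballG S D) ×ˢ ((Set.Iic R) ×ˢ (Set.Iic R))).Finite :=
    (ballG_finite A.fin D).prod ((Set.finite_Iic R).prod (Set.finite_Iic R))
  refine finite_of_rel (fun e g => act e.1 (P e.2.1) = act ξ g.1 ∧ e.2 = g.2) ?_ ?_ hfin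
  · intro e he
    obtain ⟨g, hg, hg'⟩ := A.exists_ballG_of_dist_le (A.act_mem_orbit he.1 _)
      (exc_dist_le A hP he le_rfl he.2.1.le)
    exact ⟨(g, e.2), ⟨hg, he.2.1.le.trans he.2.2.1, he.2.2.1⟩, hg'.symm, rfl⟩
  · rintro ⟨x, i, j⟩ - ⟨x', i', j'⟩ - ⟨g, k, l⟩ - ⟨h1, h2⟩ ⟨h3, h4⟩
    simp only [Prod.mk.injEq] at *
    obtain ⟨rfl, rfl⟩ := h2
    obtain ⟨rfl, rfl⟩ := h4
    exact ⟨(A.act_left_inj _).1 (h1.trans h3.symm), rfl, rfl⟩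

end LocalGerms

section Shadow

variable {act : X → G → X} {S : Set G} {ξ : X} {T : Finset G} {τ n : ℕ} {U : Set X}
  {P : ℕ → G} {R δ D : ℕ}

namespace LocalGerms

variable (H : LocalGerms act S ξ T τ U n)
include H

theorem isShort_of_exc (A : RightAct act S) (hP : IsPath S P) (hn : 10 * (D + τ + δ + 1) ≤ n)
    {γ : G} {i j : ℕ} (he : (act ξ γ, i, j) ∈ Exc act S P R ξ δ D)
    (hs : IsShort act S T U D (γ * P i)) {s : ℕ} (h1 : i ≤ s) (h2 : s ≤ j) :
    IsShort act S T U D (γ * P s) := by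
  refine H.isShort_track A hP hs H.mem (fun s h1 h2 => ?_) (by omega) h1 h2
  have := exc_dist_le A hP he h1 h2
  simpa only [A.mul] using this

theorem excShadow_ncard_le (A : RightAct act S) (hP : IsPath S P)
    (hn : 10 * (D + τ + δ + 1) ≤ n) {ζ : X} (hζ : ζ ∈ U) :
    (ExcShadow act S P R ξ δ D T U ζ).Finite ∧
      (ExcShadow act S P R ξ δ D T U ζ).ncard ≤ T.card * (Exc act S P R ξ δ D).ncard := by
  have hg : ∀ e : X × ℕ × ℕ, ∃ g, e ∈ Exc act S P R ξ δ D →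
      g ∈ ballG S D ∧ act ξ g = act e.1 (P e.2.1) := by
    intro e
    by_cases he : e ∈ Exc act S P R ξ δ D
    · obtain ⟨g, hg, hg'⟩ := A.exists_ballG_of_dist_le (A.act_mem_orbit he.1 _)
        (exc_dist_le A hP he le_rfl he.2.1.le)
      exact ⟨g, fun _ => ⟨hg, hg'⟩⟩
    · exact ⟨1, fun h => absurd h he⟩
  choose g hg using hg
  have hfin : ((T : Set G) ×ˢ Exc act S P R ξ δ D).Finite :=
    T.finite_toSet.prod (exc_finite A hP)
  let r : X × ℕ × ℕ → G × X × ℕ × ℕ → Prop := fun e w =>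
    act e.1 (P e.2.1) = act ζ (w.1 * g w.2) ∧ e.2 = w.2.2
  have hr : ∀ e ∈ ExcShadow act S P R ξ δ D T U ζ, ∃ w ∈ (T : Set G) ×ˢ Exc act S P R ξ δ D,
      r e w := by
    rintro ⟨x, i, j⟩ ⟨γ, h1, h2, h3⟩
    simp only at *
    obtain ⟨h4, h5⟩ := hg _ h2
    simp only at h5
    rw [A.mul] at h5
    obtain ⟨t, ht, h6⟩ := H.shrink A h3 h4 h5 (by omega)
    refine ⟨(t, (act ξ γ, i, j)), ⟨ht, h2⟩, ?_, rfl⟩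
    simp only
    rw [h1, A.mul, h6 ζ hζ]
  have hinj : ∀ e ∈ ExcShadow act S P R ξ δ D T U ζ, ∀ e' ∈ ExcShadow act S P R ξ δ D T U ζ,
      ∀ w ∈ (T : Set G) ×ˢ Exc act S P R ξ δ D, r e w → r e' w → e = e' := by
    rintro ⟨x, i, j⟩ - ⟨x', i', j'⟩ - ⟨t, p, k, l⟩ - ⟨h1, h2⟩ ⟨h3, h4⟩
    simp only [Prod.mk.injEq] at *
    obtain ⟨rfl, rfl⟩ := h2
    obtain ⟨rfl, rfl⟩ := h4
    exact ⟨(A.act_left_inj _).1 (h1.trans h3.symm), rfl, rfl⟩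
  refine ⟨finite_of_rel r hr hinj hfin, (ncard_le_of_rel r hr hinj hfin).trans ?_⟩
  rw [Set.ncard_prod, Set.ncard_coe_finset]

/-- Given a fixed point `ζ h ∈ U` of each `h ∈ T`, for some `h ∈ T` at least a proportion
`1 / T.card` of the excursions of the orbit of `ξ` are shadowed by excursions of the orbit of `ζ h`
whose end points are close to each other. -/
theorem exists_closing (A : RightAct act S) (hP : IsPath S P)
    (hQ : ∀ x ∈ orbit act ξ, ∀ y ∈ orbit act ξ,
      odist act S x y + odist act S x ξ ≤ odist act S y ξ + δ ∨
      odist act S x y + odist act S y ξ ≤ odist act S x ξ + δ)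
    (hn : 10 * (D + τ + δ + 1) ≤ n) {ζ : G → X} (hζ : ∀ h ∈ T, ζ h ∈ U)
    (hζ' : ∀ h ∈ T, act (ζ h) h = ζ h) :
    ∃ h ∈ T, (Exc act S P R ξ δ D).ncard ≤ T.card *
      {e | e ∈ ExcShadow act S P R ξ δ D T U (ζ h) ∧
        odist act S (act e.1 (P e.2.1)) (act e.1 (P e.2.2)) ≤ δ}.ncard := by
  classical
  obtain ⟨t₀, ht₀, -⟩ := H.fix 1 (one_mem_ballG n) (A.one ξ)
  set F : G → Set (X × ℕ × ℕ) := fun h => {e | e ∈ ExcShadow act S P R ξ δ D T U (ζ h) ∧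
        odist act S (act e.1 (P e.2.1)) (act e.1 (P e.2.2)) ≤ δ} with hF
  have hFfin : ∀ h ∈ T, (F h).Finite := fun h hh =>
    (H.excShadow_ncard_le A hP hn (hζ h hh)).1.subset fun e he => he.1
  have hg : ∀ e ∈ Exc act S P R ξ δ D, ∃ h ∈ T, ∃ γ, act ξ γ = e.1 ∧
      IsShort act S T U D (γ * P e.2.1) ∧ (act (ζ h) γ, e.2) ∈ F h := by
    rintro ⟨x, i, j⟩ he
    obtain ⟨g, hg, hg'⟩ := A.exists_ballG_of_dist_le (A.act_mem_orbit he.1 _)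
      (exc_dist_le A hP he le_rfl he.2.1.le)
    have l1 := exc_dist_le A hP he le_rfl he.2.1.le
    have l2 := exc_dist_le A hP he he.2.1.le le_rfl
    obtain ⟨e1, e2, -, e3, e4, -⟩ := id he
    have o1 := A.act_mem_orbit e1 (P i)
    have o2 := A.act_mem_orbit e1 (P j)
    simp only at *
    have hq := hQ _ o1 _ o2
    obtain ⟨b, hb, hb'⟩ := A.geo o2 o1
    rw [A.dist_symm o2 o1] at hb
    replace hb := ballG_mono (show _ ≤ δ by omega) hb
    set γ := g * (P i)⁻¹ with hγ
    have hγi : γ * P i = g := by rw [hγ]; simp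
    have hx : act ξ γ = x := by
      rw [hγ, ← A.mul, hg', A.mul, mul_inv_cancel, A.one]
    have hs : IsShort act S T U D (γ * P i) := by
      rw [hγi]
      exact H.isShort_of_mem_ballG A hg
    have hsj := H.isShort_of_exc A hP hn (by rw [hx]; exact he) hs he.2.1.le le_rfl
    obtain ⟨t, ht, k, hk, hsj'⟩ := hsj
    have hcl : IsShort act S T U (D + δ + D) (γ * P j * b * g⁻¹) := by
      refine ⟨t, ht, k * b * g⁻¹, mul_mem_ballG (mul_mem_ballG hk hb) (A.inv_mem hg),
        fun y hy => ?_⟩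
      rw [mul_assoc, ← A.mul, hsj' y hy, A.mul]
      simp only [mul_assoc]
    have hcl' : act ξ 1 = act ξ (γ * P j * b * g⁻¹) := by
      rw [A.one, ← A.mul, ← A.mul, ← A.mul, hx, hb', ← hg', A.mul, mul_inv_cancel, A.one]
    obtain ⟨h, hh, hcl2⟩ := H.shrink A hcl (one_mem_ballG 0) hcl' (by omega)
    refine ⟨h, hh, γ, hx, hs, ⟨γ, rfl, by rw [hx]; exact he, hs⟩, ?_⟩
    have h1 := hcl2 _ (hζ h hh)
    rw [mul_one, hζ' h hh, ← A.act_eq_iff, ← hγi] at h1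
    simp only
    rw [A.mul, A.mul, ← h1]
    exact odist_le (A.inv_mem hb) (by rw [A.mul]; simp)
  set E : G → Set (X × ℕ × ℕ) := fun h => {e | e ∈ Exc act S P R ξ δ D ∧ ∃ γ, act ξ γ = e.1 ∧
      IsShort act S T U D (γ * P e.2.1) ∧ (act (ζ h) γ, e.2) ∈ F h} with hE
  have hEF : ∀ h ∈ T, (E h).ncard ≤ (F h).ncard := by
    intro h hh
    refine ncard_le_of_rel (fun e e' => ∃ γ, act ξ γ = e.1 ∧
      IsShort act S T U D (γ * P e.2.1) ∧ (act (ζ h) γ, e.2) = e') ?_ ?_ (hFfin h hh)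
    · rintro e ⟨-, γ, h1, h2, h3⟩
      exact ⟨_, h3, γ, h1, h2, rfl⟩
    · rintro ⟨x, i, j⟩ - ⟨x', i', j'⟩ - ⟨y, k, l⟩ - ⟨γ, h1, h2, h3⟩ ⟨γ', h1', h2', h3'⟩
      simp only [Prod.mk.injEq] at *
      obtain ⟨h3, rfl, rfl⟩ := h3
      obtain ⟨h3', rfl, rfl⟩ := h3'
      have := H.eq_of_eq A h2 h2' (hζ h hh) (by rw [← A.mul, ← A.mul, h3, h3']) (by omega)
      rw [← A.mul, ← A.mul, A.act_left_inj, h1, h1'] at this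
      exact ⟨this, rfl, rfl⟩
  by_contra hcon
  push Not at hcon
  have hsub : Exc act S P R ξ δ D ⊆ ⋃ h ∈ T, E h := by
    intro e he
    obtain ⟨h, hh, hγ⟩ := hg e he
    exact Set.mem_biUnion hh ⟨he, hγ⟩
  have hle : (Exc act S P R ξ δ D).ncard ≤ ∑ h ∈ T, (E h).ncard := by
    refine (Set.ncard_le_ncard hsub (Set.Finite.biUnion T.finite_toSet fun h _ =>
      (exc_finite A hP).subset fun e he => he.1)).trans ?_
    exact Finset.set_ncard_biUnion_le T E
  have h1 : ∑ h ∈ T, T.card * (F h).ncard < ∑ _h ∈ T, (Exc act S P R ξ δ D).ncard :=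
    Finset.sum_lt_sum_of_nonempty ⟨t₀, ht₀⟩ hcon
  rw [← Finset.mul_sum, Finset.sum_const, smul_eq_mul] at h1
  have h2 : ∑ h ∈ T, (E h).ncard ≤ ∑ h ∈ T, (F h).ncard := Finset.sum_le_sum hEF
  have h3 := Nat.mul_le_mul_left T.card (hle.trans h2)
  omega

theorem cr_ncard_le_excShadow {L : ℕ} (A : LinRep act S L δ) (hP : IsPath S P)
    (hn : 10 * (D + τ + δ + 1) ≤ n) (hD : 2 * δ + 2 * τ + 10 ≤ D) {ζ : X} (hζ : ζ ∈ U)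
    (hreg : IsRegular act ζ) :
    (Cr act S P R ζ (D + τ)).ncard ≤ {e | e ∈ ExcShadow act S P R ξ δ D T U ζ ∧
        δ < odist act S (act e.1 (P e.2.1)) (act e.1 (P e.2.2))}.ncard := by
  refine ncard_le_of_rel (fun e e' => e.1 = e'.1 ∧ e.2.1 ≤ e'.2.1 ∧ e'.2.2 ≤ e.2.2) ?_ ?_
    ((H.excShadow_ncard_le A.toRightAct hP hn hζ).1.subset fun e he => he.1)
  · rintro ⟨x, i, j⟩ he
    have b1 : ∀ t, i ≤ t → t ≤ j → odist act S (act x (P t)) ζ ≤ D + τ :=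
      fun t ht ht' => A.cr_dist_le hP (by omega) he ht ht'
    obtain ⟨h1, h2, h3, h4, h5, h6, h7⟩ := he
    simp only at *
    have ho : ∀ t, act x (P t) ∈ orbit act ζ := fun t => A.act_mem_orbit h1 _
    have hζζ := A.self_mem_orbit ζ
    have hξξ := A.self_mem_orbit ξ
    obtain ⟨g, hg, hg'⟩ := A.exists_ballG_of_dist_le (ho i) (b1 i le_rfl h2.le)
    obtain ⟨γ, hγ⟩ : ∃ γ, γ = g * (P i)⁻¹ := ⟨_, rfl⟩
    have hγi : γ * P i = g := by rw [hγ]; simp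
    have hx : act ζ γ = x := by
      rw [hγ, ← A.mul, hg', A.mul, mul_inv_cancel, A.one]
    have hs : IsShort act S T U (D + τ) (γ * P i) := by
      rw [hγi]
      exact H.isShort_of_mem_ballG A.toRightAct hg
    have htr : ∀ s, i ≤ s → s ≤ j → IsShort act S T U (D + τ) (γ * P s) := fun s hs1 hs2 =>
      H.isShort_track A.toRightAct hP hs hζ
        (fun s h1 h2 => by rw [← A.mul, hx]; exact b1 s h1 h2) (by omega) hs1 hs2
    have hf : ∀ t, i ≤ t → t ≤ j →
        odist act S (act (act ξ γ) (P t)) ξ ≤ odist act S (act x (P t)) ζ ∧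
        odist act S (act x (P t)) ζ ≤ odist act S (act (act ξ γ) (P t)) ξ + τ := by
      intro t ht ht'
      have := H.dist_le A.toRightAct (htr t ht ht') hζ (by omega)
      rwa [← A.mul, ← A.mul, hx] at this
    have hqi : odist act S (act x (P i)) ζ = D + τ := le_antisymm (b1 i le_rfl h2.le) h4
    have hcol : ∀ t, Col3 act S δ (act x (P t)) ζ (act x (P i)) := fun t =>
      A.col ζ hreg _ (ho t) _ hζζ _ (ho i)
    unfold Col3 at hcol
    rw [A.dist_symm hζζ (ho i)] at hcol
    have fi := hf i le_rfl h2.le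
    have fj := hf j h2.le le_rfl
    have bi := b1 i le_rfl h2.le
    have bj := b1 j h2.le le_rfl
    have cj := hcol j
    rw [A.dist_symm (ho j) (ho i)] at cj
    obtain ⟨i', j', a1, a2, a3, a4, a5, a6, a7, t₀, a8, a9, a10⟩ := exists_crossing
      (f := fun t => odist act S (act (act ξ γ) (P t)) ξ)
      (ρ := fun t => odist act S (act x (P t)) ζ)
      (σ := fun t => odist act S (act x (P t)) (act x (P i))) (δ := δ) (τ := τ) (D := D)
      (q := D + τ) (i := i) (j := j) h2.le hf
      (A.path_step hP h1 hζζ) (A.path_step hP h1 (ho i))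
      (fun t _ _ => by have := hcol t; omega)
      (A.dist_self _) hqi (by omega) (by omega)
      (by rw [A.dist_symm (ho j) (ho i)]; omega) hD
    have f0 := hf t₀ (by omega) (by omega)
    have hexc : (act ξ γ, i', j') ∈ Exc act S P R ξ δ D :=
      ⟨A.mem_orbit _ _, a2, a3.trans h3, a4, a5, a6, t₀, a8, a9, by simp only at *; omega⟩
    refine ⟨(x, i', j'), ⟨⟨γ, hx.symm, hexc, ?_⟩, ?_⟩, rfl, a1, a3⟩
    · have := exc_dist_le A.toRightAct hP hexc le_rfl a2.le
      obtain ⟨u, hu, hu'⟩ := A.exists_ballG_of_dist_le (A.act_mem_orbit (A.mem_orbit ξ γ) _) this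
      simp only at hu'
      rw [A.mul] at hu'
      obtain ⟨t, ht, h⟩ := H.shrink A.toRightAct (htr i' a1 (by omega)) hu hu' (by omega)
      exact ⟨t, ht, u, hu, h⟩
    · have := A.dist_tri (ho j') (ho i') (ho i)
      have := A.dist_symm (ho i') (ho j')
      simp only at *
      omega
  · rintro ⟨x, i, j⟩ he ⟨x', i', j'⟩ he' ⟨y, k, l⟩ hy ⟨a1, a2, a3⟩ ⟨b1, b2, b3⟩
    obtain ⟨⟨γ, -, ⟨-, -, -, -, -, -, t, hl, hl', -⟩, -⟩, -⟩ := hy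
    simp only at *
    subst a1 b1
    obtain ⟨-, u1, u2, u3, u4, u5, u6⟩ := he
    obtain ⟨-, v1, v2, v3, v4, v5, v6⟩ := he'
    have := interval_unique (f := fun t => odist act S (act x' (P t)) ζ) u3 u4 u5 v3 v4 v5
      (s := k + 1) ⟨by simp only; omega, by simp only; omega⟩ ⟨by simp only; omega, by simp only; omega⟩
    simp only at this
    rw [this.1, this.2]

end LocalGerms

/-- Two points `v false` and `v true`, one on each side of `ζ`, separating `ζ` from all points
at distance about `10 * D` from it. -/
theorem LinRep.exists_sides {L : ℕ} (A : LinRep act S L δ) (hD : 100 * (δ + τ + 1) ≤ D) {ζ : X}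
    (hζ : IsRegular act ζ) :
    ∃ v : Bool → X, (∀ b, v b ∈ orbit act ζ) ∧ ∀ y ∈ orbit act ζ,
      10 * D ≤ odist act S y ζ → odist act S y ζ ≤ 10 * D + τ →
      ∃ b, ∀ z ∈ orbit act ζ, odist act S z ζ ≤ δ + τ + 1 →
        D ≤ odist act S y (v b) ∧ D ≤ odist act S z (v b) ∧
        odist act S z (v b) + odist act S y (v b) ≤ odist act S z y + δ := by
  have hζζ := A.self_mem_orbit ζ
  have sep : ∀ y₀ ∈ orbit act ζ, 10 * D ≤ odist act S y₀ ζ → odist act S y₀ ζ ≤ 10 * D + τ →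
      ∃ v ∈ orbit act ζ, ∀ y ∈ orbit act ζ, odist act S y y₀ ≤ τ + δ →
        10 * D ≤ odist act S y ζ → odist act S y ζ ≤ 10 * D + τ →
        ∀ z ∈ orbit act ζ, odist act S z ζ ≤ δ + τ + 1 →
        D ≤ odist act S y v ∧ D ≤ odist act S z v ∧
        odist act S z v + odist act S y v ≤ odist act S z y + δ := by
    intro y₀ hy₀ h1 h2
    obtain ⟨g, hg, hg'⟩ := A.exists_ballG_of_dist_le hy₀ h2
    obtain ⟨a, ha, b, hb, rfl⟩ := ballG_split (k := 5 * D) hg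
    have hv := A.mem_orbit ζ a
    have d1 : odist act S ζ (act ζ a) ≤ 5 * D := odist_le ha rfl
    have d2 : odist act S (act ζ a) y₀ ≤ 5 * D + τ :=
      (odist_le hb (by rw [A.mul, hg'])).trans (by omega)
    refine ⟨_, hv, fun y hy e1 e2 e3 z hz e4 => ?_⟩
    have s1 := A.dist_symm hζζ hv
    have s2 := A.dist_symm hv hy₀
    have s3 := A.dist_symm hz hζζ
    have s4 := A.dist_symm hy hz
    have s5 := A.dist_symm hv hy
    have s6 := A.dist_symm hv hz
    have t1 := A.dist_tri hy₀ hv hζζ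
    have t2 := A.dist_tri hy hy₀ hv
    have t3 := A.dist_tri hz hζζ hv
    have t4 := A.dist_tri hy hv hζζ
    have t5 := A.dist_tri hy hz hζζ
    have t6 := A.dist_tri hζζ hz hv
    have c := A.col ζ hζ _ hz _ hv _ hy
    unfold Col3 at c
    omega
  by_cases h0 : ∃ y₁ ∈ orbit act ζ, 10 * D ≤ odist act S y₁ ζ ∧ odist act S y₁ ζ ≤ 10 * D + τ
  swap
  · exact ⟨fun _ => ζ, fun _ => hζζ, fun y hy h1 h2 => absurd ⟨y, hy, h1, h2⟩ h0⟩
  obtain ⟨y₁, hy₁, p1, p2⟩ := h0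
  obtain ⟨v₁, hv₁, hv₁'⟩ := sep y₁ hy₁ p1 p2
  by_cases h1 : ∃ y₂ ∈ orbit act ζ, τ + δ < odist act S y₂ y₁ ∧
      10 * D ≤ odist act S y₂ ζ ∧ odist act S y₂ ζ ≤ 10 * D + τ
  swap
  · refine ⟨fun _ => v₁, fun _ => hv₁, fun y hy q1 q2 => ⟨true, fun z hz q3 => ?_⟩⟩
    refine hv₁' y hy ?_ q1 q2 z hz q3
    by_contra h
    exact h1 ⟨y, hy, by omega, q1, q2⟩
  obtain ⟨y₂, hy₂, p3, p4, p5⟩ := h1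
  obtain ⟨v₂, hv₂, hv₂'⟩ := sep y₂ hy₂ p4 p5
  refine ⟨fun b => if b then v₁ else v₂, fun b => by cases b <;> simp [hv₁, hv₂],
    fun y hy q1 q2 => ?_⟩
  by_cases hc : odist act S y y₁ ≤ τ + δ
  · exact ⟨true, fun z hz q3 => hv₁' y hy hc q1 q2 z hz q3⟩
  · refine ⟨false, fun z hz q3 => hv₂' y hy ?_ q1 q2 z hz q3⟩
    have c1 := A.col ζ hζ _ hy₁ _ hy₂ _ hζζ
    have c2 := A.col ζ hζ _ hy₁ _ hy _ hζζ
    have c3 := A.col ζ hζ _ hy₂ _ hy _ hζζ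
    have c4 := A.col ζ hζ _ hy₁ _ hy₂ _ hy
    unfold Col3 at c1 c2 c3 c4
    have t1 := A.dist_tri hy₁ hζζ hy
    have t2 := A.dist_tri hy₁ hζζ hy₂
    have t3 := A.dist_tri hy₂ hζζ hy
    have s1 := A.dist_symm hζζ hy
    have s2 := A.dist_symm hζζ hy₂
    have s3 := A.dist_symm hy₁ hy₂
    have s4 := A.dist_symm hy₁ hy
    have s5 := A.dist_symm hy₂ hy
    omega

theorem LocalGerms.two_mul_excShadow_le (H : LocalGerms act S ξ T τ U n) {L : ℕ}
    (A : LinRep act S L δ) (hP : IsPath S P)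
    (hn : 10 * (10 * D + τ + δ + 1) ≤ n) (hD : 100 * (δ + τ + 1) ≤ D) {ζ : X} (hζ : ζ ∈ U)
    (hreg : IsRegular act ζ) :
    ∃ v₁ v₂, IsRegular act v₁ ∧ IsRegular act v₂ ∧
      2 * (ExcShadow act S P R ξ δ (10 * D) T U ζ).ncard ≤
        (Cr act S P R v₁ D).ncard + (Cr act S P R v₂ D).ncard := by
  classical
  obtain ⟨v, hv, hv'⟩ := A.exists_sides hD hreg
  have hvreg : ∀ b, IsRegular act (v b) := fun b => A.reg_of_mem hreg (hv b)
  refine ⟨v false, v true, hvreg _, hvreg _, ?_⟩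
  set E := ExcShadow act S P R ξ δ (10 * D) T U ζ with hE
  have hEfin := (H.excShadow_ncard_le (R := R) A.toRightAct hP hn hζ).1
  have hdist : ∀ e ∈ E, ∀ γ, e.1 = act ζ γ → (act ξ γ, e.2) ∈ Exc act S P R ξ δ (10 * D) →
      IsShort act S T U (10 * D) (γ * P e.2.1) → ∀ t, e.2.1 ≤ t → t ≤ e.2.2 →
      odist act S (act (act ξ γ) (P t)) ξ ≤ odist act S (act e.1 (P t)) ζ ∧
        odist act S (act e.1 (P t)) ζ ≤ odist act S (act (act ξ γ) (P t)) ξ + τ := by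
    rintro ⟨x, i, j⟩ - γ h1 h2 h3 t ht ht'
    have := H.dist_le A.toRightAct (H.isShort_of_exc A.toRightAct hP hn h2 h3 ht ht') hζ (by omega)
    rwa [← A.mul, ← A.mul, ← h1] at this
  have ht : ∀ e : X × ℕ × ℕ, ∃ t, e ∈ E → e.2.1 < t ∧ t < e.2.2 ∧
      odist act S (act e.1 (P t)) ζ ≤ δ + τ + 1 := by
    intro e
    by_cases he : e ∈ E
    · obtain ⟨γ, h1, h2, h3⟩ := id he
      obtain ⟨-, -, -, -, -, -, t, ht1, ht2, ht3⟩ := id h2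
      have := (hdist e he γ h1 h2 h3 t ht1.le ht2.le).2
      exact ⟨t, fun _ => ⟨ht1, ht2, by simp only at *; omega⟩⟩
    · exact ⟨0, fun h => absurd h he⟩
  choose t₀ ht₀ using ht
  set C : Set (Bool × X × ℕ × ℕ) := ({false} : Set Bool) ×ˢ Cr act S P R (v false) D ∪
    ({true} : Set Bool) ×ˢ Cr act S P R (v true) D with hC
  have hCmem : ∀ b e, e ∈ Cr act S P R (v b) D ↔ (b, e) ∈ C := by
    intro b e
    cases b <;> simp [hC]
  have hCfin : C.Finite :=
    ((Set.finite_singleton _).prod (A.cr_rel_ballG hP (by omega)).1).union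
      ((Set.finite_singleton _).prod (A.cr_rel_ballG hP (by omega)).1)
  have hCcard : C.ncard ≤ (Cr act S P R (v false) D).ncard + (Cr act S P R (v true) D).ncard := by
    refine (Set.ncard_union_le _ _).trans ?_
    rw [Set.ncard_prod, Set.ncard_prod]
    simp
  have hEcard : (E ×ˢ (Set.univ : Set Bool)).ncard = 2 * E.ncard := by
    rw [Set.ncard_prod, Set.ncard_univ]
    simp [mul_comm]
  rw [← hEcard]
  refine (ncard_le_of_rel (fun w w' => w'.2.1 = w.1.1 ∧
    (w.2 = false → w.1.2.1 ≤ w'.2.2.1 ∧ w'.2.2.2 ≤ t₀ w.1) ∧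
    (w.2 = true → t₀ w.1 ≤ w'.2.2.1 ∧ w'.2.2.2 ≤ w.1.2.2)) ?_ ?_ hCfin).trans hCcard
  · rintro ⟨⟨x, i, j⟩, b⟩ ⟨he, -⟩
    obtain ⟨q1, q2, q3⟩ := ht₀ _ he
    have hd := hdist _ he
    obtain ⟨γ, h1, h2, h3⟩ := id he
    have di := hd γ h1 h2 h3 i le_rfl h2.2.1.le
    have dj := hd γ h1 h2 h3 j h2.2.1.le le_rfl
    have li := exc_dist_le A.toRightAct hP h2 le_rfl h2.2.1.le
    have lj := exc_dist_le A.toRightAct hP h2 h2.2.1.le le_rfl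
    obtain ⟨-, -, hR, gi, gj, -⟩ := h2
    simp only at *
    set t := t₀ (x, i, j) with ht
    have hx : x ∈ orbit act ζ := ⟨γ, h1.symm⟩
    have ho : ∀ t, act x (P t) ∈ orbit act ζ := fun t => A.act_mem_orbit hx _
    cases b with
    | false =>
      obtain ⟨b, hb⟩ := hv' _ (ho i) (by omega) (by omega)
      obtain ⟨u1, u2, u3⟩ := hb _ (ho t) (by omega)
      obtain ⟨i', j', a1, a2, a3⟩ := A.exists_cr_of_between (R := R) hP (hvreg b) (x := x)
        (by rw [A.orbit_eq (hv b)]; exact hx) (by omega) q1.le (by omega) u1 u2 u3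
      exact ⟨(b, x, i', j'), (hCmem b _).1 a3, rfl, fun _ => ⟨a1, a2⟩, by simp⟩
    | true =>
      obtain ⟨b, hb⟩ := hv' _ (ho j) (by omega) (by omega)
      obtain ⟨u1, u2, u3⟩ := hb _ (ho t) (by omega)
      obtain ⟨i', j', a1, a2, a3⟩ := A.exists_cr_of_between (R := R) hP (hvreg b) (x := x)
        (by rw [A.orbit_eq (hv b)]; exact hx) (by omega) q2.le (by omega) u2 u1
        (by rw [A.dist_symm (ho j) (ho t)]; omega)
      exact ⟨(b, x, i', j'), (hCmem b _).1 a3, rfl, by simp, fun _ => ⟨a1, a2⟩⟩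
  · rintro ⟨⟨x, i, j⟩, b⟩ ⟨he, -⟩ ⟨⟨x', i', j'⟩, b'⟩ ⟨he', -⟩ ⟨d, y, k, l⟩ hw ⟨h1, h2, h3⟩
      ⟨h1', h2', h3'⟩
    have hkl := A.cr_lt hP (by omega) ((hCmem d _).2 hw)
    obtain ⟨q1, q2, q3⟩ := ht₀ _ he
    obtain ⟨q1', q2', q3'⟩ := ht₀ _ he'
    obtain ⟨γ, g1, g2, g3⟩ := id he
    obtain ⟨γ', g1', g2', g3'⟩ := id he'
    simp only at *
    subst h1 h1'
    have e1 : i ≤ k ∧ l ≤ j := by cases b <;> simp at h2 h3 <;> omega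
    have e2 : i' ≤ k ∧ l ≤ j' := by cases b' <;> simp at h2' h3' <;> omega
    have s1 := H.isShort_of_exc A.toRightAct hP hn g2 g3 (s := k + 1) (by omega) (by omega)
    have s2 := H.isShort_of_exc A.toRightAct hP hn g2' g3' (s := k + 1) (by omega) (by omega)
    have hγ := H.eq_of_eq A.toRightAct s1 s2 hζ (by rw [← A.mul, ← A.mul, ← g1, ← g1']) (by omega)
    rw [← A.mul, ← A.mul, A.act_left_inj] at hγ
    rw [← hγ] at g2'
    obtain ⟨-, -, -, f1, f2, f3, -⟩ := g2
    obtain ⟨-, -, -, f1', f2', f3', -⟩ := g2'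
    have := interval_unique (f := fun t => odist act S (act (act ξ γ) (P t)) ξ) f1 f2 f3 f1' f2' f3'
      (s := k + 1) ⟨by simp only; omega, by simp only; omega⟩ ⟨by simp only; omega, by simp only; omega⟩
    simp only at this
    obtain ⟨rfl, rfl⟩ := this
    have : b = b' := by
      cases b <;> cases b' <;> simp at h2 h3 h2' h3' ⊢ <;> omega
    rw [this]

theorem exists_contraction [T2Space X] {L : ℕ} (hL : 1 ≤ L) (A : LinRep act S L δ)
    (hcont : ∀ g : G, Continuous fun x : X => act x g)
    (hdense : Dense {x | IsRegular act x})
    (hQ : ∀ x ∈ orbit act ξ, ∀ y ∈ orbit act ξ,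
      odist act S x y + odist act S x ξ ≤ odist act S y ξ + δ ∨
      odist act S x y + odist act S y ξ ≤ odist act S x ξ + δ)
    (hgermfin : ∃ T : Finset G, ∀ g ∈ stab act ξ, ∃ h ∈ T, SameGerm act ξ g h)
    (hfixacc : ∀ g ∈ stab act ξ, ∀ U ∈ nhds ξ,
      (U ∩ interior {x : X | act x g = x}).Nonempty) :
    ∃ k D₀ : ℕ, 1 ≤ k ∧ ∀ D ≥ D₀, ∀ P : ℕ → G, IsPath S P → ∀ R N : ℕ,
      (∀ c, IsRegular act c → (Cr act S P R c D).ncard ≤ N) →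
      ∀ c, IsRegular act c → k * k * (Cr act S P R c (200 * L * D)).ncard + N ≤ k * k * N := by
  obtain ⟨T, τ, hT1, hT2, hT3⟩ := exists_finset_germs A.toRightAct hgermfin
  have hTpos : 1 ≤ T.card := by
    obtain ⟨t, ht, -⟩ := hT3 1 (A.one ξ)
    exact Finset.card_pos.2 ⟨t, ht⟩
  refine ⟨T.card, 100 * (δ + τ + 1), hTpos, fun D hD P hP R N hN c hc => ?_⟩
  obtain ⟨U, hU, H⟩ := exists_localGerms A.toRightAct hcont hT1 hT2 hT3
    (10 * (10 * D + τ + δ + 1))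
  have hζ : ∀ h, ∃ ζ, h ∈ T → ζ ∈ U ∧ act ζ h = ζ ∧ IsRegular act ζ := by
    intro h
    by_cases hh : h ∈ T
    · have hne := hfixacc h (hT1 h hh) (interior U) (interior_mem_nhds.2 hU)
      obtain ⟨ζ, ⟨h1, h2⟩, h3⟩ := hdense.inter_open_nonempty _
        (isOpen_interior.inter isOpen_interior) hne
      exact ⟨ζ, fun _ => ⟨interior_subset h1, interior_subset (s := {x | act x h = x}) h2, h3⟩⟩
    · exact ⟨ξ, fun h' => absurd h' hh⟩
  choose ζ hζ using hζ
  obtain ⟨h, hh, hclose⟩ := H.exists_closing (R := R) (D := 10 * D) A.toRightAct hP hQ le_rfl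
    (fun h hh => (hζ h hh).1) (fun h hh => (hζ h hh).2.1)
  obtain ⟨hζU, -, hζreg⟩ := hζ h hh
  obtain ⟨hfin, hcard⟩ := H.excShadow_ncard_le (R := R) (D := 10 * D) A.toRightAct hP le_rfl hζU
  obtain ⟨v₁, v₂, hv₁, hv₂, htwo⟩ := H.two_mul_excShadow_le (R := R) A hP le_rfl hD hζU hζreg
  have hcr := H.cr_ncard_le_excShadow (R := R) A hP le_rfl (by omega) hζU hζreg
  have hnt := A.cr_ncard_le (R := R) hP hc hζreg (D := 10 * D + τ) (D' := 200 * L * D)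
    (by omega) (by nlinarith)
  have hv₁' := hN v₁ hv₁
  have hv₂' := hN v₂ hv₂
  set E' := ExcShadow act S P R ξ δ (10 * D) T U (ζ h) with hE'
  have hsum : E'.ncard =
      {e | e ∈ E' ∧ odist act S (act e.1 (P e.2.1)) (act e.1 (P e.2.2)) ≤ δ}.ncard +
      {e | e ∈ E' ∧ δ < odist act S (act e.1 (P e.2.1)) (act e.1 (P e.2.2))}.ncard := by
    rw [← Set.ncard_union_eq _ (hfin.subset fun e he => he.1) (hfin.subset fun e he => he.1)]
    · congr 1
      ext e
      simp only [Set.mem_union, Set.mem_ofPred_eq]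
      constructor
      · intro he
        rcases Nat.lt_or_ge δ (odist act S (act e.1 (P e.2.1)) (act e.1 (P e.2.2))) with h | h
        · exact Or.inr ⟨he, h⟩
        · exact Or.inl ⟨he, h⟩
      · rintro (h | h)
        · exact h.1
        · exact h.1
    · rw [Set.disjoint_left]
      rintro e ⟨-, h1⟩ ⟨-, h2⟩
      omega
  generalize {e | e ∈ E' ∧ odist act S (act e.1 (P e.2.1)) (act e.1 (P e.2.2)) ≤ δ}.ncard = b₁ at *
  generalize {e | e ∈ E' ∧ δ < odist act S (act e.1 (P e.2.1)) (act e.1 (P e.2.2))}.ncard = b₂ at *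
  have hEN : E'.ncard ≤ N := by omega
  generalize E'.ncard = e at *
  generalize (Exc act S P R ξ δ (10 * D)).ncard = e₀ at *
  generalize (Cr act S P R c (200 * L * D)).ncard = q at *
  generalize T.card = k at *
  have i1 : e ≤ k * k * b₁ := by nlinarith
  have i2 : q ≤ b₂ := hnt.trans hcr
  obtain ⟨m, rfl⟩ := Nat.exists_eq_add_of_le hEN
  have i3 : 1 ≤ k * k := Nat.mul_pos hTpos hTpos
  nlinarith

end Shadow

section Scales

variable {act : X → G → X} {S : Set G} {ξ : X} {L δ : ℕ}

/-- Iterating the contraction, the number of passages through balls decays as a power of the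
radius. -/
theorem exists_cr_decay [T2Space X] (hL : 1 ≤ L) (A : LinRep act S L δ)
    (hcont : ∀ g : G, Continuous fun x : X => act x g)
    (hdense : Dense {x | IsRegular act x})
    (hQ : ∀ x ∈ orbit act ξ, ∀ y ∈ orbit act ξ,
      odist act S x y + odist act S x ξ ≤ odist act S y ξ + δ ∨
      odist act S x y + odist act S y ξ ≤ odist act S x ξ + δ)
    (hgermfin : ∃ T : Finset G, ∀ g ∈ stab act ξ, ∃ h ∈ T, SameGerm act ξ g h)
    (hfixacc : ∀ g ∈ stab act ξ, ∀ U ∈ nhds ξ,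
      (U ∩ interior {x : X | act x g = x}).Nonempty) :
    ∃ (θ K : ℝ) (D₀ : ℕ), 0 < θ ∧ θ < 1 ∧ 0 ≤ K ∧ 2 * δ + 10 ≤ D₀ ∧
      ∀ P : ℕ → G, IsPath S P → ∀ R m : ℕ, ∀ c, IsRegular act c →
        ((Cr act S P R c ((200 * L) ^ m * D₀)).ncard : ℝ) ≤ K * (R + 1) * θ ^ m := by
  obtain ⟨k, D₁, hk, hc⟩ := exists_contraction hL A hcont hdense hQ hgermfin hfixacc
  set D₀ := D₁ + 2 * δ + 10 with hD₀
  have hb : (0 : ℝ) < (k : ℝ) * k + 1 := by positivity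
  set θ : ℝ := 1 - 1 / ((k : ℝ) * k + 1) with hθ
  have hk' : (1 : ℝ) ≤ (k : ℝ) * k := by exact_mod_cast Nat.mul_pos hk hk
  have h0 : 0 < θ := by
    rw [hθ, sub_pos, div_lt_one hb]
    linarith
  have h1 : θ < 1 := by
    have : 0 < 1 / ((k : ℝ) * k + 1) := by positivity
    linarith
  refine ⟨θ, (ballG S D₀).ncard, D₀, h0, h1, by positivity, by omega, fun P hP R m => ?_⟩
  induction m with
  | zero =>
    intro c hc'
    have := (A.cr_rel_ballG hP (R := R) (c := c) (D := D₀) (by omega)).2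
    simp only [pow_zero, one_mul, mul_one]
    exact_mod_cast this
  | succ m ih =>
    intro c hc'
    have hpow : 1 ≤ (200 * L) ^ m := Nat.one_le_pow _ _ (by omega)
    have hD : D₁ ≤ (200 * L) ^ m * D₀ := by nlinarith
    have hM : (0 : ℝ) ≤ (ballG S D₀).ncard * (R + 1) * θ ^ m := by positivity
    have h := hc _ hD P hP R ⌊((ballG S D₀).ncard : ℝ) * (R + 1) * θ ^ m⌋₊
      (fun c hc => Nat.le_floor (ih c hc)) c hc'
    have h2 := Nat.floor_le hM
    rw [show 200 * L * ((200 * L) ^ m * D₀) = (200 * L) ^ (m + 1) * D₀ by ring] at h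
    generalize (Cr act S P R c ((200 * L) ^ (m + 1) * D₀)).ncard = q at *
    rw [pow_succ, ← mul_assoc]
    generalize ((ballG S D₀).ncard : ℝ) * (R + 1) * θ ^ m = M at *
    have h3 : (k : ℝ) * k * q + ⌊M⌋₊ ≤ (k : ℝ) * k * ⌊M⌋₊ := by exact_mod_cast h
    generalize (⌊M⌋₊ : ℝ) = N at *
    have h4 : M * θ = M * ((k : ℝ) * k) / (k * k + 1) := by
      rw [hθ]
      field_simp
      ring
    rw [h4, le_div_iff₀ hb]
    have h5 : (0 : ℝ) ≤ q := by positivity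
    have h6 : (k : ℝ) * k * (q * (k * k + 1)) ≤ k * k * (M * (k * k)) := by
      nlinarith [mul_le_mul_of_nonneg_left h2 (by linarith : (0 : ℝ) ≤ k * k - 1),
        mul_le_mul_of_nonneg_right h3 hb.le, mul_nonneg (by linarith : (0 : ℝ) ≤ k * k) hM]
    exact le_of_mul_le_mul_left h6 (by linarith)

theorem exists_cover_or_separated {Y : Type*} {E : Y → Y → Prop} (hrefl : ∀ x, E x x)
    (hsymm : ∀ x y, E x y → E y x) (Q : Set Y) (B : ℕ) :
    (∃ Z : Finset Y, Z.card ≤ B ∧ ↑Z ⊆ Q ∧ ∀ y ∈ Q, ∃ z ∈ Z, E z y) ∨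
    ∃ Z : Finset Y, Z.card = B ∧ ↑Z ⊆ Q ∧ ∀ z ∈ Z, ∀ z' ∈ Z, E z z' → z = z' := by
  classical
  induction B with
  | zero => exact Or.inr ⟨∅, by simp⟩
  | succ B ih =>
    rcases ih with ⟨Z, h1, h2, h3⟩ | ⟨Z, h1, h2, h3⟩
    · exact Or.inl ⟨Z, by omega, h2, h3⟩
    by_cases h : ∀ y ∈ Q, ∃ z ∈ Z, E z y
    · exact Or.inl ⟨Z, by omega, h2, h⟩
    push Not at h
    obtain ⟨y, hy, hy'⟩ := h
    have hmem : y ∉ Z := fun h => hy' y h (hrefl y)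
    refine Or.inr ⟨insert y Z, by rw [Finset.card_insert_of_notMem hmem, h1], ?_, ?_⟩
    · rw [Finset.coe_insert]
      exact Set.insert_subset hy h2
    · intro z hz z' hz' hzz
      rw [Finset.mem_insert] at hz hz'
      rcases hz with rfl | hz <;> rcases hz' with rfl | hz'
      · rfl
      · exact absurd (hsymm _ _ hzz) (hy' z' hz')
      · exact absurd hzz (hy' z hz)
      · exact h3 z hz z' hz' hzz

namespace LinRep

variable (A : LinRep act S L δ)
include A

theorem card_le_of_separated {n : ℕ} {ζ : X} (hζ : IsRegular act ζ) {Y : Finset X}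
    (hY : ∀ y ∈ Y, IsRegular act y) (hsep : ∀ y ∈ Y, ∀ y' ∈ Y, Eqv act S n y y' → y = y') :
    Y.card ≤ 3 * (ballG S (2 * δ)).ncard * (L * n + 1) := by
  rw [← Set.ncard_coe_finset]
  refine (ncard_le_of_rel (fun y x => Eqv act S n y x) ?_ ?_ ?_).trans
    (A.ball_ncard_le hζ (L * n))
  · intro y hy
    obtain ⟨b, hb, h⟩ := A.rep y ζ (hY y hy) hζ n
    refine ⟨act ζ b, ⟨A.mem_orbit ζ b, ?_⟩, h.symm⟩
    rw [A.dist_symm (A.mem_orbit ζ b) (A.self_mem_orbit ζ)]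
    exact odist_le hb rfl
  · rintro y hy y' hy' x - h h'
    exact hsep y hy y' hy' (h.trans h'.symm)
  · exact A.finite_ball ζ (L * n)

theorem exists_separated {B l N : ℕ} (hl : 1 ≤ l) (hex : ∃ ζ, IsRegular act ζ)
    (hcon : ∀ n, N ≤ n → n < 2 * N → ∀ q, IsRegular act q →
      ¬ ∃ Z : Finset X, Z.card ≤ B ∧ (∀ z ∈ Z, IsRegular act z ∧ Eqv act S (l ^ n) q z) ∧
        ∀ y, IsRegular act y → Eqv act S (l ^ n) q y → ∃ z ∈ Z, Eqv act S (l ^ (n + 1)) z y)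
    (i : ℕ) (hi : i ≤ N) :
    ∃ Y : Finset X, B ^ i ≤ Y.card ∧ (∀ y ∈ Y, IsRegular act y) ∧
      ∀ y ∈ Y, ∀ y' ∈ Y, Eqv act S (l ^ (N + i)) y y' → y = y' := by
  classical
  induction i with
  | zero =>
    obtain ⟨ζ, hζ⟩ := hex
    exact ⟨{ζ}, by simp, by simpa using hζ, by simp⟩
  | succ i ih =>
    obtain ⟨Y, h1, h2, h3⟩ := ih (by omega)
    have hstep : ∀ q, ∃ Z : Finset X, q ∈ Y → Z.card = B ∧
        ↑Z ⊆ {y | IsRegular act y ∧ Eqv act S (l ^ (N + i)) q y} ∧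
        ∀ z ∈ Z, ∀ z' ∈ Z, Eqv act S (l ^ (N + i + 1)) z z' → z = z' := by
      intro q
      by_cases hq : q ∈ Y
      · rcases exists_cover_or_separated (E := Eqv act S (l ^ (N + i + 1)))
          (fun x => Eqv.refl _ x) (fun x y h => h.symm)
          {y | IsRegular act y ∧ Eqv act S (l ^ (N + i)) q y} B with ⟨Z, z1, z2, z3⟩ | ⟨Z, hZ⟩
        · exact absurd ⟨Z, z1, fun z hz => z2 hz, fun y hy hy' => z3 y ⟨hy, hy'⟩⟩
            (hcon (N + i) (by omega) (by omega) q (h2 q hq))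
        · exact ⟨Z, fun _ => hZ⟩
      · exact ⟨∅, fun h => absurd h hq⟩
    choose Z hZ using hstep
    have key : ∀ q ∈ Y, ∀ q' ∈ Y, ∀ z ∈ Z q, ∀ z' ∈ Z q',
        Eqv act S (l ^ (N + (i + 1))) z z' → z = z' ∧ q = q' := by
      intro q hq q' hq' z hz z' hz' hE
      have e1 := ((hZ q hq).2.1 hz).2
      have e2 := ((hZ q' hq').2.1 hz').2
      have e3 := hE.mono (Nat.pow_le_pow_right hl (show N + i ≤ N + (i + 1) by omega))
      have hqq := h3 q hq q' hq' ((e1.trans e3).trans e2.symm)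
      subst hqq
      exact ⟨(hZ q hq).2.2 z hz z' hz' hE, rfl⟩
    refine ⟨Y.biUnion Z, ?_, ?_, ?_⟩
    · rw [Finset.card_biUnion, Finset.sum_congr rfl (fun q hq => (hZ q hq).1),
        Finset.sum_const, smul_eq_mul, pow_succ]
      · exact Nat.mul_le_mul_right _ h1
      · intro q hq q' hq' hne
        rw [Function.onFun, Finset.disjoint_left]
        intro z hz hz'
        exact hne (key q hq q' hq' z hz z hz' (Eqv.refl _ _)).2
    · intro y hy
      obtain ⟨q, hq, hz⟩ := Finset.mem_biUnion.1 hy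
      exact ((hZ q hq).2.1 hz).1
    · intro y hy y' hy' hE
      obtain ⟨q, hq, hz⟩ := Finset.mem_biUnion.1 hy
      obtain ⟨q', hq', hz'⟩ := Finset.mem_biUnion.1 hy'
      exact (key q hq q' hq' y hz y' hz' hE).1

/-- In every range of scales `N ≤ n < 2 * N` there is a pattern of size `l ^ n` which extends to
a pattern of size `l ^ (n + 1)` in a bounded number of ways. -/
theorem exists_good_scale {l : ℕ} (hl : 1 ≤ l) (hex : ∃ ζ, IsRegular act ζ) :
    ∃ B : ℕ, ∀ N, 1 ≤ N → ∃ n, N ≤ n ∧ n < 2 * N ∧ ∃ q, IsRegular act q ∧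
      ∃ Z : Finset X, Z.card ≤ B ∧ (∀ z ∈ Z, IsRegular act z ∧ Eqv act S (l ^ n) q z) ∧
        ∀ y, IsRegular act y → Eqv act S (l ^ n) q y → ∃ z ∈ Z, Eqv act S (l ^ (n + 1)) z y := by
  set K := 3 * (ballG S (2 * δ)).ncard * (L + 1) with hK
  refine ⟨K * l ^ 2 + l ^ 2, fun N hN => ?_⟩
  by_contra hcon
  push Not at hcon
  obtain ⟨Y, h1, h2, h3⟩ := A.exists_separated (B := K * l ^ 2 + l ^ 2) (N := N) hl hex
    (by
      rintro n hn hn' q hq ⟨Z, z1, z2, z3⟩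
      obtain ⟨y, y1, y2, y3⟩ := hcon n hn hn' q hq Z z1 z2
      obtain ⟨z, hz, hz'⟩ := z3 y y1 y2
      exact y3 z hz hz') N le_rfl
  obtain ⟨ζ, hζ⟩ := hex
  have h4 := A.card_le_of_separated hζ h2 h3
  have h5 : 1 ≤ l ^ (N + N) := Nat.one_le_pow _ _ hl
  have h6 : Y.card ≤ K * l ^ (N + N) := by
    refine h4.trans ?_
    rw [hK, mul_assoc _ (L + 1)]
    exact Nat.mul_le_mul_left _ (by rw [add_mul, one_mul]; omega)
  have h7 : K * l ^ (N + N) < (K * l ^ 2 + l ^ 2) ^ N := by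
    rw [show K * l ^ 2 + l ^ 2 = (K + 1) * l ^ 2 by ring, mul_pow, ← pow_mul,
      show N + N = 2 * N by ring]
    refine Nat.mul_lt_mul_of_pos_right ?_ (Nat.pow_pos (by omega))
    calc K < K + 1 := Nat.lt_succ_self K
      _ = (K + 1) ^ 1 := (pow_one _).symm
      _ ≤ (K + 1) ^ N := Nat.pow_le_pow_right (by omega) hN
  omega

end LinRep

end Scales

section Records

variable {act : X → G → X} {S : Set G} {P P' : ℕ → G} {R r ρ : ℕ} {q : X} {Z : Finset X}
  {κ : X → G}

/-- Every regular point `y` is close to a marked point `y · κ y`, whose surroundings look like the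
surroundings of one of the points of `Z`. -/
structure Atlas (act : X → G → X) (S : Set G) (r ρ : ℕ) (q : X) (Z : Finset X) (κ : X → G) :
    Prop where
  le : r ≤ ρ
  reg : ∀ z ∈ Z, IsRegular act z
  cover : ∀ y, IsRegular act y → Eqv act S r q y → ∃ z ∈ Z, Eqv act S (200 * ρ) z y
  mark : ∀ y, IsRegular act y → κ y ∈ ballG S ρ ∧ Eqv act S r q (act y (κ y))

/-- The trajectory which is at `p` at time `t` stays in the ball of radius `m` around `z` before
the time `t'`. -/
def Stays (act : X → G → X) (S : Set G) (P : ℕ → G) (m : ℕ) (z p : X) (t t' : ℕ) : Prop :=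
  ∀ s, t ≤ s → s < t' → odist act S (act p ((P t)⁻¹ * P s)) z < m

/-- The trajectory which is at `b` at time `t'` comes from the ball of radius `ρ` around `z` and
leaves the ball of radius `10 * ρ` at time `t'`. -/
def Leaves (act : X → G → X) (S : Set G) (P : ℕ → G) (ρ : ℕ) (z b : X) (t' : ℕ) : Prop :=
  b ∈ orbit act z ∧ odist act S b z = 10 * ρ ∧ ∃ p t, p ∈ orbit act z ∧ odist act S p z ≤ ρ ∧
    t < t' ∧ Stays act S P (10 * ρ) z p t t' ∧ act p ((P t)⁻¹ * P t') = b

/-- The local states `(z, p, t)` in which a trajectory may be observed. -/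
def Active (act : X → G → X) (S : Set G) (P : ℕ → G) (R ρ : ℕ) (Z : Finset X) (κ : X → G) :
    Set (X × X × ℕ) :=
  {e | e.1 ∈ Z ∧ e.2.1 ∈ orbit act e.1 ∧ odist act S e.2.1 e.1 ≤ ρ ∧ e.2.2 ≤ R ∧
    (e.2.2 = 0 ∨ ∃ z ∈ Z, ∃ b, Leaves act S P ρ z b e.2.2 ∧ e.2.1 = act e.1 (κ b)⁻¹)}

/-- The active states together with the place and time of the next exit. -/
def Rec (act : X → G → X) (S : Set G) (P : ℕ → G) (R ρ : ℕ) (Z : Finset X) (κ : X → G) :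
    Set ((X × X × ℕ) × X × ℕ) :=
  {e | e.1 ∈ Active act S P R ρ Z κ ∧ e.1.2.2 ≤ e.2.2 ∧ e.2.2 ≤ R ∧
    Stays act S P (10 * ρ) e.1.1 e.1.2.1 e.1.2.2 e.2.2 ∧
    e.2.1 = act e.1.2.1 ((P e.1.2.2)⁻¹ * P e.2.2) ∧
    (e.2.2 = R ∨ 10 * ρ ≤ odist act S e.2.1 e.1.1)}

namespace RightAct

variable (A : RightAct act S)
include A

theorem exists_rec {e : X × X × ℕ} (he : e ∈ Active act S P R ρ Z κ) :
    ∃ w, (e, w) ∈ Rec act S P R ρ Z κ := by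
  classical
  obtain ⟨z, p, t⟩ := e
  have hex : ∃ t', t ≤ t' ∧ (t' = R ∨ 10 * ρ ≤ odist act S (act p ((P t)⁻¹ * P t')) z) :=
    ⟨R, he.2.2.2.1, Or.inl rfl⟩
  obtain ⟨h1, h2⟩ := Nat.find_spec hex
  refine ⟨(_, Nat.find hex), he, h1, Nat.find_min' hex ⟨he.2.2.2.1, Or.inl rfl⟩, ?_, rfl, h2⟩
  intro s hs hs'
  have := Nat.find_min hex hs'
  by_contra h
  exact this ⟨hs, Or.inr (by simpa using h)⟩

theorem rec_unique {e : X × X × ℕ} {w w' : X × ℕ} (h : (e, w) ∈ Rec act S P R ρ Z κ)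
    (h' : (e, w') ∈ Rec act S P R ρ Z κ) : w = w' := by
  obtain ⟨b, t⟩ := w
  obtain ⟨b', t'⟩ := w'
  obtain ⟨-, h1, h2, h3, h4, h5⟩ := h
  obtain ⟨-, h1', h2', h3', h4', h5'⟩ := h'
  simp only at *
  have key : t = t' := by
    rcases Nat.lt_trichotomy t t' with h | h | h
    · have := h3' t h1 h
      rw [← h4] at this
      omega
    · exact h
    · have := h3 t' h1' h
      rw [← h4'] at this
      omega
  subst key
  rw [h4, h4']

theorem stays_track (hP : IsPath S P) {z m : X} {a : G} {p y : X} {t t' : ℕ}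
    (hE : Eqv act S (200 * ρ) z m) (ha : a ∈ ballG S ρ) (hp : p = act z a) (hy : y = act m a)
    (hρ : 1 ≤ ρ) (hs : Stays act S P (10 * ρ) z p t t') {s : ℕ} (h1 : t ≤ s) (h2 : s ≤ t') :
    ∃ k ∈ ballG S (10 * ρ), act p ((P t)⁻¹ * P s) = act z k ∧ act y ((P t)⁻¹ * P s) = act m k := by
  induction s, h1 using Nat.le_induction with
  | base => exact ⟨a, ballG_mono (by omega) ha, by simp [A.one, hp], by simp [A.one, hy]⟩
  | succ s h1 ih =>
    obtain ⟨k, hk, k1, k2⟩ := ih (by omega)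
    obtain ⟨u, hu, hu'⟩ := hP s
    have hz := A.self_mem_orbit z
    have hpz : act p ((P t)⁻¹ * P s) ∈ orbit act z := by rw [k1]; exact A.mem_orbit z k
    have hd := (A.dist_step hpz hz hu).1
    have hlt := hs s h1 (by omega)
    obtain ⟨k', hk', e⟩ := A.exists_ballG_of_dist_le (D := 10 * ρ) (A.act_mem_orbit hpz u) (by omega)
    refine ⟨k', hk', ?_, ?_⟩
    · rw [e, A.mul, hu', mul_assoc]
    · rw [hu', ← mul_assoc, ← A.mul, k2, A.mul]
      rw [k1, A.mul] at e
      exact ((hE.eq_iff A hk' (mul_mem_ballG hk hu) (by omega)).1 e).symm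

end RightAct

namespace Atlas

variable (T : Atlas act S r ρ q Z κ)
include T

/-- The records of a path determine the trajectories of all regular points. -/
theorem eq_of_rec_eq {L δ : ℕ} (A : LinRep act S L δ) (hP : IsPath S P) (hP' : IsPath S P')
    (hρ : 1 ≤ ρ) (hrec : Rec act S P R ρ Z κ = Rec act S P' R ρ Z κ) (d : ℕ) :
    ∀ t z p y m a, R - t = d → (z, p, t) ∈ Active act S P R ρ Z κ → IsRegular act m →
      Eqv act S (200 * ρ) z m → a ∈ ballG S ρ → p = act z a → y = act m a →
      act y ((P t)⁻¹ * P R) = act y ((P' t)⁻¹ * P' R) := by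
  induction d using Nat.strong_induction_on with
  | _ d ih =>
    intro t z p y m a hd hact hm hE ha hp hy
    obtain ⟨⟨b, t'⟩, hw⟩ := A.exists_rec hact
    have hw' := hw
    rw [hrec] at hw'
    obtain ⟨-, h1, h2, h3, h4, h5⟩ := id hw
    obtain ⟨-, -, -, h3', h4', -⟩ := hw'
    simp only at *
    obtain ⟨k, hk, k1, k2⟩ := A.stays_track hP hE ha hp hy hρ h3 h1 le_rfl
    obtain ⟨k', hk', k1', k2'⟩ := A.stays_track hP' hE ha hp hy hρ h3' h1 le_rfl
    have hkk : act m k = act m k' := by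
      rw [← hE.eq_iff A.toRightAct hk hk' (by omega), ← k1, ← k1', ← h4, ← h4']
    have hstep : act y ((P t)⁻¹ * P t') = act y ((P' t)⁻¹ * P' t') := by rw [k2, k2', hkk]
    by_cases ht' : t' = R
    · rw [ht'] at hstep
      exact hstep
    have hz := A.self_mem_orbit z
    have hbz : b ∈ orbit act z := by rw [h4, k1]; exact A.mem_orbit z k
    have hb1 : odist act S b z ≤ 10 * ρ := by
      rw [A.dist_symm hbz hz]
      exact odist_le hk (by rw [h4, k1])
    obtain ⟨hz', hpz, hpd, htR, -⟩ := id hact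
    simp only at *
    have htt : t < t' := by
      rcases Nat.lt_or_ge t t' with h | h
      · exact h
      · have : t = t' := by omega
        subst this
        rw [inv_mul_cancel, A.one] at h4
        rw [h4] at h5
        omega
    have hbreg : IsRegular act b := A.reg_of_mem (T.reg z hz') hbz
    obtain ⟨c1, c2⟩ := T.mark b hbreg
    have hbk : b = act z k := h4.trans k1
    set y₁ := act y ((P t)⁻¹ * P t') with hy₁
    have hregm' : IsRegular act (act y₁ (κ b)) := by
      rw [k2, A.mul]
      exact A.reg _ _ hm
    have hEm : Eqv act S r q (act y₁ (κ b)) := by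
      have := hE.move A.toRightAct (n := r) (k := 10 * ρ + ρ) (by have := T.le; omega)
        (mul_mem_ballG hk c1)
      rw [← A.mul, ← A.mul, ← k2, ← hbk] at this
      exact c2.trans this
    obtain ⟨z', hz'', hE'⟩ := T.cover _ hregm' hEm
    have hinv := A.inv_mem c1
    have hnew : (z', act z' (κ b)⁻¹, t') ∈ Active act S P R ρ Z κ := by
      refine ⟨hz'', A.mem_orbit _ _, ?_, h2, Or.inr ⟨z, hz', b, ⟨hbz, by omega, p, t, hpz, hpd, htt,
        h3, h4.symm⟩, rfl⟩⟩
      rw [A.dist_symm (A.mem_orbit _ _) (A.self_mem_orbit _)]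
      exact odist_le hinv rfl
    have := ih (R - t') (by omega) t' z' _ y₁ _ (κ b)⁻¹ rfl hnew hregm' hE' hinv rfl
      (by rw [A.mul]; simp [A.one])
    have e1 : act y ((P t)⁻¹ * P R) = act y₁ ((P t')⁻¹ * P R) := by
      rw [hy₁, A.mul]; congr 1; group
    have e2 : act y ((P' t)⁻¹ * P' R) = act y₁ ((P' t')⁻¹ * P' R) := by
      rw [hstep, A.mul]; congr 1; group
    rw [e1, e2, this]

theorem act_eq_of_rec_eq {L δ : ℕ} (A : LinRep act S L δ) (hP : IsPath S P) (hP' : IsPath S P')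
    (hρ : 1 ≤ ρ) (hrec : Rec act S P R ρ Z κ = Rec act S P' R ρ Z κ) (h0 : P 0 = 1)
    (h0' : P' 0 = 1) {x : X} (hx : IsRegular act x) : act x (P R) = act x (P' R) := by
  obtain ⟨c1, c2⟩ := T.mark x hx
  have hreg := A.reg x (κ x) hx
  obtain ⟨z, hz, hE⟩ := T.cover _ hreg c2
  have hinv := A.inv_mem c1
  have hact : (z, act z (κ x)⁻¹, 0) ∈ Active act S P R ρ Z κ := by
    refine ⟨hz, A.mem_orbit _ _, ?_, by simp, Or.inl rfl⟩
    rw [A.dist_symm (A.mem_orbit _ _) (A.self_mem_orbit _)]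
    exact odist_le hinv rfl
  have := T.eq_of_rec_eq A hP hP' hρ hrec _ 0 z _ x _ (κ x)⁻¹ rfl hact hreg hE hinv rfl
    (by rw [A.mul]; simp [A.one])
  simpa [h0, h0'] using this

end Atlas

end Records

section Counting

theorem ncard_fiberwise_le {α β : Type*} {s : Set α} (hs : s.Finite) {t : α → Set β} {n : ℕ}
    (ht : ∀ a ∈ s, (t a).Finite ∧ (t a).ncard ≤ n) :
    {p : α × β | p.1 ∈ s ∧ p.2 ∈ t p.1}.Finite ∧
      {p : α × β | p.1 ∈ s ∧ p.2 ∈ t p.1}.ncard ≤ s.ncard * n := by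
  classical
  have heq : {p : α × β | p.1 ∈ s ∧ p.2 ∈ t p.1} = ⋃ a ∈ hs.toFinset, Prod.mk a '' t a := by
    ext ⟨a, b⟩
    simp [and_comm]
  rw [heq]
  constructor
  · exact Set.Finite.biUnion hs.toFinset.finite_toSet
      fun a ha => ((ht a (hs.mem_toFinset.1 ha)).1.image _)
  · refine (Finset.set_ncard_biUnion_le _ _).trans ?_
    rw [Set.ncard_eq_toFinset_card s hs, ← smul_eq_mul]
    refine Finset.sum_le_card_nsmul _ _ _ fun a ha => ?_
    obtain ⟨h1, h2⟩ := ht a (hs.mem_toFinset.1 ha)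
    exact (Set.ncard_image_le h1).trans h2

/-- A bound for the number of subsets of cardinality at most `a` of a finite set. -/
theorem finite_ncard_le_subsets {α : Type*} {W : Set α} (hW : W.Finite) (a : ℕ) :
    {F : Set α | F ⊆ W ∧ F.ncard ≤ a}.Finite ∧
      {F : Set α | F ⊆ W ∧ F.ncard ≤ a}.ncard ≤ (W.ncard + 1) ^ a := by
  classical
  have : Fintype W := hW.fintype
  have hsub : {F : Set α | F ⊆ W ∧ F.ncard ≤ a} ⊆
      (fun f : Fin a → Option W => {w : α | ∃ i, ∃ h : w ∈ W, f i = some ⟨w, h⟩}) ''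
        Set.univ := by
    rintro F ⟨h1, h2⟩
    have hF : F.Finite := hW.subset h1
    have : Fintype F := hF.fintype
    have e : Fin F.ncard ≃ F := by
      refine (Fintype.equivFinOfCardEq ?_).symm
      rw [← Nat.card_coe_set_eq, Nat.card_eq_fintype_card]
    refine ⟨fun i => if h : (i : ℕ) < F.ncard then some ⟨e ⟨i, h⟩, h1 (e ⟨i, h⟩).2⟩ else none,
      trivial, ?_⟩
    ext w
    constructor
    · rintro ⟨i, h, hi⟩
      simp only at hi
      split_ifs at hi with hlt
      simp only [Option.some.injEq, Subtype.mk.injEq] at hi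
      rw [← hi]
      exact (e ⟨i, hlt⟩).2
    · intro hw
      refine ⟨⟨e.symm ⟨w, hw⟩, lt_of_lt_of_le (e.symm ⟨w, hw⟩).2 h2⟩, h1 hw, ?_⟩
      simp
  refine ⟨(Set.finite_univ.image _).subset hsub, ?_⟩
  refine (Set.ncard_le_ncard hsub (Set.finite_univ.image _)).trans ?_
  refine (Set.ncard_image_le Set.finite_univ).trans ?_
  rw [Set.ncard_univ, Nat.card_eq_fintype_card, Fintype.card_fun, Fintype.card_option,
    Fintype.card_fin, ← Nat.card_eq_fintype_card (α := W), Nat.card_coe_set_eq]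

variable {act : X → G → X} {S : Set G} {P : ℕ → G} {R r ρ L δ D M : ℕ} {Z : Finset X}
  {κ : X → G}

namespace LinRep

variable (A : LinRep act S L δ)
include A

/-- Each exit from the ball of radius `10 * ρ` comes with a passage through a smaller ball. -/
theorem leaves_ncard_le (hP : IsPath S P) (hD : 2 * δ + 10 ≤ D) (hρ : D ≤ ρ)
    (hM : ∀ c, IsRegular act c → (Cr act S P R c D).ncard ≤ M) {z b : X}
    (hz : IsRegular act z) :
    {t | t ≤ R ∧ Leaves act S P ρ z b t}.Finite ∧
      {t | t ≤ R ∧ Leaves act S P ρ z b t}.ncard ≤ M := by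
  have hfin : {t | t ≤ R ∧ Leaves act S P ρ z b t}.Finite :=
    (Set.finite_Iic R).subset fun t ht => ht.1
  refine ⟨hfin, ?_⟩
  by_cases hb : b ∈ orbit act z ∧ odist act S b z = 10 * ρ
  swap
  · have : {t | t ≤ R ∧ Leaves act S P ρ z b t} = ∅ := by
      ext t
      simp only [Set.mem_ofPred_eq, Set.mem_empty_iff_false, iff_false, not_and]
      exact fun _ h => hb ⟨h.1, h.2.1⟩
    rw [this]
    simp
  obtain ⟨hbz, hbd⟩ := hb
  have hzz := A.self_mem_orbit z
  obtain ⟨g, hg, hg'⟩ := A.exists_ballG_of_dist_le hbz hbd.le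
  obtain ⟨a, ha, u, hu, rfl⟩ := ballG_split (k := 5 * ρ)
    (ballG_mono (show 10 * ρ ≤ 5 * ρ + 5 * ρ by omega) hg)
  have hc := A.mem_orbit z a
  have d1 : odist act S z (act z a) ≤ 5 * ρ := odist_le ha rfl
  have d2 : odist act S (act z a) b ≤ 5 * ρ :=
    (odist_le hu (by rw [A.mul, hg'])).trans (by omega)
  have d3 := A.dist_tri hbz hc hzz
  have d4 := A.dist_symm hzz hc
  have d5 := A.dist_symm hbz hc
  have hcreg := A.reg z a hz
  generalize act z a = c at *
  refine (ncard_le_of_rel (fun t e => act e.1 (P t) = b ∧ e.2.2 ≤ t ∧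
      ∀ s, e.2.1 ≤ s → s < t → odist act S (act e.1 (P s)) z < 10 * ρ) ?_ ?_
    (A.cr_rel_ballG hP (by omega)).1).trans (hM c hcreg)
  · rintro t ⟨htR, -, -, p, t₀, hp, hpd, hlt, hst, hpb⟩
    set x := act p (P t₀)⁻¹ with hx
    have hxP : ∀ s, act x (P s) = act p ((P t₀)⁻¹ * P s) := fun s => by rw [hx, A.mul]
    have hxt : act x (P t) = b := by rw [hxP, hpb]
    have hxt₀ : act x (P t₀) = p := by rw [hxP]; simp [A.one]
    have e1 := A.dist_tri hp hc hzz
    have e2 := A.dist_tri hzz hp hc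
    have e3 := A.dist_symm hzz hp
    have e4 := A.dist_tri hbz hp hzz
    have e5 := A.dist_symm hp hc
    have e7 := A.dist_tri hc hzz hp
    have e6 := A.dist_tri hbz hc hp
    have col := A.col z hz _ hbz _ hc _ hp
    unfold Col3 at col
    obtain ⟨i, j, h1, h2, h3⟩ := A.exists_cr_of_between (R := R) hP hcreg (x := x) (D := D)
      (i := t₀) (j := t) (by rw [A.orbit_eq hc, hx]; exact A.act_mem_orbit hp _) hD hlt.le htR
      (by rw [hxt₀]; omega) (by rw [hxt]; omega) (by rw [hxt₀, hxt]; omega)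
    refine ⟨_, h3, hxt, h2, fun s hs hs' => ?_⟩
    simp only at *
    rw [hxP]
    exact hst s (by omega) hs'
  · rintro t - t' - ⟨x, i, j⟩ hcr ⟨h1, h2, h3⟩ ⟨h1', h2', h3'⟩
    have hij := hcr.2.1
    simp only at *
    rcases Nat.lt_trichotomy t t' with h | h | h
    · have := h3' t (by omega) h
      rw [h1] at this
      omega
    · exact h
    · have := h3 t' (by omega) h
      rw [h1'] at this
      omega

theorem active_ncard_le (hP : IsPath S P) (hD : 2 * δ + 10 ≤ D) (hρ : D ≤ ρ)
    (hM : ∀ c, IsRegular act c → (Cr act S P R c D).ncard ≤ M)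
    (hZ : ∀ z ∈ Z, IsRegular act z) {K : ℕ} (hK : K = 3 * (ballG S (2 * δ)).ncard) :
    (Active act S P R ρ Z κ).Finite ∧
    (Active act S P R ρ Z κ).ncard ≤ Z.card * (K * (ρ + 1)) + Z.card * (Z.card * (K * M)) := by
  have hZf := Z.finite_toSet
  obtain ⟨f1, n1⟩ := ncard_fiberwise_le hZf (n := K * (ρ + 1))
    (t := fun z => {x | x ∈ orbit act z ∧ odist act S x z ≤ ρ})
    fun z hz => ⟨A.finite_ball z ρ, by rw [hK]; exact A.ball_ncard_le (hZ z hz) ρ⟩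
  obtain ⟨f2, n2⟩ := ncard_fiberwise_le hZf (n := K * M)
    (t := fun z => {w : X × ℕ | w.1 ∈ {x | x ∈ orbit act z ∧ odist act S x z = 10 * ρ} ∧
      w.2 ∈ {t | t ≤ R ∧ Leaves act S P ρ z w.1 t}})
    fun z hz => by
      have hs : {x | x ∈ orbit act z ∧ odist act S x z = 10 * ρ}.Finite :=
        (A.finite_ball z (10 * ρ)).subset fun x hx => ⟨hx.1, hx.2.le⟩
      obtain ⟨g1, g2⟩ := ncard_fiberwise_le hs (n := M)
        (t := fun b => {t | t ≤ R ∧ Leaves act S P ρ z b t})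
        fun b _ => A.leaves_ncard_le hP hD hρ hM (hZ z hz)
      refine ⟨g1, g2.trans (Nat.mul_le_mul_right _ ?_)⟩
      rw [hK]
      exact A.sphere_ncard_le (hZ z hz) _
  have f3 := hZf.prod f2
  set V₁ := {p : X × X | p.1 ∈ (Z : Set X) ∧
    p.2 ∈ {x | x ∈ orbit act p.1 ∧ odist act S x p.1 ≤ ρ}} with hV₁
  set V₂ := {p : X × X × ℕ | p.1 ∈ (Z : Set X) ∧
    p.2 ∈ {w : X × ℕ | w.1 ∈ {x | x ∈ orbit act p.1 ∧ odist act S x p.1 = 10 * ρ} ∧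
      w.2 ∈ {t | t ≤ R ∧ Leaves act S P ρ p.1 w.1 t}}} with hV₂
  have hsub : Active act S P R ρ Z κ ⊆ (fun p : X × X => (p.1, p.2, 0)) '' V₁ ∪
      (fun p : X × X × X × ℕ => (p.1, act p.1 (κ p.2.2.1)⁻¹, p.2.2.2)) '' ((Z : Set X) ×ˢ V₂) := by
    rintro ⟨z, p, t⟩ ⟨h1, h2, h3, h4, h5⟩
    simp only at *
    rcases h5 with h5 | ⟨z', hz', b, hb, h5⟩
    · subst h5
      exact Or.inl ⟨(z, p), ⟨h1, h2, h3⟩, rfl⟩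
    · refine Or.inr ⟨(z, z', b, t), ⟨h1, hz', ⟨hb.1, hb.2.1⟩, h4, hb⟩, ?_⟩
      simp only [h5]
  have hfin := (f1.image (fun p : X × X => (p.1, p.2, 0))).union
    (f3.image (fun p : X × X × X × ℕ => (p.1, act p.1 (κ p.2.2.1)⁻¹, p.2.2.2)))
  refine ⟨hfin.subset hsub, (Set.ncard_le_ncard hsub hfin).trans ?_⟩
  refine (Set.ncard_union_le _ _).trans (Nat.add_le_add ?_ ?_)
  · refine (Set.ncard_image_le f1).trans (n1.trans ?_)
    rw [Set.ncard_coe_finset]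
  · refine (Set.ncard_image_le f3).trans ?_
    rw [Set.ncard_prod, Set.ncard_coe_finset]
    refine Nat.mul_le_mul_left _ (n2.trans ?_)
    rw [Set.ncard_coe_finset]

end LinRep

end Counting

section Growth

variable {act : X → G → X} {S : Set G} {P : ℕ → G} {R r ρ L δ D M B K : ℕ} {q : X}
  {Z : Finset X} {κ : X → G}

theorem RightAct.rec_ncard_le (A : RightAct act S)
    (hfin : (Active act S P R ρ Z κ).Finite) :
    (Rec act S P R ρ Z κ).ncard ≤ (Active act S P R ρ Z κ).ncard := by
  refine ncard_le_of_rel (fun e e' => e.1 = e') (fun e he => ⟨_, he.1, rfl⟩) ?_ hfin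
  rintro ⟨e, w⟩ he ⟨e', w'⟩ he' e₁ - rfl h
  simp only at h
  subst h
  rw [A.rec_unique he he']

/-- The set of all conceivable records. -/
def RecSpace (act : X → G → X) (S : Set G) (R ρ : ℕ) (Z : Finset X) :
    Set ((X × X × ℕ) × X × ℕ) :=
  (fun e : X × (X × ℕ) × X × ℕ => ((e.1, e.2.1.1, e.2.1.2), e.2.2.1, e.2.2.2)) ''
    {e | e.1 ∈ (Z : Set X) ∧ e.2 ∈
      ({x | x ∈ orbit act e.1 ∧ odist act S x e.1 ≤ ρ} ×ˢ Set.Iic R) ×ˢ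
        ({x | x ∈ orbit act e.1 ∧ odist act S x e.1 ≤ 10 * ρ} ×ˢ Set.Iic R)}

theorem RightAct.rec_subset_recSpace (A : RightAct act S) (hP : IsPath S P) (hρ : 1 ≤ ρ) :
    Rec act S P R ρ Z κ ⊆ RecSpace act S R ρ Z := by
  rintro ⟨⟨z, p, t⟩, b, t'⟩ ⟨⟨h1, h2, h3, h4, -⟩, h5, h6, h7, h8, -⟩
  simp only at *
  obtain ⟨a, ha, ha'⟩ := A.exists_ballG_of_dist_le h2 h3
  obtain ⟨k, hk, hk', -⟩ := A.stays_track hP (Eqv.refl _ z) ha ha'.symm ha'.symm hρ h7 h5 le_rfl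
  refine ⟨(z, (p, t), b, t'), ⟨h1, ⟨⟨h2, h3⟩, h4⟩, ⟨?_, ?_⟩, h6⟩, rfl⟩
  · rw [h8]
    exact A.act_mem_orbit h2 _
  · simp only
    rw [h8, hk', A.dist_symm (A.mem_orbit _ _) (A.self_mem_orbit _)]
    exact odist_le hk rfl

theorem LinRep.recSpace_ncard_le (A : LinRep act S L δ) (hZ : ∀ z ∈ Z, IsRegular act z)
    (hK : K = 3 * (ballG S (2 * δ)).ncard) :
    (RecSpace act S R ρ Z).Finite ∧ (RecSpace act S R ρ Z).ncard ≤
      Z.card * ((K * (ρ + 1) * (R + 1)) * (K * (10 * ρ + 1) * (R + 1))) := by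
  obtain ⟨h1, h2⟩ := ncard_fiberwise_le Z.finite_toSet
    (n := (K * (ρ + 1) * (R + 1)) * (K * (10 * ρ + 1) * (R + 1)))
    (t := fun z => ({x | x ∈ orbit act z ∧ odist act S x z ≤ ρ} ×ˢ Set.Iic R) ×ˢ
        ({x | x ∈ orbit act z ∧ odist act S x z ≤ 10 * ρ} ×ˢ Set.Iic R))
    fun z hz => by
      refine ⟨((A.finite_ball z ρ).prod (Set.finite_Iic R)).prod
        ((A.finite_ball z (10 * ρ)).prod (Set.finite_Iic R)), ?_⟩
      rw [Set.ncard_prod, Set.ncard_prod, Set.ncard_prod, Set.ncard_Iic_nat, hK]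
      gcongr
      · exact A.ball_ncard_le (hZ z hz) ρ
      · exact A.ball_ncard_le (hZ z hz) (10 * ρ)
  refine ⟨h1.image _, (Set.ncard_image_le h1).trans ?_⟩
  rwa [Set.ncard_coe_finset] at h2

theorem Atlas.groupGrowth_le [T2Space X] (T : Atlas act S r ρ q Z κ) (A : LinRep act S L δ)
    (hcont : ∀ g : G, Continuous fun x : X => act x g)
    (hfaithful : ∀ g : G, (∀ x : X, act x g = x) → g = 1)
    (hdense : Dense {x | IsRegular act x}) (hD : 2 * δ + 10 ≤ D) (hρ : D ≤ ρ)
    (hM : ∀ P, IsPath S P → ∀ c, IsRegular act c → (Cr act S P R c D).ncard ≤ M)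
    (hB : Z.card ≤ B) (hK : K = 3 * (ballG S (2 * δ)).ncard) :
    groupGrowth S R ≤ (B * ((K * (ρ + 1) * (R + 1)) * (K * (10 * ρ + 1) * (R + 1))) + 1) ^
      (B * (K * (ρ + 1)) + B * (B * (K * M))) := by
  set a := B * (K * (ρ + 1)) + B * (B * (K * M)) with ha
  obtain ⟨w1, w2⟩ := A.recSpace_ncard_le (R := R) (ρ := ρ) T.reg hK
  obtain ⟨s1, s2⟩ := finite_ncard_le_subsets w1 a
  have hle : groupGrowth S R ≤ ((RecSpace act S R ρ Z).ncard + 1) ^ a := by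
    rw [groupGrowth, Nat.card_coe_set_eq]
    refine (ncard_le_of_rel (fun g F => ∃ P, IsPath S P ∧ P 0 = 1 ∧ P R = g ∧
      Rec act S P R ρ Z κ = F) ?_ ?_ s1).trans s2
    · intro g hg
      obtain ⟨P, hP, h0, hR⟩ := exists_path hg
      refine ⟨_, ⟨A.rec_subset_recSpace hP (by omega), ?_⟩, P, hP, h0, hR, rfl⟩
      obtain ⟨a1, a2⟩ := A.active_ncard_le (κ := κ) hP hD hρ (hM P hP) T.reg hK
      refine (A.rec_ncard_le a1).trans (a2.trans ?_)
      rw [ha]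
      gcongr
    · rintro g - g' - F - ⟨P, hP, h0, rfl, hF⟩ ⟨P', hP', h0', rfl, hF'⟩
      have heq : (fun x => act x (P R)) = fun x => act x (P' R) :=
        (hcont _).ext_on hdense (hcont _) fun x hx =>
          T.act_eq_of_rec_eq A hP hP' (by omega) (hF.trans hF'.symm) h0 h0' hx
      have := hfaithful (P R * (P' R)⁻¹) fun x => (A.act_eq_iff).1 (congrFun heq x)
      exact mul_inv_eq_one.1 this
  refine hle.trans (Nat.pow_le_pow_left ?_ _)
  have := w2.trans (Nat.mul_le_mul_right _ hB)
  omega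

theorem LinRep.exists_groupGrowth_le [T2Space X] (hL : 1 ≤ L) (A : LinRep act S L δ)
    (hcont : ∀ g : G, Continuous fun x : X => act x g)
    (hfaithful : ∀ g : G, (∀ x : X, act x g = x) → g = 1)
    (hdense : Dense {x | IsRegular act x}) (hex : ∃ ζ, IsRegular act ζ)
    {θ K₁ : ℝ} {D₀ : ℕ} (hθ : 0 < θ) (hθ1 : θ < 1) (hK₁ : 0 ≤ K₁) (hD₀ : 2 * δ + 10 ≤ D₀)
    (hdecay : ∀ P : ℕ → G, IsPath S P → ∀ R m : ℕ, ∀ c, IsRegular act c →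
        ((Cr act S P R c ((200 * L) ^ m * D₀)).ncard : ℝ) ≤ K₁ * (R + 1) * θ ^ m) :
    ∃ (c : ℝ) (N₀ : ℕ), 1 ≤ c ∧ ∀ R N : ℕ, 1 ≤ R → N₀ ≤ N → ∃ a w : ℕ, 1 ≤ w ∧
      groupGrowth S R ≤ w ^ a ∧
      (a : ℝ) ≤ c * (((200 * L : ℕ) : ℝ) ^ (2 * N) + R * θ ^ N) ∧
      (w : ℝ) ≤ c * (((200 * L : ℕ) : ℝ) ^ (2 * N)) ^ 2 * (R : ℝ) ^ 2 := by
  set l := 200 * L with hl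
  obtain ⟨B, hB⟩ := A.exists_good_scale (l := l) (by omega) hex
  obtain ⟨K, hK⟩ : ∃ K, K = 3 * (ballG S (2 * δ)).ncard := ⟨_, rfl⟩
  set c : ℝ := B * (K * (2 * L)) + B * (B * (K * (K₁ * 2 * (θ ^ D₀)⁻¹))) +
    B * ((K * (2 * L) * 2) * (K * (11 * L) * 2)) + 1 with hc
  have hc0 : 0 ≤ (B : ℝ) * (K * (2 * L)) := by positivity
  have hc1 : 0 ≤ (B : ℝ) * (B * (K * (K₁ * 2 * (θ ^ D₀)⁻¹))) := by positivity
  have hc2 : 0 ≤ (B : ℝ) * ((K * (2 * L) * 2) * (K * (11 * L) * 2)) := by positivity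
  refine ⟨c, D₀, by linarith, fun R N hR hN => ?_⟩
  obtain ⟨n, hn, hn', q, hq, Z, hZB, hZ, hcov⟩ := hB N (by omega)
  have hκ : ∀ y, ∃ k, IsRegular act y → k ∈ ballG S (L * l ^ n) ∧ Eqv act S (l ^ n) q (act y k) := by
    intro y
    by_cases hy : IsRegular act y
    · obtain ⟨b, hb, hb'⟩ := A.rep q y hq hy (l ^ n)
      exact ⟨b, fun _ => ⟨hb, hb'.symm⟩⟩
    · exact ⟨1, fun h => absurd h hy⟩
  choose κ hκ using hκ
  have T : Atlas act S (l ^ n) (L * l ^ n) q Z κ := by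
    refine ⟨Nat.le_mul_of_pos_left _ hL, fun z hz => (hZ z hz).1, fun y hy hy' => ?_, hκ⟩
    obtain ⟨z, hz, hz'⟩ := hcov y hy hy'
    refine ⟨z, hz, ?_⟩
    rwa [show 200 * (L * l ^ n) = l ^ (n + 1) by rw [pow_succ, hl]; ring]
  have hDρ : l ^ (n - D₀) * D₀ ≤ L * l ^ n := by
    have h1 : D₀ ≤ l ^ D₀ := (Nat.lt_pow_self (by omega)).le
    calc l ^ (n - D₀) * D₀ ≤ l ^ (n - D₀) * l ^ D₀ := Nat.mul_le_mul_left _ h1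
      _ = l ^ n := by rw [← pow_add]; congr 1; omega
      _ ≤ L * l ^ n := Nat.le_mul_of_pos_left _ hL
  have hD : 2 * δ + 10 ≤ l ^ (n - D₀) * D₀ :=
    hD₀.trans (Nat.le_mul_of_pos_left _ (Nat.pow_pos (by omega)))
  have hM0 : 0 ≤ K₁ * (R + 1) * θ ^ (n - D₀) := by positivity
  have hgrowth := T.groupGrowth_le (R := R) (M := ⌊K₁ * (R + 1) * θ ^ (n - D₀)⌋₊) A hcont hfaithful
    hdense hD hDρ (fun P hP c hc => Nat.le_floor (hdecay P hP R (n - D₀) c hc)) hZB hK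
  refine ⟨_, _, Nat.succ_pos _, hgrowth, ?_, ?_⟩
  all_goals
    have hR' : (1 : ℝ) ≤ R := by exact_mod_cast hR
    have hL' : (1 : ℝ) ≤ L := by exact_mod_cast hL
    have hl1 : (1 : ℝ) ≤ l := by exact_mod_cast (show 1 ≤ l by omega)
    have hx1 : (1 : ℝ) ≤ (l : ℝ) ^ (2 * N) := one_le_pow₀ hl1
    have hx2 : (l : ℝ) ^ n ≤ (l : ℝ) ^ (2 * N) := pow_le_pow_right₀ hl1 hn'.le
    have hfl := Nat.floor_le hM0
    have hy0 : 0 < θ ^ N := by positivity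
    have hy : θ ^ (n - D₀) ≤ (θ ^ D₀)⁻¹ * θ ^ N := by
      rw [le_inv_mul_iff₀ (by positivity), ← pow_add]
      exact pow_le_pow_of_le_one hθ.le hθ1.le (by omega)
    push_cast
    generalize (l : ℝ) ^ (2 * N) = x at *
    have hρ1 : (L : ℝ) * (l : ℝ) ^ n + 1 ≤ 2 * L * x := by nlinarith
    have hρ2 : 10 * ((L : ℝ) * (l : ℝ) ^ n) + 1 ≤ 11 * L * x := by nlinarith
    have hR1 : (R : ℝ) + 1 ≤ 2 * R := by linarith
  · have hM1 : (⌊K₁ * (R + 1) * θ ^ (n - D₀)⌋₊ : ℝ) ≤ (K₁ * 2 * (θ ^ D₀)⁻¹) * (R * θ ^ N) := by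
      refine hfl.trans ?_
      calc K₁ * (R + 1) * θ ^ (n - D₀) ≤ K₁ * (2 * R) * ((θ ^ D₀)⁻¹ * θ ^ N) := by gcongr
        _ = _ := by ring
    calc (B : ℝ) * (K * ((L : ℝ) * (l : ℝ) ^ n + 1)) +
          B * (B * (K * (⌊K₁ * (R + 1) * θ ^ (n - D₀)⌋₊ : ℝ)))
        ≤ (B : ℝ) * (K * (2 * L * x)) + B * (B * (K * ((K₁ * 2 * (θ ^ D₀)⁻¹) * (R * θ ^ N)))) := by
          gcongr
      _ = B * (K * (2 * L)) * x + B * (B * (K * (K₁ * 2 * (θ ^ D₀)⁻¹))) * (R * θ ^ N) := by ring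
      _ ≤ c * x + c * (R * θ ^ N) := by
          gcongr
          · linarith
          · linarith
      _ = _ := by ring
  · have hxR : 1 ≤ x ^ 2 * (R : ℝ) ^ 2 := one_le_mul_of_one_le_of_one_le (one_le_pow₀ hx1)
      (one_le_pow₀ hR')
    calc (B : ℝ) * ((K * ((L : ℝ) * (l : ℝ) ^ n + 1) * (R + 1)) *
          (K * (10 * ((L : ℝ) * (l : ℝ) ^ n) + 1) * (R + 1))) + 1
        ≤ B * ((K * (2 * L * x) * (2 * R)) * (K * (11 * L * x) * (2 * R))) + 1 := by gcongr
      _ = B * ((K * (2 * L) * 2) * (K * (11 * L) * 2)) * (x ^ 2 * R ^ 2) + 1 := by ring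
      _ ≤ B * ((K * (2 * L) * 2) * (K * (11 * L) * 2)) * (x ^ 2 * R ^ 2) + x ^ 2 * R ^ 2 := by
          gcongr
      _ = (B * ((K * (2 * L) * 2) * (K * (11 * L) * 2)) + 1) * (x ^ 2 * R ^ 2) := by ring
      _ ≤ c * (x ^ 2 * R ^ 2) := by
          gcongr
          linarith
      _ = _ := by ring

end Growth

theorem exists_exp_rpow_bound {f : ℕ → ℕ} (hf : Monotone f) {θ c : ℝ} {l N₀ : ℕ} (hθ : 0 < θ)
    (hθ1 : θ < 1) (hl : 2 ≤ l) (hc : 1 ≤ c)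
    (h : ∀ R N : ℕ, 1 ≤ R → N₀ ≤ N → ∃ a w : ℕ, 1 ≤ w ∧ f R ≤ w ^ a ∧
      (a : ℝ) ≤ c * ((l : ℝ) ^ (2 * N) + R * θ ^ N) ∧
      (w : ℝ) ≤ c * ((l : ℝ) ^ (2 * N)) ^ 2 * (R : ℝ) ^ 2) :
    ∃ α : ℝ, 0 < α ∧ α < 1 ∧ ∃ C : ℝ, 1 ≤ C ∧ ∀ R : ℕ, 1 ≤ R →
      (f R : ℝ) ≤ Real.exp ((C * (R : ℝ)) ^ α) := by
  have hl1 : (1 : ℝ) < l := by exact_mod_cast hl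
  have hl0 : (0 : ℝ) < l := by linarith
  have hlog : 0 < Real.log l := Real.log_pos hl1
  set η : ℝ := -Real.log θ / Real.log l with hη
  have hη0 : 0 < η := div_pos (neg_pos.2 (Real.log_neg hθ hθ1)) hlog
  have hθl : θ = (l : ℝ) ^ (-η) := by
    rw [Real.rpow_def_of_pos hl0, hη]
    field_simp
    rw [Real.exp_log hθ]
  set β : ℝ := max (1 / 2) (1 - η / 4) with hβ
  have hβ0 : 1 / 2 ≤ β := le_max_left _ _
  have hβ1 : β < 1 := max_lt (by norm_num) (by linarith)
  set s : ℝ := (1 - β) / 2 with hs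
  have hs0 : 0 < s := by linarith
  set α : ℝ := β + s with hα
  have hα0 : 0 < α := by linarith
  have hlogc : 0 ≤ Real.log c := Real.log_nonneg hc
  set R₁ := (l ^ 4) ^ N₀ with hR₁
  set C' : ℝ := max 1 (max (c * (1 + θ⁻¹) * (Real.log c + 3 / s)) (Real.log (f R₁))) with hC'
  have hC1 : 1 ≤ C' := le_max_left _ _
  have hC2 : c * (1 + θ⁻¹) * (Real.log c + 3 / s) ≤ C' := (le_max_left _ _).trans (le_max_right _ _)
  have hC3 : Real.log (f R₁) ≤ C' := (le_max_right _ _).trans (le_max_right _ _)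
  refine ⟨α, hα0, by linarith, C' ^ (1 / α), Real.one_le_rpow hC1 (by positivity), fun R hR => ?_⟩
  have hR0 : (1 : ℝ) ≤ R := by exact_mod_cast hR
  have hRpos : (0 : ℝ) < R := by linarith
  rw [Real.mul_rpow (by positivity) (by positivity), ← Real.rpow_mul (by linarith),
    one_div_mul_cancel hα0.ne', Real.rpow_one]
  refine (Real.le_exp_log _).trans (Real.exp_le_exp.2 ?_)
  have hRα : 1 ≤ (R : ℝ) ^ α := Real.one_le_rpow hR0 hα0.le
  rcases Nat.eq_zero_or_pos (f R) with h0 | hfpos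
  · rw [h0]
    simp only [Nat.cast_zero, Real.log_zero]
    positivity
  have hfpos' : (0 : ℝ) < f R := by exact_mod_cast hfpos
  rcases Nat.lt_or_ge R R₁ with hlt | hge
  · have h1 : Real.log (f R) ≤ Real.log (f R₁) :=
      Real.log_le_log hfpos' (by exact_mod_cast hf hlt.le)
    nlinarith
  set N := Nat.log (l ^ 4) R with hN
  have hl4 : 1 < l ^ 4 := Nat.one_lt_pow (by norm_num) (by omega)
  have hN1 : (l ^ 4) ^ N ≤ R := Nat.pow_log_le_self _ (by omega)
  have hN2 : R < (l ^ 4) ^ (N + 1) := Nat.lt_pow_succ_log_self hl4 R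
  have hN0 : N₀ ≤ N := (Nat.le_log_iff_pow_le hl4 (by omega)).2 hge
  obtain ⟨a, w, hw, hfw, ha, hw'⟩ := h R N hR hN0
  have hx : ((l : ℝ) ^ (2 * N)) ^ 2 ≤ R := by
    rw [← pow_mul, show 2 * N * 2 = 4 * N by ring, pow_mul]
    exact_mod_cast hN1
  have hx' : (l : ℝ) ^ (2 * N) ≤ (R : ℝ) ^ β := by
    calc (l : ℝ) ^ (2 * N) ≤ Real.sqrt R := Real.le_sqrt_of_sq_le hx
      _ = (R : ℝ) ^ (1 / 2 : ℝ) := Real.sqrt_eq_rpow _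
      _ ≤ _ := Real.rpow_le_rpow_of_exponent_le hR0 hβ0
  have hy : (R : ℝ) * θ ^ N ≤ θ⁻¹ * (R : ℝ) ^ β := by
    have e1 : (R : ℝ) ^ (1 / 4 : ℝ) ≤ (l : ℝ) ^ (N + 1) := by
      have : (R : ℝ) ≤ ((l : ℝ) ^ (N + 1)) ^ 4 := by
        rw [← pow_mul, mul_comm, pow_mul]
        exact_mod_cast hN2.le
      calc (R : ℝ) ^ (1 / 4 : ℝ) ≤ (((l : ℝ) ^ (N + 1)) ^ 4) ^ (1 / 4 : ℝ) := by gcongr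
        _ = _ := by
          rw [← Real.rpow_natCast _ 4, ← Real.rpow_mul (by positivity)]
          norm_num
    have e2 : θ ^ (N + 1) ≤ (R : ℝ) ^ (-η / 4) := by
      calc θ ^ (N + 1) = ((l : ℝ) ^ (N + 1)) ^ (-η) := by
            rw [hθl, ← Real.rpow_natCast, ← Real.rpow_natCast, ← Real.rpow_mul hl0.le,
              ← Real.rpow_mul hl0.le, mul_comm]
        _ ≤ ((R : ℝ) ^ (1 / 4 : ℝ)) ^ (-η) :=
            Real.rpow_le_rpow_of_nonpos (by positivity) e1 (by linarith)
        _ = _ := by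
            rw [← Real.rpow_mul hRpos.le]
            congr 1
            ring
    calc (R : ℝ) * θ ^ N = θ⁻¹ * (R * θ ^ (N + 1)) := by
          rw [pow_succ]
          field_simp
      _ ≤ θ⁻¹ * (R * (R : ℝ) ^ (-η / 4)) := by gcongr
      _ = θ⁻¹ * (R : ℝ) ^ (1 - η / 4) := by
          rw [show 1 - η / 4 = 1 + -η / 4 by ring, Real.rpow_add hRpos, Real.rpow_one]
      _ ≤ _ := by
          gcongr
          exact le_max_right _ _
  have ha' : (a : ℝ) ≤ c * (1 + θ⁻¹) * (R : ℝ) ^ β := by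
    refine ha.trans ?_
    rw [mul_assoc]
    gcongr
    linarith
  have hlogR : Real.log R ≤ (R : ℝ) ^ s / s := Real.log_le_rpow_div hRpos.le hs0
  have hRs : 1 ≤ (R : ℝ) ^ s := Real.one_le_rpow hR0 hs0.le
  have hw0 : (0 : ℝ) < w := by exact_mod_cast hw
  have hlogw : Real.log w ≤ (Real.log c + 3 / s) * (R : ℝ) ^ s := by
    have e1 : (w : ℝ) ≤ c * (R : ℝ) ^ 3 := by
      refine hw'.trans ?_
      rw [mul_assoc]
      gcongr
      nlinarith [sq_nonneg (R : ℝ)]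
    calc Real.log w ≤ Real.log (c * (R : ℝ) ^ 3) := Real.log_le_log hw0 e1
      _ = Real.log c + 3 * Real.log R := by
          rw [Real.log_mul (by positivity) (by positivity), Real.log_pow]
          norm_num
      _ ≤ Real.log c * (R : ℝ) ^ s + 3 * ((R : ℝ) ^ s / s) := by
          gcongr
          exact le_mul_of_one_le_right hlogc hRs
      _ = _ := by ring
  have hlogw0 : 0 ≤ Real.log w := Real.log_nonneg (by exact_mod_cast hw)
  calc Real.log (f R) ≤ Real.log ((w : ℝ) ^ a) := Real.log_le_log hfpos' (by exact_mod_cast hfw)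
    _ = a * Real.log w := Real.log_pow _ _
    _ ≤ (c * (1 + θ⁻¹) * (R : ℝ) ^ β) * ((Real.log c + 3 / s) * (R : ℝ) ^ s) := by gcongr
    _ = c * (1 + θ⁻¹) * (Real.log c + 3 / s) * (R : ℝ) ^ α := by
        rw [hα, Real.rpow_add hRpos]
        ring
    _ ≤ C' * (R : ℝ) ^ α := by gcongr

/-- Theorem on groups with a purely non-Hausdorff singularity.
Let `G` be a group generated by a finite set `S` of involutions, acting faithfully
(by homeomorphisms) on a Cantor set `X`. Suppose there is a singular point `ξ ∈ X`
such that: (1) the orbital graphs of regular points are linearly repetitive;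
(2) the orbital graphs of regular points are quasi-isometric to `ℝ`, while the
orbital graph of `ξ` is quasi-isometric to `[0, ∞)`; (3) the group of germs of `ξ`
is finite (an elementary abelian `2`-group) and for every `g ∈ G_ξ` the interior
of the set of fixed points of `g` accumulates on `ξ`. Then there exists `α ∈ (0,1)`
such that `γ_G(R) ≼ exp(R^α)`. -/
theorem growth_of_nonHausdorff_singularity
    -- `X` is a Cantor set
    [CompactSpace X] [TopologicalSpace.MetrizableSpace X] [TotallyDisconnectedSpace X]
    [PerfectSpace X] [Nonempty X]
    (S : Set G) (hSfin : S.Finite)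
    (hinvol : ∀ s ∈ S, s * s = 1)
    (hSgen : Subgroup.closure S = ⊤)
    (act : X → G → X)
    (hact_one : ∀ x : X, act x 1 = x)
    (hact_mul : ∀ (x : X) (g h : G), act (act x g) h = act x (g * h))
    (hcont : ∀ g : G, Continuous fun x : X => act x g)
    (hfaithful : ∀ g : G, (∀ x : X, act x g = x) → g = 1)
    (ξ : X)
    -- `ξ` is singular
    (hsing : ¬ IsRegular act ξ)
    -- (1) linear repetitivity of the orbital graphs of regular points
    (hrep : ∃ L : ℝ, 1 < L ∧ ∀ ζ ζ' : X, IsRegular act ζ → IsRegular act ζ' →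
      ∀ R : ℕ, 0 < R → ∃ ψ : X → X,
        Set.InjOn ψ (oball act S ζ R) ∧
        Set.MapsTo ψ (oball act S ζ R) (oball act S ζ' ⌊L * (R : ℝ)⌋₊) ∧
        ∀ x ∈ oball act S ζ R, ∀ y ∈ oball act S ζ R, ∀ s : S,
          (act x (s : G) = y ↔ act (ψ x) (s : G) = ψ y))
    -- (2) quasi-isometry types of the orbital graphs
    (hlineQI : ∀ ζ : X, IsRegular act ζ → QIToLine act S ζ)
    (hrayQI : QIToHalfLine act S ξ)
    -- (3) the group of germs of `ξ` is a finite elementary abelian 2-group, and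
    -- the interior of the fixed-point set of each `g ∈ G_ξ` accumulates on `ξ`
    (hgermfin : ∃ T : Finset G, ∀ g ∈ stab act ξ, ∃ h ∈ T, SameGerm act ξ g h)
    (hgerm2 : ∀ g ∈ stab act ξ, g * g ∈ germTrivial act ξ)
    (hfixacc : ∀ g ∈ stab act ξ, ∀ U ∈ nhds ξ,
      (U ∩ interior {x : X | act x g = x}).Nonempty) :
    ∃ α : ℝ, 0 < α ∧ α < 1 ∧ ∃ C : ℝ, 1 ≤ C ∧ ∀ R : ℕ, 1 ≤ R →
      (groupGrowth S R : ℝ) ≤ Real.exp ((C * (R : ℝ)) ^ α) := by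
  have : T2Space X := inferInstance
  have A : RightAct act S := ⟨hact_one, hact_mul, hinvol, hSgen, hSfin⟩
  have hdense := dense_isRegular A hcont
  obtain ⟨ζ₀, hζ₀⟩ := hdense.nonempty
  obtain ⟨L, δ₀, hL, hLR⟩ := exists_linRep A hcont hrep hlineQI hζ₀
  obtain ⟨δ₁, hδ₁⟩ := hrayQI.dist_le A
  have AL : LinRep act S L (max δ₀ δ₁) := hLR _ (le_max_left _ _)
  have hQ : ∀ x ∈ orbit act ξ, ∀ y ∈ orbit act ξ,
      odist act S x y + odist act S x ξ ≤ odist act S y ξ + max δ₀ δ₁ ∨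
      odist act S x y + odist act S y ξ ≤ odist act S x ξ + max δ₀ δ₁ := fun x hx y hy =>
    (hδ₁ x hx y hy).imp (by omega) (by omega)
  obtain ⟨θ, K, D₀, hθ, hθ1, hK, hD₀, hdecay⟩ :=
    exists_cr_decay hL AL hcont hdense hQ hgermfin hfixacc
  obtain ⟨c, N₀, hc, h⟩ :=
    AL.exists_groupGrowth_le hL hcont hfaithful hdense ⟨ζ₀, hζ₀⟩ hθ hθ1 hK hD₀ hdecay
  have hmono : Monotone (groupGrowth S) := fun m n hmn => by
    simp only [groupGrowth, Nat.card_coe_set_eq]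
    exact Set.ncard_le_ncard (ballG_mono hmn) (ballG_finite hSfin n)
  exact exists_exp_rpow_bound hmono hθ hθ1 (by omega) hc h

end GermGrowth
end
end

section
/- Let G = ⟨a, b, c, d⟩ be the first Grigorchuk group with generating set S = {a, b, c, d}. Let η ≈ 0.81054 be the unique positive real root of x³ + x² + x − 2. Then for every α > log 2 / (log 2 − log η) ≈ 0.76743 the growth function of G satisfies γ_G(R) ≼ exp(R^α); equivalently, limsup_{R→∞} (log log γ_G(R)) / (log R) ≤ log 2 / (log 2 − log η). -/
noncomputable section
open scoped Classical

namespace Grigorchuk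

/-- The space `{0,1}^∞` of infinite binary sequences (`false` = 0, `true` = 1). -/
abbrev Seq := ℕ → Bool

/-- Flip the letter at position `k`. -/
def flipAt (k : ℕ) (w : Seq) : Seq := fun n => if n = k then !(w n) else w n

/-- The generator `a`: `(0w)·a = 1w`, `(1w)·a = 0w`, i.e. flip the first letter. -/
def genA : Seq → Seq := flipAt 0

/-- The position of the first `0` in `w`. -/
def firstZero (w : Seq) : ℕ := sInf {n | w n = false}

/-- The common pattern of the generators `b`, `c`, `d`: if `w = 1^k 0 …`, then the
letter in position `k + 1` is flipped iff `k % 3 ≠ r` (and sequences without any `0`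
are fixed).  For `r = 2` this is exactly the transformation `b` defined recursively
by `(0w)·b = 0(w·a)`, `(1w)·b = 1(w·c)` (together with the analogous recursions for
`c` and `d`, which correspond to `r = 1` and `r = 0`). -/
def genStep (r : ℕ) (w : Seq) : Seq :=
  if ∃ n, w n = false then
    (if (firstZero w) % 3 ≠ r then flipAt (firstZero w + 1) w else w)
  else w

/-- The generator `b`: `(0w)·b = 0(w·a)`, `(1w)·b = 1(w·c)`. -/
def genB : Seq → Seq := genStep 2

/-- The generator `c`: `(0w)·c = 0(w·a)`, `(1w)·c = 1(w·d)`. -/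
def genC : Seq → Seq := genStep 1

/-- The generator `d`: `(0w)·d = 0w`, `(1w)·d = 1(w·b)`. -/
def genD : Seq → Seq := genStep 0

/-- The generating set `S = {a, b, c, d}` of the first Grigorchuk group, as
transformations of `{0,1}^∞`. -/
def grigGens : Set (Seq → Seq) := {genA, genB, genC, genD}

/-- The transformation given by a word in the generators. -/
def comp (l : List (Seq → Seq)) : Seq → Seq := l.foldr (· ∘ ·) id

/-- `γ_G(R)`: the number of distinct transformations of `{0,1}^∞` representable as
products of at most `R` generators of the first Grigorchuk group (all generators
are involutions, so `S` is symmetric and these are exactly the elements of word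
length at most `R`). -/
def grigGrowth (R : ℕ) : ℕ :=
  Nat.card {f : Seq → Seq | ∃ l : List (Seq → Seq),
    (∀ s ∈ l, s ∈ grigGens) ∧ l.length ≤ R ∧ comp l = f}

/-- The transformation of binary sequences acting by `f₀` below the letter `0` and by `f₁` below
the letter `1`, and flipping the first letter when `e` is `true`. -/
def node (e : Bool) (f₀ f₁ : Seq → Seq) (w : Seq) : Seq := fun n =>
  match n with
  | 0 => xor e (w 0)
  | n + 1 => (if w 0 then f₁ else f₀) (fun m => w (m + 1)) n

lemma node_comp (e e' : Bool) (f₀ f₁ g₀ g₁ : Seq → Seq) :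
    node e f₀ f₁ ∘ node e' g₀ g₁ =
      node (xor e e') ((if e' then f₁ else f₀) ∘ g₀) ((if e' then f₀ else f₁) ∘ g₁) := by
  funext w n
  cases n <;> cases e' <;> cases h : w 0 <;> simp [node, h]

lemma id_eq_node : (id : Seq → Seq) = node false id id := by
  funext w n
  cases n <;> simp [node]

lemma genA_eq_node : genA = node true id id := by
  funext w n
  cases n <;> simp [node, genA, flipAt]

lemma genStep_of_head_false (r : ℕ) (w : Seq) (h : w 0 = false) :
    genStep r w = if 0 ≠ r then flipAt 1 w else w := by
  have hz : firstZero w = 0 := Nat.sInf_eq_zero.2 (Or.inl h)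
  have hex : ∃ n, w n = false := ⟨0, h⟩
  simp [genStep, hz, hex]

lemma firstZero_of_head_true (w : Seq) (h : w 0 = true) (hex : ∃ n, w n = false) :
    firstZero w = firstZero (fun m => w (m + 1)) + 1 := by
  have hpos : 0 < firstZero w := by
    refine Nat.pos_of_ne_zero fun h0 => ?_
    rcases Nat.sInf_eq_zero.1 h0 with h1 | h1
    · simp [h] at h1
    · obtain ⟨n, hn⟩ := hex
      exact (h1 ▸ hn : n ∈ (∅ : Set ℕ))
  exact (Nat.sInf_add (p := fun n => w n = false) hpos).symm

lemma genStep_of_head_true {r r' : ℕ} (hr : ∀ k, (k + 1) % 3 = r ↔ k % 3 = r')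
    (w : Seq) (h : w 0 = true) (n : ℕ) :
    genStep r w (n + 1) = genStep r' (fun m => w (m + 1)) n ∧ genStep r w 0 = true := by
  by_cases hex : ∃ n, w n = false
  · have hex' : ∃ n, w (n + 1) = false := by
      obtain ⟨m, hm⟩ := hex
      cases m with
      | zero => simp [h] at hm
      | succ m => exact ⟨m, hm⟩
    simp only [genStep, hex, hex', if_true, firstZero_of_head_true w h hex, ne_eq, hr]
    split_ifs <;> simp [flipAt, h]
  · have hex' : ¬ ∃ n, w (n + 1) = false := fun ⟨m, hm⟩ => hex ⟨m + 1, hm⟩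
    simp [genStep, hex, hex', h]

lemma genStep_eq_node {r r' : ℕ} (hr : ∀ k, (k + 1) % 3 = r ↔ k % 3 = r') :
    genStep r = node false (if 0 ≠ r then genA else id) (genStep r') := by
  funext w n
  cases h : w 0 with
  | false =>
    rw [genStep_of_head_false r w h]
    cases n <;> split_ifs <;> simp [node, h, genA, flipAt]
  | true =>
    cases n with
    | zero => simp [node, h, (genStep_of_head_true hr w h 0).2]
    | succ n => simp [node, h, (genStep_of_head_true hr w h n).1]

lemma genB_eq_node : genB = node false genA genC := by
  simpa [genB, genC] using genStep_eq_node (r := 2) (r' := 1) (by omega)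

lemma genC_eq_node : genC = node false genA genD := by
  simpa [genC, genD] using genStep_eq_node (r := 1) (r' := 0) (by omega)

lemma genD_eq_node : genD = node false id genB := by
  simpa [genD, genB] using genStep_eq_node (r := 0) (r' := 2) (by omega)

/-- Formal letters standing for the generators. -/
inductive Letter
  | a | b | c | d

open Letter

instance : Nonempty Letter := ⟨a⟩

instance : Finite Letter :=
  Set.finite_univ_iff.1 <| (Set.toFinite {a, b, c, d}).subset fun x _ => by cases x <;> simp

/-- The generator named by a letter. -/
def gen : Letter → Seq → Seq
  | a => genA
  | b => genB
  | c => genC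
  | d => genD

/-- The transformation given by a formal word. -/
def eval : List Letter → Seq → Seq
  | [] => id
  | x :: t => gen x ∘ eval t

lemma exists_eval_eq_comp (l : List (Seq → Seq)) (hl : ∀ s ∈ l, s ∈ grigGens) :
    ∃ w : List Letter, w.length = l.length ∧ eval w = comp l := by
  induction l with
  | nil => exact ⟨[], rfl, rfl⟩
  | cons s t ih =>
    obtain ⟨w, hw, he⟩ := ih fun s hs => hl s (List.mem_cons_of_mem _ hs)
    have hs : ∃ x, gen x = s := by
      rcases hl s List.mem_cons_self with h | h | h | h
      exacts [⟨a, h.symm⟩, ⟨b, h.symm⟩, ⟨c, h.symm⟩, ⟨d, h.symm⟩]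
    obtain ⟨x, rfl⟩ := hs
    exact ⟨x :: w, by simp [hw], by simp [eval, he, comp]⟩

/-- The product of two letters other than `a` in the Klein four-group `{1, b, c, d}`, as a word. -/
def kleinMul : Letter → Letter → List Letter
  | b, c => [d]
  | c, b => [d]
  | b, d => [c]
  | d, b => [c]
  | c, d => [b]
  | d, c => [b]
  | _, _ => []

/-- Left multiplication of an alternating word by a letter. -/
def push : Letter → List Letter → List Letter
  | x, [] => [x]
  | a, a :: t => t
  | a, y :: t => a :: y :: t
  | x, a :: t => x :: a :: t
  | x, y :: t => kleinMul x y ++ t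

/-- The alternating form of a word. -/
def reduce : List Letter → List Letter
  | [] => []
  | x :: t => push x (reduce t)

lemma genA_comp_genA : genA ∘ genA = id := by
  funext w n
  by_cases h : n = 0 <;> simp [genA, flipAt, h]

lemma firstZero_flipAt (w : Seq) (h : ∃ n, w n = false) :
    (∃ n, flipAt (firstZero w + 1) w n = false) ∧
      firstZero (flipAt (firstZero w + 1) w) = firstZero w := by
  have hm : w (firstZero w) = false := Nat.sInf_mem (s := {n | w n = false}) h
  have hm' : flipAt (firstZero w + 1) w (firstZero w) = false := by simp [flipAt, hm]
  refine ⟨⟨_, hm'⟩, le_antisymm (Nat.sInf_le hm') ?_⟩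
  refine le_csInf ⟨_, hm'⟩ fun n hn => ?_
  by_contra hlt
  push Not at hlt
  have : w n = false := by
    have h1 : n ≠ firstZero w + 1 := by omega
    simpa [flipAt, h1] using hn
  exact Nat.notMem_of_lt_sInf hlt this

lemma genStep_of_exists (r : ℕ) {w : Seq} (h : ∃ n, w n = false) :
    genStep r w = if firstZero w % 3 = r then w else flipAt (firstZero w + 1) w := by
  simp only [genStep, h, if_true, ne_eq, ite_not]

lemma genStep_comp_genStep (r r' : ℕ) (w : Seq) (h : ∃ n, w n = false) :
    genStep r (genStep r' w) =
      if (firstZero w % 3 = r ↔ firstZero w % 3 = r') then w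
      else flipAt (firstZero w + 1) w := by
  obtain ⟨h1, h2⟩ := firstZero_flipAt w h
  have hflip : flipAt (firstZero w + 1) (flipAt (firstZero w + 1) w) = w := by
    funext n
    by_cases hn : n = firstZero w + 1 <;> simp [flipAt, hn]
  rw [genStep_of_exists r' h]
  split_ifs with hr' hr hr <;> simp only [genStep_of_exists r h, genStep_of_exists r h1, h2]
  all_goals split_ifs <;> simp_all

lemma genStep_comp_self (r : ℕ) : genStep r ∘ genStep r = id := by
  funext w
  by_cases h : ∃ n, w n = false
  · simp [genStep_comp_genStep r r w h]
  · simp [genStep, h]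

lemma genStep_comp_of_ne {r r' r'' : ℕ}
    (hr : ∀ k, (k % 3 = r ↔ k % 3 = r') ↔ k % 3 = r'') :
    genStep r ∘ genStep r' = genStep r'' := by
  funext w
  by_cases h : ∃ n, w n = false
  · rw [Function.comp_apply, genStep_comp_genStep r r' w h]
    simp only [genStep, h, hr, if_true]
    split_ifs <;> simp_all
  · simp [genStep, h]

lemma eval_append (u v : List Letter) : eval (u ++ v) = eval u ∘ eval v := by
  induction u with
  | nil => rfl
  | cons x t ih => simp [eval, ih, Function.comp_assoc]

lemma eval_kleinMul (x y : Letter) (hx : x ≠ a) (hy : y ≠ a) :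
    eval (kleinMul x y) = gen x ∘ gen y := by
  cases x <;> cases y <;> first | contradiction | skip
  all_goals simp only [kleinMul, eval, gen, genB, genC, genD, genStep_comp_self, Function.comp_id]
  all_goals exact (genStep_comp_of_ne (by omega)).symm

lemma eval_push (x : Letter) (t : List Letter) : eval (push x t) = gen x ∘ eval t := by
  cases t with
  | nil => simp [push, eval]
  | cons y t =>
    by_cases hx : x = a <;> by_cases hy : y = a
    · subst hx hy
      simp only [push, eval, gen, ← Function.comp_assoc, genA_comp_genA, Function.id_comp]
    · subst hx
      cases y <;> simp_all [push, eval]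
    · subst hy
      cases x <;> simp_all [push, eval]
    · have : push x (y :: t) = kleinMul x y ++ t := by cases x <;> cases y <;> simp_all [push]
      rw [this, eval_append, eval_kleinMul x y hx hy, eval, Function.comp_assoc]

lemma eval_reduce (l : List Letter) : eval (reduce l) = eval l := by
  induction l with
  | nil => rfl
  | cons x t ih => rw [reduce, eval_push, ih, eval]

/-- Words in which `a` alternates with the other letters; if nonempty, they begin with `a`
exactly when the Boolean is `true`. -/
inductive Alternating : Bool → List Letter → Prop
  | nil (e : Bool) : Alternating e []
  | cons_a {t : List Letter} : Alternating false t → Alternating true (a :: t)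
  | cons_ne {x : Letter} {t : List Letter} :
      x ≠ a → Alternating true t → Alternating false (x :: t)

lemma alternating_push {e : Bool} {t : List Letter} (x : Letter) (ht : Alternating e t) :
    ∃ e', Alternating e' (push x t) := by
  cases ht with
  | nil =>
    cases x
    · exact ⟨true, .cons_a (.nil _)⟩
    all_goals exact ⟨false, .cons_ne nofun (.nil _)⟩
  | cons_a ht =>
    cases x
    · exact ⟨_, ht⟩
    all_goals exact ⟨false, .cons_ne nofun (.cons_a ht)⟩
  | @cons_ne y t hy ht =>
    cases x <;> cases y <;> first | contradiction | skip
    all_goals first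
      | exact ⟨_, ht⟩
      | exact ⟨true, .cons_a (.cons_ne nofun ht)⟩
      | exact ⟨false, .cons_ne nofun ht⟩

lemma alternating_reduce (l : List Letter) : ∃ e, Alternating e (reduce l) := by
  induction l with
  | nil => exact ⟨true, .nil _⟩
  | cons x t ih =>
    obtain ⟨e, he⟩ := ih
    exact alternating_push x he

/-- The weights on the generators for which the sections contract by the factor `η`. -/
def letterWeight (η : ℝ) : Letter → ℝ
  | a => 1 - η ^ 3
  | b => η ^ 3
  | c => 1 - η ^ 2
  | d => 1 - η

/-- The total weight of a word. -/
def weight (η : ℝ) (l : List Letter) : ℝ := (l.map (letterWeight η)).sum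

@[simp] lemma weight_nil (η : ℝ) : weight η [] = 0 := rfl

@[simp] lemma weight_cons (η : ℝ) (x : Letter) (t : List Letter) :
    weight η (x :: t) = letterWeight η x + weight η t := by simp [weight]

@[simp] lemma weight_append (η : ℝ) (u v : List Letter) :
    weight η (u ++ v) = weight η u + weight η v := by simp [weight]

section Weights

variable {η : ℝ}

lemma root_lt_one (hη : 0 < η) (hroot : η ^ 3 + η ^ 2 + η = 2) : η < 1 := by
  by_contra! h
  nlinarith [one_le_pow₀ h (n := 3), one_le_pow₀ h (n := 2)]

lemma letterWeight_pos (hη : 0 < η) (h1 : η < 1) (x : Letter) : 0 < letterWeight η x := by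
  cases x <;> simp only [letterWeight]
  · linarith [pow_lt_one₀ hη.le h1 (n := 3) (by norm_num)]
  · positivity
  · linarith [pow_lt_one₀ hη.le h1 (n := 2) (by norm_num)]
  · linarith

lemma letterWeight_le_one (hη : 0 < η) (h1 : η < 1) (x : Letter) : letterWeight η x ≤ 1 := by
  cases x <;> simp only [letterWeight]
  · linarith [pow_pos hη 3]
  · exact pow_le_one₀ hη.le h1.le
  · linarith [pow_pos hη 2]
  · linarith

lemma weight_nonneg (hη : 0 < η) (h1 : η < 1) (l : List Letter) : 0 ≤ weight η l := by
  induction l with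
  | nil => simp
  | cons x t ih => simpa using add_nonneg (letterWeight_pos hη h1 x).le ih

lemma weight_le_length (hη : 0 < η) (h1 : η < 1) (l : List Letter) :
    weight η l ≤ l.length := by
  induction l with
  | nil => simp
  | cons x t ih =>
    have := letterWeight_le_one hη h1 x
    simp
    linarith

lemma weight_kleinMul (hη : 0 < η) (hroot : η ^ 3 + η ^ 2 + η = 2) (x y : Letter) :
    weight η (kleinMul x y) ≤ letterWeight η x + letterWeight η y := by
  have h1 := root_lt_one hη hroot
  have hx := letterWeight_pos hη h1
  have h3 := pow_pos hη 3
  have h2 : η ^ 2 ≤ η := by nlinarith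
  have hb := hx x
  have hy := hx y
  cases x <;> cases y <;> simp only [kleinMul, weight_cons, weight_nil] <;>
    first
      | linarith
      | (simp only [letterWeight]; linarith)

lemma weight_push (hη : 0 < η) (hroot : η ^ 3 + η ^ 2 + η = 2) (x : Letter) (t : List Letter) :
    weight η (push x t) ≤ letterWeight η x + weight η t := by
  have hp := letterWeight_pos hη (root_lt_one hη hroot) a
  have hk := weight_kleinMul hη hroot
  cases t with
  | nil => simp [push]
  | cons y t =>
    have := hk x y
    cases x <;> cases y <;> simp only [push, weight_cons, weight_append] <;> linarith

lemma weight_reduce (hη : 0 < η) (hroot : η ^ 3 + η ^ 2 + η = 2) (l : List Letter) :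
    weight η (reduce l) ≤ weight η l := by
  induction l with
  | nil => simp [reduce]
  | cons x t ih =>
    rw [weight_cons]
    exact (weight_push hη hroot x _).trans (by linarith)

end Weights

/-- The first-level decomposition of a generator: the words for its two sections (a generator
other than `a` fixes the first letter). -/
def letterSection : Bool → Letter → List Letter
  | _, a => []
  | false, b => [a]
  | true, b => [c]
  | false, c => [a]
  | true, c => [d]
  | false, d => []
  | true, d => [b]

/-- Whether a letter is `a`. -/
def isA : Letter → Bool
  | a => true
  | _ => false

lemma gen_eq_node (x : Letter) :
    gen x = node (isA x) (eval (letterSection false x)) (eval (letterSection true x)) := by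
  cases x
  · exact genA_eq_node
  · exact genB_eq_node
  · exact genC_eq_node
  · exact genD_eq_node

/-- Whether the transformation given by a word flips the first letter. -/
def flips : List Letter → Bool
  | [] => false
  | x :: t => xor (isA x) (flips t)

/-- A word for the section of a word at the vertex `i` of the first level. -/
def sectionWord (i : Bool) : List Letter → List Letter
  | [] => []
  | x :: t => letterSection (xor (flips t) i) x ++ sectionWord i t

lemma eval_eq_node (l : List Letter) :
    eval l = node (flips l) (eval (sectionWord false l)) (eval (sectionWord true l)) := by
  induction l with
  | nil => exact id_eq_node
  | cons x t ih =>
    rw [eval, ih, gen_eq_node, node_comp]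
    cases h : flips t <;> simp [flips, sectionWord, h, eval_append]

section Contraction

variable {η : ℝ}

lemma weight_letterSection_add (hroot : η ^ 3 + η ^ 2 + η = 2) (i : Bool) (x : Letter)
    (hx : x ≠ a) :
    weight η (letterSection i x) + weight η (letterSection (!i) x) =
      η * (letterWeight η x + letterWeight η a) := by
  cases i <;> cases x <;> first | contradiction | skip
  all_goals
    simp only [letterSection, letterWeight, weight_cons, weight_nil, Bool.not_false, Bool.not_true]
  all_goals first
    | linear_combination -hroot
    | linear_combination (η - 1) * hroot
    | linear_combination η * hroot

lemma weight_sectionWord_add (hroot : η ^ 3 + η ^ 2 + η = 2) {e : Bool} {l : List Letter}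
    (h : Alternating e l) (hη : 0 ≤ η) (ha : 0 ≤ letterWeight η a) :
    weight η (sectionWord false l) + weight η (sectionWord true l) ≤
      η * (weight η l + if e then 0 else letterWeight η a) := by
  induction h with
  | nil e =>
    simp only [sectionWord, weight_nil]
    split_ifs
    · simp
    · simpa using mul_nonneg hη ha
  | cons_a _ ih =>
    simp [sectionWord, letterSection] at ih ⊢
    linarith
  | @cons_ne x t hx _ ih =>
    have := weight_letterSection_add hroot (flips t) x hx
    simp only [sectionWord, weight_append, weight_cons, Bool.xor_false, Bool.xor_true] at ih ⊢
    simp only [if_true, Bool.false_eq_true, if_false] at ih ⊢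
    linarith

lemma weight_sectionWord_add_le (hη : 0 < η) (hroot : η ^ 3 + η ^ 2 + η = 2) (l : List Letter) :
    weight η (sectionWord false (reduce l)) + weight η (sectionWord true (reduce l)) ≤
      η * (weight η l + 1) := by
  have h1 := root_lt_one hη hroot
  obtain ⟨e, he⟩ := alternating_reduce l
  refine (weight_sectionWord_add hroot he hη.le (letterWeight_pos hη h1 a).le).trans ?_
  refine mul_le_mul_of_nonneg_left (add_le_add (weight_reduce hη hroot l) ?_) hη.le
  split_ifs
  · exact zero_le_one
  · exact letterWeight_le_one hη h1 a

end Contraction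

/-- The transformations given by words of weight at most `K`. -/
def lightElements (η K : ℝ) : Set (Seq → Seq) := eval '' {l | weight η l ≤ K}

lemma finite_lightElements {η : ℝ} (hη : 0 < η) (h1 : η < 1) (K : ℝ) :
    (lightElements η K).Finite := by
  obtain ⟨δ, hδ, hle⟩ : ∃ δ > 0, ∀ x, δ ≤ letterWeight η x := by
    obtain ⟨x, hx⟩ := Finite.exists_min (letterWeight η)
    exact ⟨_, letterWeight_pos hη h1 x, hx⟩
  have hlen (l : List Letter) : δ * l.length ≤ weight η l := by
    induction l with
    | nil => simp
    | cons x t ih =>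
      have := hle x
      simp
      linarith
  refine Set.Finite.image _ ((List.finite_length_le Letter ⌊K / δ⌋₊).subset fun l hl => ?_)
  refine Nat.le_floor ?_
  rw [le_div_iff₀ hδ]
  linarith [hlen l, show weight η l ≤ K from hl]

/-- One step of a stack machine assembling transformations: push an element of `B`, or combine
the two topmost entries by `node`. -/
def stackStep {B : Set (Seq → Seq)} (s : List (Seq → Seq)) : B ⊕ Bool → List (Seq → Seq)
  | .inl f => f :: s
  | .inr e =>
    match s with
    | f₁ :: f₀ :: s => node e f₀ f₁ :: s
    | s => s

lemma add_rpow_le_two_mul {p x y z : ℝ} (hp0 : 0 ≤ p) (hp : p ≤ 1) (hx : 0 ≤ x) (hy : 0 ≤ y)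
    (hz : x + y ≤ z) : x ^ p + y ^ p ≤ 2 * (z / 2) ^ p := by
  have h := (Real.concaveOn_rpow hp0 hp).2 (Set.mem_Ici.2 hx) (Set.mem_Ici.2 hy)
    (show (0 : ℝ) ≤ 1 / 2 by norm_num) (show (0 : ℝ) ≤ 1 / 2 by norm_num) (by norm_num)
  simp only [smul_eq_mul] at h
  have h2 : (1 / 2 * x + 1 / 2 * y) ^ p ≤ (z / 2) ^ p :=
    Real.rpow_le_rpow (by positivity) (by linarith) hp0
  linarith

/-- Every word of weight `n` is produced by a stack program of length less than `2 (n + 1) ^ p`. -/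
lemma exists_stack_program {η p θ K : ℝ} (hη : 0 < η) (hroot : η ^ 3 + η ^ 2 + η = 2)
    (hp0 : 0 ≤ p) (hp : p ≤ 1) (hθ1 : θ ≤ 1) (hθ : 2 * (θ / 2) ^ p = 1) (hθ0 : 0 ≤ θ)
    (hK0 : 0 ≤ K) (hK : ∀ n, K < n → η * (n + 1) + 2 ≤ θ * (n + 1)) (N : ℕ) :
    ∀ l : List Letter, weight η l ≤ N → ∃ q : List (lightElements η K ⊕ Bool),
      (q.length + 1 : ℝ) ≤ 2 * (weight η l + 1) ^ p ∧
        ∀ s, q.foldl stackStep s = eval l :: s := by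
  have h1 := root_lt_one hη hroot
  have light (l : List Letter) (hl : weight η l ≤ K) :
      ∃ q : List (lightElements η K ⊕ Bool),
        (q.length + 1 : ℝ) ≤ 2 * (weight η l + 1) ^ p ∧
          ∀ s, q.foldl stackStep s = eval l :: s := by
    refine ⟨[.inl ⟨eval l, l, hl, rfl⟩], ?_, fun s => rfl⟩
    have := Real.one_le_rpow (show 1 ≤ weight η l + 1 by linarith [weight_nonneg hη h1 l]) hp0
    simp
    linarith
  induction N with
  | zero => exact fun l hl => light l (hl.trans (by simpa using hK0))
  | succ N ih =>
    intro l hl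
    rcases le_or_gt (weight η l) K with hlK | hlK
    · exact light l hlK
    have hsum := weight_sectionWord_add_le hη hroot l
    have hcon := hK _ hlK
    set u := sectionWord false (reduce l)
    set v := sectionWord true (reduce l)
    have hu := weight_nonneg hη h1 u
    have hv := weight_nonneg hη h1 v
    have hw := weight_nonneg hη h1 l
    push_cast at hl
    have hθw : θ * (weight η l + 1) ≤ weight η l + 1 :=
      mul_le_of_le_one_left (by linarith) hθ1
    obtain ⟨q₀, hq₀, hr₀⟩ := ih u (by linarith)
    obtain ⟨q₁, hq₁, hr₁⟩ := ih v (by linarith)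
    refine ⟨q₀ ++ q₁ ++ [.inr (flips (reduce l))], ?_, fun s => ?_⟩
    · have h := add_rpow_le_two_mul hp0 hp (add_nonneg hu zero_le_one)
        (add_nonneg hv zero_le_one)
        (show weight η u + 1 + (weight η v + 1) ≤ θ * (weight η l + 1) by linarith)
      rw [mul_div_right_comm, Real.mul_rpow (by positivity) (by positivity), ← mul_assoc, hθ,
        one_mul] at h
      push_cast [List.length_append, List.length_singleton]
      linarith
    · rw [List.foldl_append, List.foldl_append, hr₀, hr₁, ← eval_reduce l, eval_eq_node (reduce l)]
      rfl

lemma grigGrowth_le_of_programs {T : Type*} [Finite T] (dec : List T → Seq → Seq) (R M : ℕ)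
    (h : ∀ l : List Letter, l.length ≤ R → ∃ q : List T, q.length ≤ M ∧ dec q = eval l) :
    grigGrowth R ≤ Nat.card (Option T) ^ M := by
  have hex (f : {f : Seq → Seq | ∃ l : List (Seq → Seq),
      (∀ s ∈ l, s ∈ grigGens) ∧ l.length ≤ R ∧ comp l = f}) :
      ∃ q : List T, q.length ≤ M ∧ dec q = f := by
    obtain ⟨f, l, hl, hR, rfl⟩ := f
    obtain ⟨w, hw, he⟩ := exists_eval_eq_comp l hl
    obtain ⟨q, hq, hd⟩ := h w (hw.trans_le hR)
    exact ⟨q, hq, hd.trans he⟩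
  choose q hq hd using hex
  have hinj : Function.Injective fun f (i : Fin M) => (q f)[(i : ℕ)]? := by
    intro f g hfg
    have : q f = q g := by
      refine List.ext_getElem? fun i => ?_
      by_cases hi : i < M
      · exact congrFun hfg ⟨i, hi⟩
      · rw [List.getElem?_eq_none (by have := hq f; omega),
          List.getElem?_eq_none (by have := hq g; omega)]
    exact Subtype.ext (by rw [← hd f, ← hd g, this])
  exact (Nat.card_le_card_of_injective _ hinj).trans_eq (by simp [Nat.card_fun])

lemma exists_grigGrowth_le_exp {η p : ℝ} (hη : 0 < η) (hroot : η ^ 3 + η ^ 2 + η = 2)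
    (hp : Real.log 2 / (Real.log 2 - Real.log η) < p) (hp1 : p ≤ 1) :
    ∃ C : ℝ, 1 ≤ C ∧ ∀ R : ℕ, 1 ≤ R → (grigGrowth R : ℝ) ≤ Real.exp ((C * (R : ℝ)) ^ p) := by
  have h1 := root_lt_one hη hroot
  have hlog2 : 0 < Real.log 2 := Real.log_pos (by norm_num)
  have hlogη : Real.log η < 0 := Real.log_neg hη h1
  have hp0 : 0 < p := lt_trans (div_pos hlog2 (by linarith)) hp
  set θ : ℝ := 2 * 2 ^ (-1 / p) with hθdef
  have hθ0 : 0 < θ := by positivity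
  have hθlog : Real.log θ = Real.log 2 - Real.log 2 / p := by
    rw [hθdef, Real.log_mul (by norm_num) (by positivity), Real.log_rpow (by norm_num)]
    ring
  have hθ : 2 * (θ / 2) ^ p = 1 := by
    rw [hθdef, mul_div_cancel_left₀ _ two_ne_zero, ← Real.rpow_mul (by norm_num),
      div_mul_cancel₀ _ hp0.ne', Real.rpow_neg_one]
    norm_num
  have hθ1 : θ ≤ 1 := by
    rw [← Real.log_nonpos_iff hθ0.le, hθlog, sub_nonpos, le_div_iff₀ hp0]
    nlinarith
  have hηθ : η < θ := by
    rw [← Real.log_lt_log_iff hη hθ0, hθlog]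
    rw [div_lt_iff₀ (by linarith)] at hp
    have : Real.log 2 / p < Real.log 2 - Real.log η := by
      rw [div_lt_iff₀ hp0]
      linarith
    linarith
  set K : ℝ := 2 / (θ - η)
  have hK0 : 0 ≤ K := div_nonneg (by norm_num) (by linarith)
  have hK (n : ℝ) (hn : K < n) : η * (n + 1) + 2 ≤ θ * (n + 1) := by
    rw [div_lt_iff₀ (by linarith)] at hn
    linarith
  have : Finite (lightElements η K) := finite_lightElements hη h1 K
  set A : ℕ := Nat.card (Option (lightElements η K ⊕ Bool))
  have hA : 3 ≤ A := by
    simp [A, Finite.card_option, Nat.card_sum]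
  have hlogA : 1 ≤ Real.log A := by
    rw [Real.le_log_iff_exp_le (by positivity)]
    have : (3 : ℝ) ≤ A := by exact_mod_cast hA
    linarith [Real.exp_one_lt_three]
  refine ⟨(2 * Real.log A) ^ p⁻¹ * 2, ?_, fun R hR => ?_⟩
  · have := Real.one_le_rpow (show 1 ≤ 2 * Real.log A by linarith) (inv_nonneg.2 hp0.le)
    linarith
  have hR1 : (1 : ℝ) ≤ R := by exact_mod_cast hR
  have hcount : grigGrowth R ≤ A ^ ⌊2 * ((R : ℝ) + 1) ^ p⌋₊ := by
    refine grigGrowth_le_of_programs (fun q => (q.foldl stackStep []).headD id) R _ fun l hl => ?_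
    have hlR : weight η l ≤ R := (weight_le_length hη h1 l).trans (by exact_mod_cast hl)
    obtain ⟨q, hq, hs⟩ :=
      exists_stack_program hη hroot hp0.le hp1 hθ1 hθ hθ0.le hK0 hK R l hlR
    refine ⟨q, Nat.le_floor ?_, by simp [hs]⟩
    have := Real.rpow_le_rpow (by linarith [weight_nonneg hη h1 l])
      (show weight η l + 1 ≤ (R : ℝ) + 1 by linarith) hp0.le
    linarith
  calc (grigGrowth R : ℝ) ≤ (A : ℝ) ^ ⌊2 * ((R : ℝ) + 1) ^ p⌋₊ := by exact_mod_cast hcount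
    _ = Real.exp (Real.log A * ⌊2 * ((R : ℝ) + 1) ^ p⌋₊) := by
      rw [← Real.rpow_natCast, Real.rpow_def_of_pos (by positivity)]
    _ ≤ Real.exp (((2 * Real.log A) ^ p⁻¹ * 2 * R) ^ p) := by
      refine Real.exp_le_exp.2 ?_
      have hfl : (⌊2 * ((R : ℝ) + 1) ^ p⌋₊ : ℝ) ≤ 2 * (2 * (R : ℝ)) ^ p := by
        refine (Nat.floor_le (by positivity)).trans ?_
        have := Real.rpow_le_rpow (by positivity) (show (R : ℝ) + 1 ≤ 2 * R by linarith) hp0.le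
        linarith
      rw [mul_assoc, Real.mul_rpow (by positivity) (by positivity), ← Real.rpow_mul (by positivity),
        inv_mul_cancel₀ hp0.ne', Real.rpow_one]
      nlinarith

lemma limsup_le_of_forall_gt {u : ℕ → ℝ} {L : ℝ} (hL : 0 ≤ L)
    (h : ∀ β, L < β → ∀ᶠ n in Filter.atTop, u n ≤ β) : Filter.limsup u Filter.atTop ≤ L := by
  refine le_of_forall_gt_imp_ge_of_dense fun β hβ => ?_
  rw [Filter.limsup_eq]
  by_cases hb : BddBelow {x | ∀ᶠ n in Filter.atTop, u n ≤ x}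
  · exact csInf_le hb (h β hβ)
  · rw [Real.sInf_of_not_bddBelow hb]
    linarith

lemma eventually_log_log_div_log_le {g : ℕ → ℕ} {α β C : ℝ} (hα : 0 ≤ α) (hαβ : α < β)
    (hC : 1 ≤ C) (hg : ∀ R : ℕ, 1 ≤ R → (g R : ℝ) ≤ Real.exp ((C * (R : ℝ)) ^ α)) :
    ∀ᶠ R : ℕ in Filter.atTop, Real.log (Real.log (g R)) / Real.log (R : ℝ) ≤ β := by
  have htend : Filter.Tendsto (fun R : ℕ => Real.log (R : ℝ)) Filter.atTop Filter.atTop :=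
    Real.tendsto_log_atTop.comp tendsto_natCast_atTop_atTop
  filter_upwards [htend.eventually_ge_atTop (α * Real.log C / (β - α)),
    Filter.eventually_ge_atTop 2] with R hR hR2
  have hR2' : (2 : ℝ) ≤ R := by exact_mod_cast hR2
  have hlogR : 0 < Real.log (R : ℝ) := Real.log_pos (by linarith)
  have hlogC : 0 ≤ Real.log C := Real.log_nonneg hC
  rw [div_le_iff₀ (by linarith)] at hR
  rw [div_le_iff₀ hlogR]
  have hmain : Real.log (Real.log (g R)) ≤ α * (Real.log C + Real.log R) := by
    rcases Nat.eq_zero_or_pos (g R) with h0 | h0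
    · simp only [h0, Nat.cast_zero, Real.log_zero]
      positivity
    have hle : Real.log (g R) ≤ (C * (R : ℝ)) ^ α := by
      rw [Real.log_le_iff_le_exp (by exact_mod_cast h0)]
      exact hg R (by omega)
    rcases (Real.log_nonneg (show (1 : ℝ) ≤ g R by exact_mod_cast h0)).eq_or_lt with hz | hpos
    · rw [← hz, Real.log_zero]
      positivity
    · refine (Real.log_le_log hpos hle).trans_eq ?_
      rw [Real.log_rpow (by positivity), Real.log_mul (by positivity) (by positivity)]
  linarith

/-- Let `G` be the first Grigorchuk group and let
`η ≈ 0.81054` be the positive root of `x³ + x² + x − 2`. Then for every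
`α > log 2 / (log 2 − log η) ≈ 0.76743` one has `γ_G(R) ≼ exp(R^α)`;
equivalently, `limsup_{R→∞} (log log γ_G(R))/(log R) ≤ log 2/(log 2 − log η)`. -/
theorem grigorchuk_growth_upper_bound
    (η : ℝ) (hη : 0 < η) (hroot : η ^ 3 + η ^ 2 + η = 2) :
    (∀ α : ℝ, Real.log 2 / (Real.log 2 - Real.log η) < α →
      ∃ C : ℝ, 1 ≤ C ∧ ∀ R : ℕ, 1 ≤ R →
        (grigGrowth R : ℝ) ≤ Real.exp ((C * (R : ℝ)) ^ α)) ∧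
    Filter.limsup
        (fun R : ℕ => Real.log (Real.log (grigGrowth R)) / Real.log (R : ℝ))
        Filter.atTop ≤ Real.log 2 / (Real.log 2 - Real.log η) := by
  have hlog2 : 0 < Real.log 2 := Real.log_pos (by norm_num)
  have hlogη : Real.log η < 0 := Real.log_neg hη (root_lt_one hη hroot)
  have hL0 : 0 < Real.log 2 / (Real.log 2 - Real.log η) := div_pos hlog2 (by linarith)
  have hL1 : Real.log 2 / (Real.log 2 - Real.log η) < 1 := by
    rw [div_lt_one (by linarith)]
    linarith
  have hgrowth (α : ℝ) (hα : Real.log 2 / (Real.log 2 - Real.log η) < α) :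
      ∃ C : ℝ, 1 ≤ C ∧ ∀ R : ℕ, 1 ≤ R →
        (grigGrowth R : ℝ) ≤ Real.exp ((C * (R : ℝ)) ^ α) := by
    obtain ⟨C, hC, h⟩ :=
      exists_grigGrowth_le_exp hη hroot (lt_min hα hL1) (min_le_right α 1)
    refine ⟨C, hC, fun R hR => (h R hR).trans (Real.exp_le_exp.2 ?_)⟩
    have hR1 : (1 : ℝ) ≤ R := by exact_mod_cast hR
    exact Real.rpow_le_rpow_of_exponent_le (one_le_mul_of_one_le_of_one_le hC hR1)
      (min_le_left α 1)
  refine ⟨hgrowth, limsup_le_of_forall_gt hL0.le fun β hβ => ?_⟩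
  obtain ⟨α, hα, hαβ⟩ := exists_between hβ
  obtain ⟨C, hC, h⟩ := hgrowth α hα
  exact eventually_log_log_div_log_le (hL0.le.trans hα.le) hαβ hC h

end Grigorchuk
end
end
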